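/- There exists a constant C > 0 depending only on P and Q such that for every admissible prime p and all 1-bounded functions f0, f1, f2 : F_p^2 → ℂ where f2 is an eigenfunction with respect to the second coordinate, the counting operator 𝔼_{x1,x2,y} f0(x1,x2) f1(x1+P(y),x2) f2(x1,x2+Q(y)) equals 𝔼_{x1,x2} ( f0(x1,x2) · 𝔼_a f1(a,x2) · 𝔼_b f2(x1,b) ) up to an error of absolute value at most C · p^{-1/640}. -/

import Mathlib

open scoped BigOperators ComplexOrder
open Polynomial

noncomputable section

namespace RatCorners

/-- Reduction of a rational number modulo `p` (genuine when `p` does not divide the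
denominator). -/
def ratRed (p : ℕ) (q : ℚ) : ZMod p := (q.num : ZMod p) * (q.den : ZMod p)⁻¹

/-- Coefficientwise reduction of a polynomial with rational coefficients modulo `p`. -/
def polyRed (p : ℕ) (f : Polynomial ℚ) : Polynomial (ZMod p) :=
  f.sum fun n a => Polynomial.C (ratRed p a) * Polynomial.X ^ n

/-- `p` divides no denominator of any coefficient of `P` (with numerator and denominator
of `P` in lowest terms). -/
def Admissible (p : ℕ) (P : RatFunc ℚ) : Prop :=
  (∀ n, ¬ p ∣ (P.num.coeff n).den) ∧ ∀ n, ¬ p ∣ (P.denom.coeff n).den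

/-- `y` is a pole of the reduction of `P` modulo `p`. -/
def IsPole (p : ℕ) (P : RatFunc ℚ) (y : ZMod p) : Prop :=
  (polyRed p P.denom).eval y = 0

instance (p : ℕ) (P : RatFunc ℚ) : DecidablePred (IsPole p P) := fun y =>
  inferInstanceAs (Decidable ((polyRed p P.denom).eval y = 0))

/-- Evaluation of the reduction of `P` modulo `p` at `y` (junk value `0` at poles). -/
def evalRed (p : ℕ) (P : RatFunc ℚ) (y : ZMod p) : ZMod p :=
  (polyRed p P.num).eval y * ((polyRed p P.denom).eval y)⁻¹

/-- A function is `1`-bounded if all its values have norm at most `1`. -/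
def OneBounded {α : Type*} (f : α → ℂ) : Prop := ∀ x, ‖f x‖ ≤ 1

/-- The formal derivative of a rational function. -/
def ratDeriv (P : RatFunc ℚ) : RatFunc ℚ :=
  algebraMap (Polynomial ℚ) (RatFunc ℚ)
      (Polynomial.derivative P.num * P.denom - P.num * Polynomial.derivative P.denom) /
    algebraMap (Polynomial ℚ) (RatFunc ℚ) (P.denom ^ 2)

/-- Substitution of the variable `y i` into a rational function `P ∈ ℚ(t)`, producing an
element of the rational function field `ℚ(y 0, …, y (n-1))`. -/
def substAt {n : ℕ} (P : RatFunc ℚ) (i : Fin n) : FractionRing (MvPolynomial (Fin n) ℚ) :=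
  Polynomial.eval₂
      ((algebraMap (MvPolynomial (Fin n) ℚ) (FractionRing (MvPolynomial (Fin n) ℚ))).comp
        MvPolynomial.C)
      (algebraMap (MvPolynomial (Fin n) ℚ) (FractionRing (MvPolynomial (Fin n) ℚ))
        (MvPolynomial.X i)) P.num /
    Polynomial.eval₂
      ((algebraMap (MvPolynomial (Fin n) ℚ) (FractionRing (MvPolynomial (Fin n) ℚ))).comp
        MvPolynomial.C)
      (algebraMap (MvPolynomial (Fin n) ℚ) (FractionRing (MvPolynomial (Fin n) ℚ))
        (MvPolynomial.X i)) P.denom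

variable (p : ℕ) [NeZero p]

/-- The counting operator `𝔼_{x₁,x₂,y} f₀(x₁,x₂) f₁(x₁+P(y),x₂) f₂(x₁,x₂+Q(y))`,
where the average in `y` avoids the poles of `P` and `Q` but is still normalized by `1/p`. -/
def cornerAvg (P Q : RatFunc ℚ) (f0 f1 f2 : ZMod p × ZMod p → ℂ) : ℂ :=
  (p : ℂ)⁻¹ ^ 3 * ∑ x1 : ZMod p, ∑ x2 : ZMod p, ∑ y : ZMod p,
    if ¬ IsPole p P y ∧ ¬ IsPole p Q y then
      f0 (x1, x2) * f1 (x1 + evalRed p P y, x2) * f2 (x1, x2 + evalRed p Q y)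
    else 0

/-- The main term `𝔼_{x₁,x₂} f₀(x₁,x₂) · 𝔼_a f₁(a,x₂) · 𝔼_b f₂(x₁,b)`. -/
def mainTerm (f0 f1 f2 : ZMod p × ZMod p → ℂ) : ℂ :=
  (p : ℂ)⁻¹ ^ 2 * ∑ x1 : ZMod p, ∑ x2 : ZMod p,
    f0 (x1, x2) * ((p : ℂ)⁻¹ * ∑ a : ZMod p, f1 (a, x2)) *
      ((p : ℂ)⁻¹ * ∑ b : ZMod p, f2 (x1, b))

/-- The `L^r` norm with respect to the uniform probability measure on `(ZMod p)²`. -/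
def Lnorm (r : ℝ) (f : ZMod p × ZMod p → ℂ) : ℝ :=
  ((p : ℝ)⁻¹ ^ 2 * ∑ x : ZMod p × ZMod p, ‖f x‖ ^ r) ^ r⁻¹

/-- The Gowers norm `‖f‖_{U²(0×F_p)}` along the second coordinate axis. -/
def U2vert (f : ZMod p × ZMod p → ℂ) : ℝ :=
  ((p : ℝ)⁻¹ ^ 4 * (∑ x : ZMod p × ZMod p, ∑ h : ZMod p, ∑ k : ZMod p,
      f x * (starRingEnd ℂ) (f (x + (0, h))) * (starRingEnd ℂ) (f (x + (0, k))) *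
        f (x + (0, h + k))).re) ^ ((4:ℝ)⁻¹)

/-- The Gowers norm `‖f‖_{U²(F_p×0)}` along the first coordinate axis. -/
def U2horiz (f : ZMod p × ZMod p → ℂ) : ℝ :=
  ((p : ℝ)⁻¹ ^ 4 * (∑ x : ZMod p × ZMod p, ∑ h : ZMod p, ∑ k : ZMod p,
      f x * (starRingEnd ℂ) (f (x + (h, 0))) * (starRingEnd ℂ) (f (x + (k, 0))) *
        f (x + (h + k, 0))).re) ^ ((4:ℝ)⁻¹)

/-- The additive character `e_p(x) = e^{2πix/p}` on `ZMod p`. -/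
def ep (x : ZMod p) : ℂ := Complex.exp (2 * Real.pi * Complex.I * (x.val : ℂ) / (p : ℂ))

/-- `e(r) = e^{2πir}` for a real number `r`. -/
def eC (r : ℝ) : ℂ := Complex.exp (2 * Real.pi * Complex.I * (r : ℂ))

/-- The Fourier transform `f̂(ξ) = 𝔼_x f(x) e_p(−x·ξ)` on `(ZMod p)²`. -/
def dft (f : ZMod p × ZMod p → ℂ) (ξ : ZMod p × ZMod p) : ℂ :=
  (p : ℂ)⁻¹ ^ 2 * ∑ x : ZMod p × ZMod p, f x * ep p (-(x.1 * ξ.1 + x.2 * ξ.2))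

/-- `F₁(n₁,𝐡) = ∑_{n₂} Δ_{−𝐡} f̂₁(n₁,n₂)` where `Δ_h g(x) = g(x)·conj g(x+h)`. -/
def F1 (f : ZMod p × ZMod p → ℂ) (n1 : ZMod p) (h : ZMod p × ZMod p) : ℂ :=
  ∑ n2 : ZMod p, dft p f (n1, n2) * (starRingEnd ℂ) (dft p f ((n1, n2) + -h))

/-- `F₂(m₂,𝐡) = ∑_{m₁} Δ_{𝐡} f̂₂(m₁,m₂)` where `Δ_h g(x) = g(x)·conj g(x+h)`. -/
def F2 (f : ZMod p × ZMod p → ℂ) (m2 : ZMod p) (h : ZMod p × ZMod p) : ℂ :=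
  ∑ m1 : ZMod p, dft p f (m1, m2) * (starRingEnd ℂ) (dft p f ((m1, m2) + h))

/-- The `F_p`-points of the Roth variety for corners associated to `P, Q`:
tuples `(y₁,…,y₁₆)` (indexed here by `0,…,15`) avoiding all poles of `P` and `Q` and
satisfying the ten defining equations. -/
def IsRothPoint (P Q : RatFunc ℚ) (y : Fin 16 → ZMod p) : Prop :=
  (∀ i, ¬ IsPole p P (y i)) ∧ (∀ i, ¬ IsPole p Q (y i)) ∧
  evalRed p P (y 0) - evalRed p P (y 2) - evalRed p P (y 8) + evalRed p P (y 10) = 0 ∧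
  evalRed p P (y 1) - evalRed p P (y 3) - evalRed p P (y 9) + evalRed p P (y 11) = 0 ∧
  evalRed p P (y 4) - evalRed p P (y 6) - evalRed p P (y 12) + evalRed p P (y 14) = 0 ∧
  evalRed p P (y 5) - evalRed p P (y 7) - evalRed p P (y 13) + evalRed p P (y 15) = 0 ∧
  evalRed p Q (y 0) - evalRed p Q (y 1) - evalRed p Q (y 8) + evalRed p Q (y 9) = 0 ∧
  evalRed p Q (y 2) - evalRed p Q (y 6) - evalRed p Q (y 10) + evalRed p Q (y 14) = 0 ∧
  evalRed p Q (y 3) - evalRed p Q (y 7) - evalRed p Q (y 11) + evalRed p Q (y 15) = 0 ∧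
  evalRed p Q (y 4) - evalRed p Q (y 5) - evalRed p Q (y 12) + evalRed p Q (y 13) = 0 ∧
  evalRed p P (y 8) - evalRed p P (y 9) - evalRed p P (y 10) + evalRed p P (y 11) -
      evalRed p P (y 12) + evalRed p P (y 13) + evalRed p P (y 14) - evalRed p P (y 15) = 0 ∧
  evalRed p Q (y 8) - evalRed p Q (y 9) - evalRed p Q (y 10) + evalRed p Q (y 11) -
      evalRed p Q (y 12) + evalRed p Q (y 13) + evalRed p Q (y 14) - evalRed p Q (y 15) = 0

/-- `|Y(F_p)|`, the number of `F_p`-points of the Roth variety for corners. -/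
def rothCard (P Q : RatFunc ℚ) : ℕ :=
  Nat.card {y : Fin 16 → ZMod p // IsRothPoint p P Q y}

/-- `χ` is an eigenfunction with respect to the first coordinate:
`χ(x₁,x₂) = 1_E(x₂) e_p(φ(x₂)x₁) e(ψ(x₂))`. -/
def IsEigen1 (χ : ZMod p × ZMod p → ℂ) : Prop :=
  ∃ (E : Finset (ZMod p)) (φ : ZMod p → ZMod p) (ψ : ZMod p → ℝ),
    ∀ x1 x2 : ZMod p,
      χ (x1, x2) = (if x2 ∈ E then 1 else 0) * ep p (φ x2 * x1) * eC (ψ x2)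

/-- `χ` is an eigenfunction with respect to the second coordinate:
`χ(x₁,x₂) = 1_E(x₁) e_p(φ(x₁)x₂) e(ψ(x₁))`. -/
def IsEigen2 (χ : ZMod p × ZMod p → ℂ) : Prop :=
  ∃ (E : Finset (ZMod p)) (φ : ZMod p → ZMod p) (ψ : ZMod p → ℝ),
    ∀ x1 x2 : ZMod p,
      χ (x1, x2) = (if x1 ∈ E then 1 else 0) * ep p (φ x1 * x2) * eC (ψ x1)

/-- The two-term counting operator `𝔼_{x₁,x₂,y} f₀(x₁,x₂) f₁(x₁+P(y),x₂)`. -/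
def twoAvg1 (P : RatFunc ℚ) (f0 f1 : ZMod p × ZMod p → ℂ) : ℂ :=
  (p : ℂ)⁻¹ ^ 3 * ∑ x1 : ZMod p, ∑ x2 : ZMod p, ∑ y : ZMod p,
    if ¬ IsPole p P y then f0 (x1, x2) * f1 (x1 + evalRed p P y, x2) else 0

/-- The two-term counting operator `𝔼_{x₁,x₂,y} f₀(x₁,x₂) f₁(x₁,x₂+P(y))`. -/
def twoAvg2 (P : RatFunc ℚ) (f0 f1 : ZMod p × ZMod p → ℂ) : ℂ :=
  (p : ℂ)⁻¹ ^ 3 * ∑ x1 : ZMod p, ∑ x2 : ZMod p, ∑ y : ZMod p,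
    if ¬ IsPole p P y then f0 (x1, x2) * f1 (x1, x2 + evalRed p P y) else 0

theorem exists_ne_zero_sum_smul_eq_zero {F ι : Type*} [Field F] [Fintype ι] (N : ℕ)
    (B : ι → F[X]) (hB : ∀ k, (B k).natDegree < N) (hN : N < Fintype.card ι) :
    ∃ c : ι → F, c ≠ 0 ∧ ∑ k, c k • B k = 0 := by
  classical
  let L : (ι → F) →ₗ[F] (Fin N → F) :=
    LinearMap.pi fun n => ∑ k, (((B k).coeff n) • LinearMap.proj k : (ι → F) →ₗ[F] F)
  have hker : LinearMap.ker L ≠ ⊥ := by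
    apply LinearMap.ker_ne_bot_of_finrank_lt
    simpa using hN
  obtain ⟨c, hc, hc0⟩ := (Submodule.ne_bot_iff _).1 hker
  refine ⟨c, hc0, ?_⟩
  ext n
  simp only [finsetSum_coeff, coeff_smul, smul_eq_mul, coeff_zero]
  by_cases hn : n < N
  · have := congrFun (LinearMap.mem_ker.1 hc) ⟨n, hn⟩
    simpa [L, mul_comm] using this
  · refine Finset.sum_eq_zero fun k _ => ?_
    rw [coeff_eq_zero_of_natDegree_lt (lt_of_lt_of_le (hB k) (not_lt.1 hn)), mul_zero]

theorem sum_ne_zero_of_rootMultiplicity_injOn {K ι : Type*} [Field K] [Fintype ι] (x : K)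
    (T : ι → K[X]) (i0 : ι) (hi0 : T i0 ≠ 0)
    (hT : ∀ i j, T i ≠ 0 → T j ≠ 0 → (T i).rootMultiplicity x = (T j).rootMultiplicity x → i = j) :
    ∑ i, T i ≠ 0 := by
  classical
  set s : Finset ι := Finset.univ.filter fun i => T i ≠ 0 with hs
  obtain ⟨j, hj, hmin⟩ := s.exists_min_image (fun i => (T i).rootMultiplicity x) ⟨i0, by simp [hs, hi0]⟩
  have hj0 : T j ≠ 0 := by simpa [hs] using hj
  intro h0
  set k := (T j).rootMultiplicity x
  have hdiv : (X - C x) ^ (k + 1) ∣ ∑ i ∈ Finset.univ.erase j, T i := by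
    refine Finset.dvd_sum fun i hi => ?_
    by_cases hi0 : T i = 0
    · simp [hi0]
    · rw [← le_rootMultiplicity_iff hi0]
      have h1 := hmin i (by simp [hs, hi0])
      have h2 : (T i).rootMultiplicity x ≠ k := fun h =>
        (Finset.ne_of_mem_erase hi) (hT i j hi0 hj0 h)
      omega
  rw [← Finset.add_sum_erase _ _ (Finset.mem_univ j)] at h0
  have : (X - C x) ^ (k + 1) ∣ T j := by
    rw [eq_neg_of_add_eq_zero_left h0]; exact (dvd_neg).2 hdiv
  rw [← le_rootMultiplicity_iff hj0] at this
  omega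

theorem rootMultiplicity_mod_lt {p : ℕ} [Fact p.Prime] {K : Type*} [Field K] [CharP K p] (x : K)
    (b m : ℕ) (hmM : m ≤ p ^ b) {ι : Type*} (s : Finset ι) (c : ι → K) (l j : ι → ℕ) (hl : ∀ k, l k < m)
    (h0 : ∑ k ∈ s, C (c k) * (X ^ (l k) * (X ^ p ^ b) ^ (j k)) ≠ 0) :
    (∑ k ∈ s, C (c k) * (X ^ (l k) * (X ^ p ^ b) ^ (j k))).rootMultiplicity x % p ^ b < m := by
  rw [rootMultiplicity_eq_natTrailingDegree]
  set g := (∑ k ∈ s, C (c k) * (X ^ (l k) * (X ^ p ^ b) ^ (j k))).comp (X + C x) with hg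
  have hg0 : g ≠ 0 := by
    intro h
    apply h0
    have := comp_eq_zero_iff.1 h
    rcases this with h | h
    · exact h
    · exfalso
      have h2 := congrArg (fun q => coeff q 1) h.2
      simp at h2
  let S : Submodule K K[X] :=
    { carrier := {f | ∀ n, m ≤ n % p ^ b → f.coeff n = 0}
      add_mem' := fun {a b} ha hb n hn => by simp [ha n hn, hb n hn]
      zero_mem' := fun n _ => by simp
      smul_mem' := fun c a ha n hn => by simp [ha n hn] }
  have hbase : ∀ l' j' : ℕ, l' < m → (X ^ l' * (X ^ p ^ b) ^ j' : K[X]) ∈ S := by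
    intro l' j' hl' n hn
    rw [← pow_mul, ← pow_add, coeff_X_pow]
    rw [if_neg]
    rintro rfl
    rw [Nat.add_mul_mod_self_left, Nat.mod_eq_of_lt (lt_of_lt_of_le hl' hmM)] at hn
    omega
  have hgS : g ∈ S := by
    rw [hg, Polynomial.sum_comp]
    refine S.sum_mem fun k _ => ?_
    simp only [mul_comp, C_comp, pow_comp, X_comp]
    rw [← smul_eq_C_mul]
    refine S.smul_mem _ ?_
    rw [add_pow_char_pow, add_pow, add_pow, Finset.sum_mul_sum]
    refine S.sum_mem fun i hi => S.sum_mem fun i' hi' => ?_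
    have : (X ^ i * C x ^ (l k - i) * ((l k).choose i : K[X]) *
      ((X ^ p ^ b) ^ i' * (C x ^ p ^ b) ^ (j k - i') * ((j k).choose i' : K[X]))) =
      (x ^ (l k - i) * ((l k).choose i : K) * (x ^ p ^ b) ^ (j k - i') * ((j k).choose i' : K)) •
      (X ^ i * (X ^ p ^ b) ^ i' : K[X]) := by
      rw [smul_eq_C_mul]
      simp only [C_mul, C_pow, C_eq_natCast]
      ring
    rw [this]
    exact S.smul_mem _ (hbase _ _ (by have := hl k; simp at hi; omega))
  by_contra hcon
  exact (mem_support_iff.1 (natTrailingDegree_mem_support_of_nonzero hg0)) (hgS _ (not_lt.1 hcon))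

theorem stepanov_point {p : ℕ} [Fact p.Prime] {K : Type*} [Field K] [CharP K p] (b : ℕ)
    (x y z t F : K) (hx : x ^ p ^ (2 * (b + 1)) = x)
    (hF : F = ∑ i ∈ Finset.range (b + 1), (y / z) ^ p ^ i)
    (ht : ∑ i ∈ Finset.range (2 * (b + 1)), (y / z) ^ p ^ i = t)
    (i r l j : ℕ) (hir : i + r = p - 1) :
    z ^ (p ^ b * (p - 1)) * (x ^ l * (x ^ p ^ (b + 1)) ^ j * (z ^ p ^ b * F) ^ i *
        z ^ (p ^ b * r)) ^ p ^ (b + 1) =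
      z ^ (p ^ b * p ^ (b + 1) * (p - 1)) *
        (x ^ (l * p ^ (b + 1) + j) * (t * z ^ p ^ b - z ^ p ^ b * F) ^ i * z ^ (p ^ b * r)) := by
  have hFM : F ^ p ^ (b + 1) = t - F := by
    rw [eq_sub_iff_add_eq, ← ht, two_mul, Finset.sum_range_add, hF, sum_pow_char_pow, add_comm]
    congr 1
    refine Finset.sum_congr rfl fun i _ => ?_
    rw [← pow_mul, ← pow_add, add_comm i]
  have hxM : (x ^ p ^ (b + 1)) ^ p ^ (b + 1) = x := by
    rw [← pow_mul, ← pow_add, ← two_mul, hx]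
  have e1 : t * z ^ p ^ b - z ^ p ^ b * F = z ^ p ^ b * F ^ p ^ (b + 1) := by rw [hFM]; ring
  have e2 : ((x ^ p ^ (b + 1)) ^ j) ^ p ^ (b + 1) = x ^ j := by rw [← pow_mul, mul_comm, pow_mul, hxM]
  rw [e1, ← hir]
  generalize p ^ (b + 1) = M at *
  generalize p ^ b = m at *
  have : (x ^ l * (x ^ M) ^ j * (z ^ m * F) ^ i * z ^ (m * r)) ^ M =
    x ^ (l * M) * ((x ^ M) ^ j) ^ M * (z ^ m * F) ^ (i * M) * z ^ (m * r * M) := by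
    rw [mul_pow, mul_pow, mul_pow, ← pow_mul x l, ← pow_mul (z ^ m * F) i, ← pow_mul z (m * r)]
  rw [this, e2]
  ring

theorem stepanov {p : ℕ} [Fact p.Prime] {K : Type*} [Field K] [Algebra (ZMod p) K]
    (u v : (ZMod p)[X]) (d : ℕ) (hu : u.natDegree ≤ d) (hv : v.natDegree ≤ d) (hd : d < p)
    (x0 : K) (hv0 : aeval x0 v = 0) (hvne : v ≠ 0) (hu0 : aeval x0 u ≠ 0) (b : ℕ)
    (t : ZMod p) (S : Finset K)
    (hS : ∀ x ∈ S, x ^ p ^ (2 * (b + 1)) = x ∧ aeval x v ≠ 0 ∧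
      ∑ i ∈ Finset.range (2 * (b + 1)), (aeval x u / aeval x v) ^ p ^ i = algebraMap _ K t) :
    S.card ≤ p ^ (b + 1) * (p ^ b + 2 * d) := by
  classical
  have : CharP K p := charP_of_injective_algebraMap' (ZMod p) p
  have hp2 : 2 ≤ p := (Fact.out : p.Prime).two_le
  set m := p ^ b with hm
  set M := p ^ (b + 1) with hM
  have hMm : M = m * p := by rw [hM, hm, pow_succ]
  have hm1 : 1 ≤ m := Nat.one_le_pow _ _ (by omega)
  have hmM : m ≤ M := by rw [hMm]; nlinarith
  set W : (ZMod p)[X] := ∑ i ∈ Finset.range (b + 1), u ^ p ^ i * v ^ (m - p ^ i) with hW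
  have hWdeg : W.natDegree ≤ m * d := by
    refine natDegree_sum_le_of_forall_le _ _ fun i hi => ?_
    have hpi : p ^ i ≤ m := Nat.pow_le_pow_right (by omega) (by simp at hi; omega)
    calc _ ≤ p ^ i * d + (m - p ^ i) * d :=
          natDegree_mul_le_of_le (natDegree_pow_le_of_le _ hu) (natDegree_pow_le_of_le _ hv)
      _ = m * d := by rw [← add_mul]; congr 1; omega
  set J := m + d with hJ
  let ι := Fin p × Fin J × Fin m
  have hterm : ∀ (Y : (ZMod p)[X]) (hY : Y.natDegree ≤ m * d) (i : Fin p),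
      (Y ^ (i : ℕ) * v ^ (m * (p - 1 - i))).natDegree ≤ m * d * (p - 1) := by
    intro Y hY i
    have := i.2
    calc _ ≤ i * (m * d) + (m * (p - 1 - i)) * d :=
          natDegree_mul_le_of_le (natDegree_pow_le_of_le _ hY) (natDegree_pow_le_of_le _ hv)
      _ = m * d * (i + (p - 1 - i)) := by ring
      _ = _ := by congr 1; omega
  let G : ι → (ZMod p)[X] := fun k => X ^ ((k.2.2 : ℕ) * M + k.2.1) *
    ((C t * v ^ m - W) ^ (k.1 : ℕ) * v ^ (m * (p - 1 - k.1)))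
  have hmd : m * d * p = M * d := by rw [hMm]; ring
  have hmp1 : m * d * (p - 1) + m * d = M * d := by
    rw [← hmd]; obtain ⟨q, rfl⟩ : ∃ q, p = q + 1 := ⟨p - 1, by omega⟩
    simp; ring
  obtain ⟨c, hc0, hc⟩ := exists_ne_zero_sum_smul_eq_zero ((m - 1) * M + J + m * d * (p - 1)) G
    (by
      rintro ⟨i, j, l⟩
      have h1 : (C t * v ^ m - W).natDegree ≤ m * d := by
        refine (natDegree_sub_le_of_le ?_ hWdeg).trans (max_self _).le
        exact (natDegree_C_mul_le _ _).trans (natDegree_pow_le_of_le _ hv)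
      have h2 := natDegree_mul_le_of_le (natDegree_X_pow_le (R := ZMod p) ((l : ℕ) * M + j)) (hterm _ h1 i)
      refine lt_of_le_of_lt h2 ?_
      have h3 : (l : ℕ) * M ≤ (m - 1) * M := Nat.mul_le_mul_right _ (by have := l.2; omega)
      have h4 := j.2
      omega)
    (by
      have : Fintype.card ι = J * M := by
        simp only [ι, Fintype.card_prod, Fintype.card_fin]; rw [hMm]; ring
      rw [this, hJ]
      have g1 : (m - 1) * M + M = m * M := by
        rw [← Nat.succ_mul, Nat.succ_eq_add_one, Nat.sub_add_cancel hm1]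
      have g2 : m < M := by nlinarith
      have g3 : d ≤ m * d := Nat.le_mul_of_pos_left _ hm1
      have g4 : d * M = M * d := mul_comm _ _
      rw [add_mul]
      omega)
  let U : K[X] := u.map (algebraMap (ZMod p) K)
  let V : K[X] := v.map (algebraMap (ZMod p) K)
  let W' : K[X] := W.map (algebraMap (ZMod p) K)
  let D : Fin p → K[X] := fun i => ∑ k : Fin J × Fin m,
    C (algebraMap (ZMod p) K (c (i, k))) * (X ^ (k.2 : ℕ) * (X ^ M) ^ (k.1 : ℕ))
  let T : Fin p → K[X] := fun i => D i * (W' ^ (i : ℕ) * V ^ (m * (p - 1 - i)))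
  have hV0 : V ≠ 0 := (Polynomial.map_ne_zero hvne)
  have hW'x0 : eval x0 W' ≠ 0 := by
    have : eval x0 W' = (aeval x0 u) ^ m := by
      simp only [W', eval_map_algebraMap, hW, map_sum, map_mul, map_pow, hv0]
      rw [Finset.sum_eq_single b]
      · simp [hm]
      · intro i hi hib
        rw [zero_pow, mul_zero]
        have : p ^ i < m := Nat.pow_lt_pow_right (by omega) (by simp at hi; omega)
        omega
      · simp
    rw [this]; exact pow_ne_zero _ hu0
  have hW'0 : W' ≠ 0 := fun h => hW'x0 (by simp [h])
  have hrm : ∀ i, T i ≠ 0 → (T i).rootMultiplicity x0 % M / m =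
      (V.rootMultiplicity x0 * (p - 1 - i)) % p := by
    intro i hi
    have hDi : D i ≠ 0 := left_ne_zero_of_mul hi
    have h1 := rootMultiplicity_mod_lt (p := p) x0 (b + 1) m hmM Finset.univ
      (fun k : Fin J × Fin m => algebraMap (ZMod p) K (c (i, k))) (fun k => (k.2 : ℕ)) (fun k => (k.1 : ℕ))
      (fun k => k.2.2) hDi
    have h2 : (T i).rootMultiplicity x0 = (D i).rootMultiplicity x0 +
        m * (V.rootMultiplicity x0 * (p - 1 - i)) := by
      rw [rootMultiplicity_mul hi, rootMultiplicity_mul (right_ne_zero_of_mul hi), ← count_roots,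
        ← count_roots (W' ^ _), ← count_roots (V ^ _), roots_pow, roots_pow, Multiset.count_nsmul,
        Multiset.count_nsmul, count_roots, count_roots, count_roots,
        rootMultiplicity_eq_zero (p := W') hW'x0]
      ring
    rw [h2]
    change (D i).rootMultiplicity x0 % M < m at h1
    set A := (D i).rootMultiplicity x0
    set B := V.rootMultiplicity x0 * (p - 1 - i)
    rw [Nat.add_mod, hMm, Nat.mul_mod_mul_left, ← hMm]
    have hB : B % p < p := Nat.mod_lt _ (by omega)
    rw [Nat.mod_eq_of_lt (a := A % M + m * (B % p))]
    · rw [Nat.add_mul_div_left _ _ hm1, Nat.div_eq_of_lt h1, zero_add]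
    · rw [hMm] at h1 ⊢; nlinarith
  have he0 : V.rootMultiplicity x0 ≠ 0 := by
    have := (rootMultiplicity_pos hV0 (x := x0)).2 (by simpa [V, IsRoot, eval_map_algebraMap] using hv0)
    omega
  have hed : V.rootMultiplicity x0 ≤ d := by
    rw [← count_roots]
    exact (Multiset.count_le_card _ _).trans ((card_roots' _).trans (natDegree_map_le.trans hv))
  have hD0 : ∃ i, D i ≠ 0 := by
    obtain ⟨⟨i, j, l⟩, hne⟩ := Function.ne_iff.1 hc0
    refine ⟨i, fun h => hne ?_⟩
    have h1 := congrArg (fun q => coeff q ((l : ℕ) + M * j)) h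
    simp only [D, finsetSum_coeff, coeff_C_mul, ← pow_mul, ← pow_add, coeff_X_pow, coeff_zero] at h1
    rw [Finset.sum_eq_single (j, l)] at h1
    · simpa using h1
    · rintro ⟨j', l'⟩ - hjl
      rw [if_neg, mul_zero]
      intro h
      simp only at h
      apply hjl
      have hl := lt_of_lt_of_le l.2 hmM
      have hl' := lt_of_lt_of_le l'.2 hmM
      have a1 : (l : ℕ) = l' := by
        have := congrArg (· % M) h
        simpa [Nat.add_mul_mod_self_left, Nat.mod_eq_of_lt hl, Nat.mod_eq_of_lt hl'] using this
      have a2 : (j : ℕ) = j' := by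
        have : M * (j : ℕ) = M * j' := by omega
        exact Nat.eq_of_mul_eq_mul_left (by omega) this
      exact Prod.ext (Fin.ext a2.symm) (Fin.ext a1.symm)
    · simp
  obtain ⟨i0, hi0⟩ := hD0
  have hH0 : ∑ i, T i ≠ 0 := by
    refine sum_ne_zero_of_rootMultiplicity_injOn x0 T i0
      (mul_ne_zero hi0 (mul_ne_zero (pow_ne_zero _ hW'0) (pow_ne_zero _ hV0))) ?_
    intro i j hi hj hij
    have h1 := hrm i hi
    rw [hij, hrm j hj] at h1
    have hcop : Nat.gcd p (V.rootMultiplicity x0) = 1 :=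
      Nat.Coprime.gcd_eq_one (((Fact.out : p.Prime).coprime_iff_not_dvd).2
        (fun h => by have := Nat.le_of_dvd (by omega) h; omega))
    have h2 := Nat.ModEq.cancel_left_of_coprime hcop h1
    have hi2 := i.2
    have hj2 := j.2
    rw [Nat.ModEq, Nat.mod_eq_of_lt (by omega), Nat.mod_eq_of_lt (by omega)] at h2
    exact Fin.ext (by omega)
  have hHdeg : (∑ i, T i).natDegree ≤ M * (m + 2 * d) := by
    refine natDegree_sum_le_of_forall_le _ _ fun i _ => ?_
    have h1 : (D i).natDegree ≤ (m - 1) + M * (J - 1) := by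
      refine natDegree_sum_le_of_forall_le _ _ fun k _ => ?_
      refine (natDegree_C_mul_le _ _).trans ?_
      rw [← pow_mul, ← pow_add, natDegree_X_pow]
      have := k.2.2
      have := Nat.mul_le_mul_left M (show (k.1 : ℕ) ≤ J - 1 by have := k.1.2; omega)
      omega
    have h2 : (W' ^ (i : ℕ) * V ^ (m * (p - 1 - i))).natDegree ≤ m * d * (p - 1) := by
      have : W' ^ (i : ℕ) * V ^ (m * (p - 1 - i)) =
        (W ^ (i : ℕ) * v ^ (m * (p - 1 - i))).map (algebraMap (ZMod p) K) := by simp [W', V]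
      rw [this]; exact natDegree_map_le.trans (hterm _ hWdeg i)
    refine (natDegree_mul_le_of_le h1 h2).trans ?_
    obtain ⟨m', hm'⟩ : ∃ m', m = m' + 1 := ⟨m - 1, by omega⟩
    have h5 : M * (J - 1) = M * m' + M * d := by rw [hJ, hm', ← mul_add]; congr 1; omega
    have h6 : M * (m + 2 * d) = M * m' + M + 2 * (M * d) := by rw [hm']; ring
    rw [h5, h6]
    omega
  have hroot : ∀ x ∈ S, eval x (∑ i, T i) = 0 := by
    intro x hx
    obtain ⟨hx1, hx2, hx3⟩ := hS x hx
    set y := aeval x u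
    set z := aeval x v
    set F := ∑ i ∈ Finset.range (b + 1), (y / z) ^ p ^ i with hF
    have hWx : eval x W' = z ^ m * F := by
      simp only [W', eval_map_algebraMap, hW, map_sum, map_mul, map_pow, hF, Finset.mul_sum]
      refine Finset.sum_congr rfl fun i hi => ?_
      have hpi : p ^ i ≤ m := Nat.pow_le_pow_right (by omega) (by simp at hi; omega)
      change y ^ p ^ i * z ^ (m - p ^ i) = _
      rw [div_pow]
      obtain ⟨k, hk⟩ := Nat.exists_eq_add_of_le hpi
      rw [hk, Nat.add_sub_cancel_left, pow_add]
      have := pow_ne_zero (p ^ i) hx2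
      field_simp
    clear_value F
    have key : z ^ (m * (p - 1)) * (eval x (∑ i, T i)) ^ M = 0 := by
      have e1 : eval x (∑ i, T i) = ∑ k : ι, algebraMap (ZMod p) K (c k) *
          (x ^ (k.2.2 : ℕ) * (x ^ M) ^ (k.2.1 : ℕ) * (z ^ m * F) ^ (k.1 : ℕ) *
            z ^ (m * (p - 1 - k.1))) := by
        rw [eval_finsetSum, Fintype.sum_prod_type (α₁ := Fin p)]
        refine Finset.sum_congr rfl fun i _ => ?_
        simp only [T, D, eval_mul, eval_pow, eval_finsetSum, eval_C, eval_X, hWx, Finset.sum_mul]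
        refine Finset.sum_congr rfl fun k _ => ?_
        have : eval x V = z := by simp [V, eval_map_algebraMap, z]
        rw [this]; ring
      have e2 : aeval x (∑ k, c k • G k) = ∑ k : ι, algebraMap (ZMod p) K (c k) *
          (x ^ ((k.2.2 : ℕ) * M + k.2.1) * (algebraMap _ K t * z ^ m - z ^ m * F) ^ (k.1 : ℕ) *
            z ^ (m * (p - 1 - k.1))) := by
        rw [map_sum]
        refine Finset.sum_congr rfl fun k _ => ?_
        have : aeval x W = z ^ m * F := by rw [← hWx]; simp [W', eval_map_algebraMap]
        simp only [G, map_smul, map_mul, map_pow, aeval_X, map_sub, aeval_C, this]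
        rw [Algebra.smul_def, mul_assoc (x ^ _)]
      rw [hc, map_zero] at e2
      refine Eq.trans ?_ ((congrArg (z ^ (m * M * (p - 1)) * ·) e2.symm).trans (mul_zero _))
      rw [e1, sum_pow_char_pow, Finset.mul_sum, Finset.mul_sum]
      refine Finset.sum_congr rfl fun k _ => ?_
      have := stepanov_point b x y z (algebraMap _ K t) F hx1 hF hx3 k.1 (p - 1 - k.1) k.2.2 k.2.1
        (by have := k.1.2; omega)
      rw [mul_pow, ← map_pow (algebraMap (ZMod p) K), ZMod.pow_card_pow, mul_left_comm, this]
      ring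
    exact eq_zero_of_pow_eq_zero (n := M) ((mul_eq_zero.1 key).resolve_left (pow_ne_zero _ hx2))
  refine le_trans (card_le_degree_of_subset_roots ?_) hHdeg
  intro x hx
  exact (mem_roots hH0).2 (hroot x hx)

theorem resultant_multiset_prod_X_sub_C {R : Type*} [CommRing R] [Nontrivial R] (s : Multiset R)
    (h : R[X]) (n : ℕ) (hn : h.natDegree ≤ n) :
    (s.map fun a => X - C a).prod.resultant h s.card n = (s.map fun a => eval a h).prod := by
  induction s using Multiset.induction_on with
  | empty => simp
  | cons a s ih =>
    rw [Multiset.map_cons, Multiset.prod_cons, Multiset.map_cons, Multiset.prod_cons, ← ih,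
      ← resultant_X_sub_C_left h n a hn, Multiset.card_cons, add_comm]
    have := resultant_mul_left (X - C a) (s.map fun a => X - C a).prod h n hn
    rwa [natDegree_X_sub_C, natDegree_multiset_prod_X_sub_C_eq_card] at this

theorem dualNumber_prod {K : Type*} [Field K] (s : Multiset K) (a b : K → K)
    (ha : ∀ x ∈ s, a x ≠ 0) :
    (s.map fun x => (TrivSqZeroExt.inl (a x) + TrivSqZeroExt.inr (b x) : DualNumber K)).prod =
      TrivSqZeroExt.inl (s.map a).prod +
        TrivSqZeroExt.inr ((s.map a).prod * (s.map fun x => b x / a x).sum) := by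
  induction s using Multiset.induction_on with
  | empty => simp
  | cons x s ih =>
    have hx := ha x (Multiset.mem_cons_self x s)
    rw [Multiset.map_cons, Multiset.prod_cons, ih fun y hy => ha y (Multiset.mem_cons_of_mem hy)]
    ext
    · simp
    · simp
      field_simp
      ring

theorem sum_roots_eq_of_sq_dvd {K : Type*} [Field K] (g₁ g₂ u v : K[X]) (hg₁ : g₁.Monic)
    (hg₂ : g₂.Monic) (hs₁ : g₁.Splits) (hs₂ : g₂.Splits) (hdeg : g₁.natDegree = g₂.natDegree)
    (hu : u.natDegree ≤ v.natDegree) (hv0 : v ≠ 0) (hdvd : v ^ 2 ∣ g₁ - g₂)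
    (h₁ : ∀ x ∈ g₁.roots, eval x v ≠ 0) (h₂ : ∀ x ∈ g₂.roots, eval x v ≠ 0) :
    (g₁.roots.map fun x => eval x u / eval x v).sum =
      (g₂.roots.map fun x => eval x u / eval x v).sum := by
  set n := v.natDegree with hn
  let φ : K →+* DualNumber K := TrivSqZeroExt.inlHom K K
  let h : (DualNumber K)[X] := v.map φ + C DualNumber.eps * u.map φ
  have hh : h.natDegree ≤ n := by
    refine (natDegree_add_le_of_degree_le natDegree_map_le ?_)
    exact (natDegree_C_mul_le _ _).trans (natDegree_map_le.trans hu)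
  have hev : ∀ x : K, eval (φ x) h =
      TrivSqZeroExt.inl (eval x v) + TrivSqZeroExt.inr (eval x u) := by
    intro x
    simp only [h, eval_add, eval_mul, eval_C, eval_map_apply]
    ext <;> simp [φ]
  have key : ∀ g : K[X], g.Monic → g.Splits →
      (g.map φ).resultant h g.natDegree n = (g.roots.map fun x =>
        (TrivSqZeroExt.inl (eval x v) + TrivSqZeroExt.inr (eval x u) : DualNumber K)).prod := by
    intro g hg hs
    have e1 : g.map φ = ((g.roots.map φ).map fun a => X - C a).prod := by
      conv_lhs => rw [hs.eq_prod_roots_of_monic hg]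
      rw [Polynomial.map_multiset_prod, Multiset.map_map, Multiset.map_map]
      congr 1
      refine Multiset.map_congr rfl fun x _ => ?_
      simp
    have e2 : g.natDegree = (g.roots.map φ).card := by
      rw [Multiset.card_map, hs.natDegree_eq_card_roots]
    rw [e1, e2, resultant_multiset_prod_X_sub_C _ _ _ hh, Multiset.map_map]
    congr 1
    exact Multiset.map_congr rfl fun x _ => hev x
  have hres : (g₁.map φ).resultant h g₁.natDegree n = (g₂.map φ).resultant h g₂.natDegree n := by
    obtain ⟨w, hw⟩ := hdvd
    rw [resultant_comm, resultant_comm (g₂.map φ), hdeg]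
    congr 1
    have e : g₁.map φ = g₂.map φ + h * ((v.map φ - C DualNumber.eps * u.map φ) * w.map φ) := by
      have e1 : g₁ = g₂ + v ^ 2 * w := by rw [← hw]; ring
      have e2 : (C DualNumber.eps * C DualNumber.eps : (DualNumber K)[X]) = 0 := by
        rw [← C_mul, DualNumber.eps_mul_eps, C_0]
      rw [e1, Polynomial.map_add, Polynomial.map_mul, Polynomial.map_pow]
      change _ = _ + (v.map φ + C DualNumber.eps * u.map φ) * _
      linear_combination (u.map φ) ^ 2 * w.map φ * e2
    rw [e]
    by_cases hw0 : w = 0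
    · rw [hw0, Polynomial.map_zero, mul_zero, mul_zero, add_zero]
    refine resultant_add_mul_right _ _ _ _ _ ?_ hh
    have d1 : (v ^ 2 * w).natDegree ≤ g₂.natDegree := by
      rw [← hw]; exact (natDegree_sub_le_of_le hdeg.le le_rfl).trans (max_self _).le
    rw [natDegree_mul (pow_ne_zero _ hv0) hw0, natDegree_pow] at d1
    have d2 : ((v.map φ - C DualNumber.eps * u.map φ) * w.map φ).natDegree ≤ n + w.natDegree := by
      refine natDegree_mul_le_of_le ?_ natDegree_map_le
      refine (natDegree_sub_le_of_le natDegree_map_le ?_).trans (max_self _).le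
      exact (natDegree_C_mul_le _ _).trans (natDegree_map_le.trans hu)
    omega
  rw [key g₁ hg₁ hs₁, key g₂ hg₂ hs₂, dualNumber_prod _ _ _ h₁, dualNumber_prod _ _ _ h₂] at hres
  have c1 := congrArg TrivSqZeroExt.fst hres
  have c2 := congrArg TrivSqZeroExt.snd hres
  simp only [TrivSqZeroExt.fst_add, TrivSqZeroExt.fst_inl, TrivSqZeroExt.fst_inr, add_zero,
    TrivSqZeroExt.snd_add, TrivSqZeroExt.snd_inl, TrivSqZeroExt.snd_inr, zero_add] at c1 c2
  rw [c1] at c2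
  refine mul_left_cancel₀ ?_ c2
  refine Multiset.prod_ne_zero fun hmem => ?_
  obtain ⟨x, hx, hx0⟩ := Multiset.mem_map.1 hmem
  exact h₂ x hx hx0

section FrobeniusOrbits

variable {p : ℕ} [Fact p.Prime] {K : Type*} [Field K]

theorem frobOrbit_lifts [Algebra (ZMod p) K] (x : K) (r : ℕ) (hx : x ^ p ^ r = x) :
    ∃ m : (ZMod p)[X], m.map (algebraMap (ZMod p) K) = ∏ i ∈ Finset.range r, (X - C (x ^ p ^ i)) := by
  have : CharP K p := charP_of_injective_algebraMap' (ZMod p) p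
  rw [← mem_lifts, lifts_iff_coeff_lifts]
  set M : K[X] := ∏ i ∈ Finset.range r, (X - C (x ^ p ^ i)) with hM
  have hinv : M.map (frobenius K p) = M := by
    rw [hM, Polynomial.map_prod]
    have h1 : ∀ i, (X - C (x ^ p ^ i)).map (frobenius K p) = X - C (x ^ p ^ (i + 1)) := by
      intro i
      rw [Polynomial.map_sub, map_X, map_C, frobenius_def, ← pow_mul, pow_succ]
    simp only [h1]
    rcases r with _ | r
    · simp
    · rw [Finset.prod_range_succ, hx, Finset.prod_range_succ' (n := r)]
      simp
  intro n
  have h := congrArg (fun q => coeff q n) hinv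
  simp only [coeff_map, frobenius_def] at h
  rw [← Subfield.mem_bot_iff_pow_eq_self, mem_bot_iff_intCast p K] at h
  obtain ⟨k, hk⟩ := h
  exact ⟨k, by simp [hk]⟩

open Classical in
theorem card_frobOrbit_dvd [CharP K p] (x : K) (G : K[X]) (hG : G ≠ 0)
    (hGσ : G.map (frobenius K p) = G) (k : ℕ) (hk : G.natDegree ≤ k) :
    ((Finset.Icc 1 k).filter fun r => x ^ p ^ r = x ∧
      ∏ i ∈ Finset.range r, (X - C (x ^ p ^ i)) ∣ G).card = G.rootMultiplicity x := by
  by_cases hroot : G.IsRoot x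
  swap
  · rw [rootMultiplicity_eq_zero hroot, Finset.card_eq_zero, Finset.filter_eq_empty_iff]
    rintro r hr ⟨-, h⟩
    apply hroot
    rw [← dvd_iff_isRoot]
    refine dvd_trans ?_ h
    have := Finset.dvd_prod_of_mem (fun i => X - C (x ^ p ^ i))
      (Finset.mem_range.2 (by simp at hr; omega : 0 < r))
    simpa using this
  have hrm : ∀ i, G.rootMultiplicity (x ^ p ^ i) = G.rootMultiplicity x := by
    intro i
    induction i with
    | zero => simp
    | succ i ih =>
      rw [← ih, eq_rootMultiplicity_map (frobenius_inj K p) (x ^ p ^ i), hGσ, frobenius_def,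
        ← pow_mul, pow_succ]
  set e := G.rootMultiplicity x with he
  have hepos : 0 < e := (rootMultiplicity_pos hG).2 hroot
  set δ := Function.minimalPeriod (frobenius K p) x with hδ
  have hper : ∀ r, x ^ p ^ r = x ↔ δ ∣ r := by
    intro r
    rw [hδ, ← Function.isPeriodicPt_iff_minimalPeriod_dvd, Function.IsPeriodicPt,
      Function.IsFixedPt, iterate_frobenius]
  have hδpos : 0 < δ := by
    have hmaps : ∀ i : ℕ, x ^ p ^ i ∈ G.roots.toFinset := by
      intro i
      rw [Multiset.mem_toFinset, mem_roots hG, ← rootMultiplicity_pos hG, hrm]; exact hepos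
    obtain ⟨i, j, hij, h⟩ := Finite.exists_ne_map_eq_of_infinite
      (fun i : ℕ => (⟨x ^ p ^ i, hmaps i⟩ : G.roots.toFinset))
    simp only [Subtype.mk.injEq] at h
    have key : ∀ i j : ℕ, i < j → x ^ p ^ i = x ^ p ^ j → 0 < δ := by
      intro i j hij h
      obtain ⟨l, rfl⟩ := Nat.exists_eq_add_of_lt hij
      have h2 : x = x ^ p ^ (l + 1) := by
        apply iterateFrobenius_inj K p i
        rw [iterateFrobenius_def, iterateFrobenius_def, h, ← pow_mul, ← pow_add]
        congr 2; ring
      exact Nat.pos_of_dvd_of_pos ((hper (l + 1)).1 h2.symm) (by omega)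
    rcases lt_or_gt_of_ne hij with h' | h'
    · exact key i j h' h
    · exact key j i h' h.symm
  have hinj : Set.InjOn (fun i : ℕ => x ^ p ^ i) (Finset.range δ : Set ℕ) := by
    have := Function.iterate_injOn_Iio_minimalPeriod (f := frobenius K p) (x := x)
    intro i hi j hj hij
    refine this (by simpa using hi) (by simpa using hj) ?_
    simpa [iterate_frobenius] using hij
  set μ : K[X] := ∏ i ∈ Finset.range δ, (X - C (x ^ p ^ i)) with hμ
  have hxδ : x ^ p ^ δ = x := (hper δ).2 dvd_rfl
  have hprod : ∀ j : ℕ, ∏ i ∈ Finset.range (δ * j), (X - C (x ^ p ^ i)) = μ ^ j := by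
    intro j
    induction j with
    | zero => simp
    | succ j ih =>
      rw [Nat.mul_succ, Finset.prod_range_add, ih, pow_succ]
      congr 1
      refine Finset.prod_congr rfl fun i _ => ?_
      rw [pow_add, pow_mul, (hper (δ * j)).2 (dvd_mul_right _ _)]
  have hdvd : ∀ j : ℕ, μ ^ j ∣ G ↔ j ≤ e := by
    intro j
    constructor
    · intro h
      rw [he, le_rootMultiplicity_iff hG]
      refine dvd_trans (pow_dvd_pow_of_dvd ?_ j) h
      have := Finset.dvd_prod_of_mem (fun i => X - C (x ^ p ^ i)) (Finset.mem_range.2 hδpos)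
      simpa only [pow_zero, pow_one] using this
    · intro h
      rw [hμ, ← Finset.prod_pow]
      refine Finset.prod_dvd_of_coprime ?_ fun i _ => ?_
      · intro i hi j' hj' hij
        refine IsCoprime.pow ?_
        exact isCoprime_X_sub_C_of_isUnit_sub
          (isUnit_iff_ne_zero.2 (sub_ne_zero.2 fun h => hij (hinj hi hj' h)))
      · rw [← le_rootMultiplicity_iff hG, hrm]; exact h
  have hset : ((Finset.Icc 1 k).filter fun r => x ^ p ^ r = x ∧
      ∏ i ∈ Finset.range r, (X - C (x ^ p ^ i)) ∣ G) = (Finset.Icc 1 e).image (δ * ·) := by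
    ext r
    simp only [Finset.mem_filter, Finset.mem_Icc, Finset.mem_image]
    constructor
    · rintro ⟨⟨h1, h2⟩, h3, h4⟩
      obtain ⟨j, rfl⟩ := (hper r).1 h3
      rw [hprod, hdvd] at h4
      exact ⟨j, ⟨Nat.pos_of_ne_zero (by rintro rfl; simp at h1), h4⟩, rfl⟩
    · rintro ⟨j, ⟨h1, h2⟩, rfl⟩
      have hd := (hdvd j).2 h2
      have hdeg : δ * j ≤ G.natDegree := by
        have := natDegree_le_of_dvd hd hG
        rw [← hprod, natDegree_prod_of_monic _ _ fun i _ => monic_X_sub_C _] at this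
        simpa only [natDegree_X_sub_C, Finset.sum_const, Finset.card_range, smul_eq_mul, mul_one] using this
      exact ⟨⟨Nat.mul_pos hδpos h1, hdeg.trans hk⟩, (hper _).2 (dvd_mul_right _ _), by rwa [hprod]⟩
  rw [hset, Finset.card_image_of_injective _ (fun a b h => Nat.eq_of_mul_eq_mul_left hδpos h),
    Nat.card_Icc, Nat.add_sub_cancel]

end FrobeniusOrbits

section LFunction

variable {p : ℕ} [Fact p.Prime] {K : Type*} [Field K] [Algebra (ZMod p) K]

/-- The monic polynomials of degree `k` over `ZMod p`. -/
def monicsOfDegree (p : ℕ) [Fact p.Prime] (k : ℕ) : Finset (ZMod p)[X] :=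
  letI := Classical.decEq (ZMod p)[X]
  (Finset.univ : Finset (Fin k → ZMod p)).image fun c =>
    X ^ k + ((degreeLTEquiv (ZMod p) k).symm c : (ZMod p)[X])

theorem mem_monicsOfDegree {k : ℕ} {g : (ZMod p)[X]} :
    g ∈ monicsOfDegree p k ↔ g.Monic ∧ g.natDegree = k := by
  classical
  simp only [monicsOfDegree, Finset.mem_image, Finset.mem_univ, true_and]
  constructor
  · rintro ⟨c, rfl⟩
    have hlt := mem_degreeLT.1 ((degreeLTEquiv (ZMod p) k).symm c).2
    refine ⟨monic_X_pow_add hlt, ?_⟩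
    rw [natDegree_add_eq_left_of_degree_lt, natDegree_X_pow]
    rwa [degree_X_pow]
  · rintro ⟨hg, hk⟩
    have hlt : g - X ^ k ∈ degreeLT (ZMod p) k := by
      rw [mem_degreeLT]
      have : g.degree = (X ^ k : (ZMod p)[X]).degree := by
        rw [degree_X_pow, degree_eq_natDegree hg.ne_zero, hk]
      have h2 := degree_sub_lt_left this hg.ne_zero (by rw [hg.leadingCoeff, (monic_X_pow k).leadingCoeff])
      rwa [this, degree_X_pow] at h2
    refine ⟨degreeLTEquiv (ZMod p) k ⟨_, hlt⟩, ?_⟩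
    rw [LinearEquiv.symm_apply_apply]
    ring

/-- The sum of the values of `u / v` over the roots of `g`, with multiplicity. -/
def rootSum (K : Type*) [Field K] [Algebra (ZMod p) K] (u v g : (ZMod p)[X]) : K :=
  ((g.aroots K).map fun x => aeval x u / aeval x v).sum

open Classical in
/-- The multiplicative character on polynomials attached to an additive character of `K` and the
rational function `u / v`. -/
def polyChar (Ψ : AddChar K ℂ) (u v g : (ZMod p)[X]) : ℂ :=
  if ∀ x ∈ g.aroots K, aeval x v ≠ 0 then Ψ (rootSum K u v g) else 0

/-- The coefficients of the `L`-function of `polyChar`. -/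
def lCoeff (Ψ : AddChar K ℂ) (u v : (ZMod p)[X]) (k : ℕ) : ℂ :=
  ∑ g ∈ monicsOfDegree p k, polyChar Ψ u v g

/-- The elements of `K` fixed by the `r`-th power of Frobenius. -/
def frobFixed (p : ℕ) (K : Type*) [Field K] (r : ℕ) : Finset K :=
  letI := Classical.decEq K
  (X ^ p ^ r - X : K[X]).roots.toFinset

open Classical in
/-- The exponential sum over the degree `r` extension of the prime field. -/
def frobSum (Ψ : AddChar K ℂ) (u v : (ZMod p)[X]) (r : ℕ) : ℂ :=
  ∑ x ∈ frobFixed p K r, if aeval x v ≠ 0 then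
    Ψ (∑ i ∈ Finset.range r, (aeval x u / aeval x v) ^ p ^ i) else 0

theorem mem_frobFixed {r : ℕ} (hr : r ≠ 0) {x : K} : x ∈ frobFixed p K r ↔ x ^ p ^ r = x := by
  have h0 : (X ^ p ^ r - X : K[X]) ≠ 0 :=
    FiniteField.X_pow_card_pow_sub_X_ne_zero K hr (Fact.out : p.Prime).one_lt
  simp [frobFixed, mem_roots h0, sub_eq_zero]

theorem polyChar_mul (Ψ : AddChar K ℂ) (u v g h : (ZMod p)[X]) (hg : g ≠ 0) (hh : h ≠ 0) :
    polyChar Ψ u v (g * h) = polyChar Ψ u v g * polyChar Ψ u v h := by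
  have hm : (g * h).aroots K = g.aroots K + h.aroots K := aroots_mul (mul_ne_zero hg hh)
  have hmem : (∀ x ∈ (g * h).aroots K, aeval x v ≠ 0) ↔
      (∀ x ∈ g.aroots K, aeval x v ≠ 0) ∧ ∀ x ∈ h.aroots K, aeval x v ≠ 0 := by
    rw [hm]
    simp only [Multiset.mem_add, or_imp, forall_and]
  rw [polyChar, polyChar, polyChar]
  by_cases h1 : ∀ x ∈ g.aroots K, aeval x v ≠ 0
  · by_cases h2 : ∀ x ∈ h.aroots K, aeval x v ≠ 0
    · rw [if_pos (hmem.2 ⟨h1, h2⟩), if_pos h1, if_pos h2, rootSum, hm, Multiset.map_add, Multiset.sum_add,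
        AddChar.map_add_eq_mul]
      rfl
    · rw [if_neg (fun h => h2 (hmem.1 h).2), if_neg h2, mul_zero]
  · rw [if_neg (fun h => h1 (hmem.1 h).1), if_neg h1, zero_mul]

theorem polyChar_X_sub_C (Ψ : AddChar K ℂ) (u v : (ZMod p)[X]) (a : ZMod p) (ha : eval a v ≠ 0) :
    polyChar Ψ u v (X - C a) = Ψ (algebraMap (ZMod p) K (eval a u / eval a v)) := by
  have h1 : aeval (algebraMap (ZMod p) K a) v = algebraMap (ZMod p) K (eval a v) :=
    aeval_algebraMap_apply_eq_algebraMap_eval _ _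
  have h2 : aeval (algebraMap (ZMod p) K a) u = algebraMap (ZMod p) K (eval a u) :=
    aeval_algebraMap_apply_eq_algebraMap_eval _ _
  have h3 : algebraMap (ZMod p) K (eval a v) ≠ 0 := by simpa using ha
  rw [polyChar, rootSum, aroots_X_sub_C, if_pos]
  · simp [h1, h2]
  · simpa [h1] using ha

theorem polyChar_congr [IsAlgClosed K] (Ψ : AddChar K ℂ) (u v g₁ g₂ : (ZMod p)[X]) (hv : v ≠ 0)
    (hu : u.natDegree ≤ v.natDegree) (hg₁ : g₁.Monic) (hg₂ : g₂.Monic)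
    (hdeg : g₁.natDegree = g₂.natDegree) (hdvd : v ^ 2 ∣ g₁ - g₂) :
    polyChar Ψ u v g₁ = polyChar Ψ u v g₂ := by
  have hcond : ∀ g h : (ZMod p)[X], h.Monic → v ^ 2 ∣ g - h →
      (∀ x ∈ h.aroots K, aeval x v ≠ 0) → ∀ x ∈ g.aroots K, aeval x v ≠ 0 := by
    intro g h hh ⟨w, hw⟩ H x hx hxv
    refine H x ?_ hxv
    rw [mem_aroots]
    refine ⟨hh.ne_zero, ?_⟩
    have : h = g - v ^ 2 * w := by rw [← hw]; ring
    rw [this]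
    simp [hxv, (mem_aroots.1 hx).2]
  have hiff : (∀ x ∈ g₁.aroots K, aeval x v ≠ 0) ↔ ∀ x ∈ g₂.aroots K, aeval x v ≠ 0 :=
    ⟨hcond g₂ g₁ hg₁ (by rw [← neg_sub]; exact (dvd_neg).2 hdvd), hcond g₁ g₂ hg₂ hdvd⟩
  rw [polyChar, polyChar]
  by_cases h2 : ∀ x ∈ g₂.aroots K, aeval x v ≠ 0
  swap
  · rw [if_neg h2, if_neg (fun h => h2 (hiff.1 h))]
  have h1 := hiff.2 h2
  rw [if_pos h1, if_pos h2]
  congr 1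
  have := sum_roots_eq_of_sq_dvd (g₁.map (algebraMap (ZMod p) K)) (g₂.map (algebraMap (ZMod p) K))
    (u.map (algebraMap (ZMod p) K)) (v.map (algebraMap (ZMod p) K)) (hg₁.map _) (hg₂.map _)
    (IsAlgClosed.splits _) (IsAlgClosed.splits _) (by simpa using hdeg) (by simpa using hu)
    (Polynomial.map_ne_zero hv)
    (by rw [← Polynomial.map_pow, ← Polynomial.map_sub]; exact Polynomial.map_dvd _ hdvd)
    (by simpa [eval_map_algebraMap] using h1) (by simpa [eval_map_algebraMap] using h2)
  simpa [rootSum, aroots, eval_map_algebraMap] using this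

theorem lCoeff_eq_zero [IsAlgClosed K] (Ψ : AddChar K ℂ) (u v : (ZMod p)[X]) (hv : v.Monic)
    (hu : u.natDegree ≤ v.natDegree) (a b : ZMod p) (ha : eval a v ≠ 0) (hb : eval b v ≠ 0)
    (hab : Ψ (algebraMap (ZMod p) K (eval a u / eval a v)) ≠
      Ψ (algebraMap (ZMod p) K (eval b u / eval b v))) (k : ℕ) (hk : 2 * v.natDegree ≤ k) :
    lCoeff Ψ u v k = 0 := by
  classical
  have hinv : ∀ a : ZMod p, eval a v ≠ 0 → IsCoprime (X - C a) (v ^ 2) := by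
    intro a ha
    refine IsCoprime.pow_right ?_
    exact ((prime_X_sub_C a).irreducible.coprime_iff_not_dvd).2 fun h => ha (dvd_iff_isRoot.1 h)
  have hv2 : (v ^ 2).Monic := hv.pow 2
  have hv2d : (v ^ 2).natDegree = 2 * v.natDegree := natDegree_pow _ _
  -- multiplication of the residue by `c`, keeping the quotient
  let τ : (ZMod p)[X] → (ZMod p)[X] → (ZMod p)[X] := fun c g =>
    v ^ 2 * (g /ₘ v ^ 2) + (c * g) %ₘ v ^ 2
  have hτmem : ∀ c g, g ∈ monicsOfDegree p k → τ c g ∈ monicsOfDegree p k ∧ τ c g - g =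
      (c * g) %ₘ v ^ 2 - g %ₘ v ^ 2 := by
    intro c g hg
    have e : τ c g - g = (c * g) %ₘ v ^ 2 - g %ₘ v ^ 2 := by
      have := modByMonic_add_div g (v ^ 2)
      simp only [τ]
      linear_combination this
    refine ⟨?_, e⟩
    rw [mem_monicsOfDegree] at hg ⊢
    have hdeg : (τ c g - g).degree < g.degree := by
      rw [e]
      refine lt_of_lt_of_le (lt_of_le_of_lt (degree_sub_le _ _) (max_lt
        (degree_modByMonic_lt _ hv2) (degree_modByMonic_lt _ hv2))) ?_
      rw [degree_eq_natDegree hv2.ne_zero, degree_eq_natDegree hg.1.ne_zero, hv2d, hg.2]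
      exact_mod_cast hk
    have e2 : τ c g = g + (τ c g - g) := by ring
    rw [e2]
    refine ⟨hg.1.add_of_left hdeg, ?_⟩
    rw [natDegree_add_eq_left_of_degree_lt hdeg, hg.2]
  have hτmod : ∀ c g, v ^ 2 ∣ τ c g - c * g := by
    intro c g
    refine ⟨g /ₘ v ^ 2 - (c * g) /ₘ v ^ 2, ?_⟩
    have := modByMonic_add_div (c * g) (v ^ 2)
    simp only [τ]
    linear_combination this
  have hττ : ∀ c c' g, v ^ 2 ∣ c' * c - 1 → τ c' (τ c g) = g := by
    intro c c' g hc
    have hq : τ c g /ₘ v ^ 2 = g /ₘ v ^ 2 := by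
      refine (div_modByMonic_unique (f := τ c g) (g := v ^ 2) (g /ₘ v ^ 2) ((c * g) %ₘ v ^ 2) hv2
        ⟨?_, degree_modByMonic_lt _ hv2⟩).1
      simp only [τ]; ring
    have hr : (c' * τ c g) %ₘ v ^ 2 = g %ₘ v ^ 2 := by
      rw [← sub_eq_zero, ← sub_modByMonic, modByMonic_eq_zero_iff_dvd hv2]
      obtain ⟨w, hw⟩ := hc
      obtain ⟨w', hw'⟩ := hτmod c g
      refine ⟨c' * w' + w * g, ?_⟩
      linear_combination c' * hw' + g * hw
    change v ^ 2 * (τ c g /ₘ v ^ 2) + (c' * τ c g) %ₘ v ^ 2 = g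
    rw [hq, hr, add_comm, modByMonic_add_div]
  obtain ⟨ia, ja, hia⟩ := hinv a ha
  obtain ⟨ib, jb, hib⟩ := hinv b hb
  set c := ia * (X - C b) with hc
  set c' := ib * (X - C a) with hc'
  have hcc' : v ^ 2 ∣ c' * c - 1 := by
    refine ⟨ja * jb * v ^ 2 - ja - jb, ?_⟩
    rw [hc, hc']
    linear_combination (ib * (X - C b)) * hia + hib - ja * v ^ 2 * hib
  have hc'c : v ^ 2 ∣ c * c' - 1 := by rwa [mul_comm]
  have hsum : lCoeff Ψ u v k = ∑ g ∈ monicsOfDegree p k, polyChar Ψ u v (τ c g) := by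
    rw [lCoeff]
    refine Finset.sum_nbij' (τ c') (τ c) (fun g hg => (hτmem _ _ hg).1)
      (fun g hg => (hτmem _ _ hg).1) (fun g _ => hττ c' c g hc'c) (fun g _ => hττ c c' g hcc') ?_
    intro g hg
    rw [hττ c' c g hc'c]
  have hrel : ∀ g ∈ monicsOfDegree p k,
      Ψ (algebraMap (ZMod p) K (eval a u / eval a v)) * polyChar Ψ u v (τ c g) =
      Ψ (algebraMap (ZMod p) K (eval b u / eval b v)) * polyChar Ψ u v g := by
    intro g hg
    have hτ := (mem_monicsOfDegree.1 (hτmem c g hg).1)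
    have hg' := mem_monicsOfDegree.1 hg
    rw [← polyChar_X_sub_C Ψ u v a ha, ← polyChar_X_sub_C Ψ u v b hb,
      ← polyChar_mul _ _ _ _ _ (X_sub_C_ne_zero a) hτ.1.ne_zero,
      ← polyChar_mul _ _ _ _ _ (X_sub_C_ne_zero b) hg'.1.ne_zero]
    refine polyChar_congr Ψ u v _ _ hv.ne_zero hu ((monic_X_sub_C a).mul hτ.1)
      ((monic_X_sub_C b).mul hg'.1) ?_ ?_
    · rw [(monic_X_sub_C a).natDegree_mul hτ.1, (monic_X_sub_C b).natDegree_mul hg'.1,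
        natDegree_X_sub_C, natDegree_X_sub_C, hτ.2, hg'.2]
    · obtain ⟨w, hw⟩ := hτmod c g
      refine ⟨(X - C a) * w - ja * (X - C b) * g, ?_⟩
      rw [hc] at hw ⊢
      linear_combination (X - C a) * hw + (X - C b) * g * hia
  have h1 : Ψ (algebraMap (ZMod p) K (eval a u / eval a v)) * lCoeff Ψ u v k =
      Ψ (algebraMap (ZMod p) K (eval b u / eval b v)) * lCoeff Ψ u v k := by
    conv_lhs => rw [hsum, Finset.mul_sum]
    rw [Finset.sum_congr rfl hrel, ← Finset.mul_sum, lCoeff]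
  by_contra h0
  exact hab (mul_right_cancel₀ h0 h1)

end LFunction

section Newton

variable {p : ℕ} [Fact p.Prime] {K : Type*} [Field K] [Algebra (ZMod p) K]

theorem aeval_pow_pow_char (f : (ZMod p)[X]) (x : K) (i : ℕ) :
    aeval (x ^ p ^ i) f = (aeval x f) ^ p ^ i := by
  induction i with
  | zero => simp
  | succ i ih =>
    rw [pow_succ, pow_mul, pow_mul, ← ih, ← expand_aeval, ZMod.expand_card, map_pow]

theorem aroots_frobOrbit {r : ℕ} {x : K} {m : (ZMod p)[X]}
    (hm : m.map (algebraMap (ZMod p) K) = ∏ i ∈ Finset.range r, (X - C (x ^ p ^ i))) :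
    m.aroots K = (Finset.range r).val.map fun i => x ^ p ^ i := by
  rw [aroots, hm, Finset.prod]
  have := Polynomial.roots_multiset_prod_X_sub_C ((Finset.range r).val.map fun i => x ^ p ^ i)
  rwa [Multiset.map_map] at this

theorem polyChar_frobOrbit (Ψ : AddChar K ℂ) (u v : (ZMod p)[X]) {r : ℕ} (hr : r ≠ 0) {x : K}
    {m : (ZMod p)[X]}
    (hm : m.map (algebraMap (ZMod p) K) = ∏ i ∈ Finset.range r, (X - C (x ^ p ^ i))) :
    polyChar Ψ u v m = open Classical in if aeval x v ≠ 0 then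
      Ψ (∑ i ∈ Finset.range r, (aeval x u / aeval x v) ^ p ^ i) else 0 := by
  have hroots := aroots_frobOrbit hm
  have hcond : (∀ y ∈ m.aroots K, aeval y v ≠ 0) ↔ aeval x v ≠ 0 := by
    rw [hroots]
    simp only [Multiset.mem_map, Finset.mem_val, Finset.mem_range, forall_exists_index, and_imp]
    constructor
    · intro h
      simpa using h x 0 (Nat.pos_of_ne_zero hr) (by simp)
    · rintro h y i hi rfl
      rw [aeval_pow_pow_char]
      exact pow_ne_zero _ h
  have hsum : rootSum K u v m = ∑ i ∈ Finset.range r, (aeval x u / aeval x v) ^ p ^ i := by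
    rw [rootSum, hroots, Multiset.map_map, Finset.sum]
    congr 1
    refine Multiset.map_congr rfl fun i _ => ?_
    simp only [Function.comp_apply, aeval_pow_pow_char, div_pow]
  rw [polyChar, hsum]
  by_cases h : aeval x v ≠ 0
  · rw [if_pos h, if_pos (hcond.2 h)]
  · rw [if_neg h, if_neg (fun h' => h (hcond.1 h'))]

theorem sum_polyChar_of_dvd (Ψ : AddChar K ℂ) (u v m : (ZMod p)[X]) (hm : m.Monic) {k : ℕ}
    (hk : m.natDegree ≤ k) :
    ∑ g ∈ (open Classical in (monicsOfDegree p k).filter (m ∣ ·)), polyChar Ψ u v g =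
      polyChar Ψ u v m * lCoeff Ψ u v (k - m.natDegree) := by
  classical
  rw [lCoeff, Finset.mul_sum]
  symm
  refine Finset.sum_bij (fun h _ => m * h) ?_ ?_ ?_ ?_
  · intro h hh
    rw [mem_monicsOfDegree] at hh
    simp only [Finset.mem_filter, mem_monicsOfDegree]
    refine ⟨⟨hm.mul hh.1, ?_⟩, dvd_mul_right _ _⟩
    rw [hm.natDegree_mul hh.1, hh.2]; omega
  · intro h _ h' _ e
    exact mul_left_cancel₀ hm.ne_zero e
  · intro g hg
    simp only [Finset.mem_filter, mem_monicsOfDegree] at hg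
    obtain ⟨⟨hg1, hg2⟩, h, rfl⟩ := hg
    have hh : h.Monic := hm.of_mul_monic_left hg1
    refine ⟨h, ?_, rfl⟩
    rw [mem_monicsOfDegree]
    rw [hm.natDegree_mul hh] at hg2
    exact ⟨hh, by omega⟩
  · intro h hh
    exact (polyChar_mul _ _ _ _ _ hm.ne_zero (mem_monicsOfDegree.1 hh).1.ne_zero).symm

theorem natDegree_eq_sum_frobOrbit [IsAlgClosed K] [CharP K p] (g : (ZMod p)[X]) (hg : g.Monic) :
    g.natDegree = ∑ r ∈ Finset.Icc 1 g.natDegree, (open Classical in (frobFixed p K r).filter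
      fun x => ∏ i ∈ Finset.range r, (X - C (x ^ p ^ i)) ∣ g.map (algebraMap (ZMod p) K)).card := by
  classical
  set G := g.map (algebraMap (ZMod p) K) with hG
  have hG0 : G ≠ 0 := (hg.map _).ne_zero
  have hGd : G.natDegree = g.natDegree := natDegree_map _
  have hGσ : G.map (frobenius K p) = G := by
    rw [hG, Polynomial.map_map]
    congr 1
    exact Subsingleton.elim _ _
  have h1 : ∀ r ∈ Finset.Icc 1 g.natDegree, ((frobFixed p K r).filter
      fun x => ∏ i ∈ Finset.range r, (X - C (x ^ p ^ i)) ∣ G).card =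
      ∑ x ∈ G.roots.toFinset, if x ^ p ^ r = x ∧
        ∏ i ∈ Finset.range r, (X - C (x ^ p ^ i)) ∣ G then 1 else 0 := by
    intro r hr
    rw [Finset.mem_Icc] at hr
    rw [← Finset.card_filter]
    congr 1
    ext x
    simp only [Finset.mem_filter, mem_frobFixed (K := K) (by omega : r ≠ 0), Multiset.mem_toFinset]
    refine ⟨fun h => ⟨?_, h⟩, fun h => h.2⟩
    rw [mem_roots hG0, ← dvd_iff_isRoot]
    refine dvd_trans ?_ h.2
    have := Finset.dvd_prod_of_mem (fun i => X - C (x ^ p ^ i))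
      (Finset.mem_range.2 (by omega : 0 < r))
    simpa only [pow_zero, pow_one] using this
  rw [Finset.sum_congr rfl h1, Finset.sum_comm]
  have h2 : ∀ x ∈ G.roots.toFinset, (∑ r ∈ Finset.Icc 1 g.natDegree, if x ^ p ^ r = x ∧
        ∏ i ∈ Finset.range r, (X - C (x ^ p ^ i)) ∣ G then 1 else 0) = G.roots.count x := by
    intro x _
    rw [← Finset.card_filter, count_roots]
    exact card_frobOrbit_dvd x G hG0 hGσ _ hGd.le
  rw [Finset.sum_congr rfl h2, Multiset.toFinset_sum_count_eq, ← hGd]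
  exact splits_iff_card_roots.1 (IsAlgClosed.splits G) |>.symm

theorem mul_lCoeff_eq [IsAlgClosed K] [CharP K p] (Ψ : AddChar K ℂ) (u v : (ZMod p)[X]) (k : ℕ) :
    (k : ℂ) * lCoeff Ψ u v k =
      ∑ r ∈ Finset.Icc 1 k, frobSum Ψ u v r * lCoeff Ψ u v (k - r) := by
  classical
  have h1 : ∀ g ∈ monicsOfDegree p k, (k : ℂ) * polyChar Ψ u v g =
      ∑ r ∈ Finset.Icc 1 k, ∑ x ∈ frobFixed p K r,
        if ∏ i ∈ Finset.range r, (X - C (x ^ p ^ i)) ∣ g.map (algebraMap (ZMod p) K) then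
          polyChar Ψ u v g else 0 := by
    intro g hg
    obtain ⟨hgm, rfl⟩ := mem_monicsOfDegree.1 hg
    conv_lhs => rw [natDegree_eq_sum_frobOrbit (K := K) g hgm]
    rw [Nat.cast_sum, Finset.sum_mul]
    refine Finset.sum_congr rfl fun r _ => ?_
    rw [← Finset.sum_filter, Finset.sum_const, nsmul_eq_mul]
  rw [lCoeff, Finset.mul_sum, Finset.sum_congr rfl h1, Finset.sum_comm]
  refine Finset.sum_congr rfl fun r hr => ?_
  rw [Finset.mem_Icc] at hr
  rw [Finset.sum_comm, frobSum, Finset.sum_mul]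
  refine Finset.sum_congr rfl fun x hx => ?_
  have hr0 : r ≠ 0 := by omega
  obtain ⟨m, hm⟩ := frobOrbit_lifts x r ((mem_frobFixed hr0).1 hx)
  have hmm : m.Monic := by
    have : (m.map (algebraMap (ZMod p) K)).Monic := by
      rw [hm]; exact monic_prod_of_monic _ _ fun i _ => monic_X_sub_C _
    exact (monic_map_iff).1 this
  have hmd : m.natDegree = r := by
    have := congrArg natDegree hm
    rw [natDegree_map, natDegree_prod_of_monic _ _ fun i _ => monic_X_sub_C _] at this
    simpa only [natDegree_X_sub_C, Finset.sum_const, Finset.card_range, smul_eq_mul, mul_one]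
      using this
  have h3 := polyChar_frobOrbit Ψ u v hr0 hm
  have h4 := sum_polyChar_of_dvd Ψ u v m hmm (k := k) (by omega)
  rw [hmd, h3] at h4
  rw [← hm]
  simp only [map_dvd_map']
  rw [← Finset.sum_filter]
  convert h4

end Newton

section PowerSums

theorem norm_le_one_of_powerSums_bounded (Z : Multiset ℂ) (c : ℝ)
    (h : ∀ b : ℕ, b ≠ 0 → ‖(Z.map fun z => z ^ b).sum‖ ≤ c) (z₀ : ℂ) (hz₀ : z₀ ∈ Z) :
    ‖z₀‖ ≤ 1 := by
  classical
  by_contra! hlt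
  -- a polynomial vanishing at every other element
  set f : ℂ[X] := ∏ z ∈ Z.toFinset.erase z₀, (X - C z) with hf
  have hf0 : eval z₀ f ≠ 0 := by
    rw [hf, eval_prod, Finset.prod_ne_zero_iff]
    intro z hz
    simpa [sub_eq_zero] using (Finset.ne_of_mem_erase hz).symm
  have hfz : ∀ z ∈ Z, z ≠ z₀ → eval z f = 0 := by
    intro z hz hne
    rw [hf, eval_prod]
    exact Finset.prod_eq_zero (Finset.mem_erase.2 ⟨hne, Multiset.mem_toFinset.2 hz⟩) (by simp)
  clear_value f
  have key : ∀ b : ℕ, (Z.map fun z => z ^ b * eval z f).sum = Z.count z₀ * (z₀ ^ b * eval z₀ f) := by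
    intro b
    rw [Finset.sum_multiset_map_count, Finset.sum_eq_single z₀]
    · rw [nsmul_eq_mul]
    · intro z hz hne
      rw [hfz z (Multiset.mem_toFinset.1 hz) hne]; simp
    · intro h; exact absurd (Multiset.mem_toFinset.2 hz₀) h
  have key2 : ∀ b : ℕ, (Z.map fun z => z ^ b * eval z f).sum =
      ∑ j ∈ Finset.range (f.natDegree + 1), f.coeff j * (Z.map fun z => z ^ (b + j)).sum := by
    intro b
    simp_rw [← Multiset.sum_map_mul_left]
    rw [← Multiset.sum_map_sum]
    congr 1
    refine Multiset.map_congr rfl fun z _ => ?_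
    rw [eval_eq_sum_range, Finset.mul_sum]
    exact Finset.sum_congr rfl fun j _ => by ring
  set M : ℝ := ∑ j ∈ Finset.range (f.natDegree + 1), ‖f.coeff j‖ * c with hM
  have hbound : ∀ b : ℕ, b ≠ 0 → ‖z₀‖ ^ b * ‖eval z₀ f‖ ≤ M := by
    intro b hb
    have h1 : ‖(Z.count z₀ : ℂ) * (z₀ ^ b * eval z₀ f)‖ ≤ M := by
      rw [← key, key2]
      refine (norm_sum_le _ _).trans (Finset.sum_le_sum fun j _ => ?_)
      rw [norm_mul]
      exact mul_le_mul_of_nonneg_left (h _ (by omega)) (norm_nonneg _)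
    rw [norm_mul, norm_mul, norm_pow, Complex.norm_natCast] at h1
    refine le_trans ?_ h1
    have : (1 : ℝ) ≤ Z.count z₀ := by
      exact_mod_cast Multiset.count_pos.2 hz₀
    exact le_mul_of_one_le_left (by positivity) this
  obtain ⟨b, hb⟩ := pow_unbounded_of_one_lt (M / ‖eval z₀ f‖) hlt
  have hpos : 0 < ‖eval z₀ f‖ := norm_pos_iff.2 hf0
  have h1 := hbound (b + 1) (by omega)
  rw [div_lt_iff₀ hpos] at hb
  have h2 : ‖z₀‖ ^ b ≤ ‖z₀‖ ^ (b + 1) := pow_le_pow_right₀ hlt.le (by omega)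
  nlinarith

theorem exists_prod_one_sub_mul_X (A : ℂ[X]) (hA : A.coeff 0 = 1) :
    ∃ ω : Multiset ℂ, Multiset.card ω ≤ A.natDegree ∧ A = (ω.map fun w => 1 - C w * X).prod := by
  have hA0 : A ≠ 0 := by rintro rfl; simp at hA
  refine ⟨A.roots.map fun ρ => ρ⁻¹, by simpa using card_roots' A, ?_⟩
  have hs := (IsAlgClosed.splits A).eq_prod_roots
  have hρ : ∀ ρ ∈ A.roots, ρ ≠ 0 := by
    rintro ρ hρ rfl
    rw [mem_roots hA0, IsRoot, ← coeff_zero_eq_eval_zero, hA] at hρ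
    exact one_ne_zero hρ
  have h1 : (A.roots.map fun ρ => X - C ρ).prod =
      C (A.roots.map fun ρ => -ρ).prod * (A.roots.map fun ρ => 1 - C ρ⁻¹ * X).prod := by
    rw [map_multiset_prod, Multiset.map_map, ← Multiset.prod_map_mul]
    congr 1
    refine Multiset.map_congr rfl fun ρ h => ?_
    have : (C ρ * C ρ⁻¹ : ℂ[X]) = 1 := by rw [← C_mul, mul_inv_cancel₀ (hρ ρ h), C_1]
    simp only [Function.comp_apply, C_neg]
    linear_combination (-X) * this
  rw [h1] at hs
  rw [Multiset.map_map]
  have h2 : ∀ s : Multiset ℂ, eval 0 (s.map fun ρ => 1 - C ρ⁻¹ * X).prod = 1 := by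
    intro s
    rw [eval_multiset_prod, Multiset.map_map]
    refine Multiset.prod_eq_one ?_
    simp +contextual [Multiset.mem_replicate]
  have h3 := congrArg (eval 0) hs
  rw [← coeff_zero_eq_eval_zero, hA, eval_mul, eval_mul, h2, eval_C, eval_C, mul_one] at h3
  rw [← mul_assoc, ← C_mul, ← h3, C_1, one_mul] at hs
  exact hs

/-- The generating series of the power sums of a multiset. -/
def powerSumSeries (ω : Multiset ℂ) : PowerSeries ℂ :=
  PowerSeries.mk fun r => if r = 0 then 0 else (ω.map fun w => w ^ r).sum

theorem X_mul_derivative_prod (ω : Multiset ℂ) :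
    (PowerSeries.X : PowerSeries ℂ) * PowerSeries.derivative ℂ
      (ω.map fun w => 1 - PowerSeries.C w * PowerSeries.X).prod =
      - (powerSumSeries ω * (ω.map fun w => 1 - PowerSeries.C w * PowerSeries.X).prod) := by
  induction ω using Multiset.induction_on with
  | empty =>
    have : powerSumSeries 0 = 0 := by ext n; simp [powerSumSeries]
    simp [this]
  | cons w s ih =>
    rw [Multiset.map_cons, Multiset.prod_cons]
    set A := (s.map fun w => 1 - PowerSeries.C w * PowerSeries.X).prod
    have h1 : powerSumSeries (w ::ₘ s) = powerSumSeries {w} + powerSumSeries s := by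
      ext n
      by_cases hn : n = 0 <;> simp [powerSumSeries, hn]
    have h2 : powerSumSeries {w} * (1 - PowerSeries.C w * PowerSeries.X) =
        PowerSeries.C w * PowerSeries.X := by
      have h3 : powerSumSeries {w} * (1 - PowerSeries.C w * PowerSeries.X) =
        powerSumSeries {w} - PowerSeries.C w * (powerSumSeries {w} * PowerSeries.X) := by ring
      rw [h3]
      ext n
      rcases n with _ | n
      · simp [powerSumSeries]
      · simp only [map_sub, PowerSeries.coeff_C_mul, PowerSeries.coeff_succ_mul_X]
        rcases n with _ | n
        · simp [powerSumSeries]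
        · simp [powerSumSeries, pow_succ]; ring
    have h4 : PowerSeries.derivative ℂ (1 - PowerSeries.C w * PowerSeries.X : PowerSeries ℂ) =
        - PowerSeries.C w := by
      rw [map_sub, Derivation.leibniz]
      simp
    rw [Derivation.leibniz, h4, h1, smul_eq_mul, smul_eq_mul]
    linear_combination (1 - PowerSeries.C w * PowerSeries.X) * ih + A * h2

theorem norm_le_of_newton (a S : ℕ → ℂ) (n : ℕ) (c q : ℝ) (hq : 0 < q) (ha0 : a 0 = 1)
    (ha : ∀ k, n < k → a k = 0)
    (hN : ∀ k : ℕ, (k : ℂ) * a k = ∑ r ∈ Finset.Icc 1 k, S r * a (k - r))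
    (hS : ∀ b : ℕ, b ≠ 0 → ‖S (2 * b)‖ ≤ c * q ^ b) : ‖S 1‖ ≤ n * √q := by
  set A : ℂ[X] := ∑ k ∈ Finset.range (n + 1), C (a k) * X ^ k with hA
  have hAc : ∀ k, A.coeff k = a k := by
    intro k
    simp only [hA, finsetSum_coeff, coeff_C_mul, coeff_X_pow, mul_ite, mul_one, mul_zero,
      Finset.sum_ite_eq, Finset.mem_range]
    split_ifs with h
    · rfl
    · exact (ha k (by omega)).symm
  have hAd : A.natDegree ≤ n := natDegree_le_iff_coeff_eq_zero.2 fun k hk => by rw [hAc, ha k hk]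
  obtain ⟨ω, hcard, hω⟩ := exists_prod_one_sub_mul_X A (by rw [hAc, ha0])
  clear_value A
  have hωP : (A : PowerSeries ℂ) = (ω.map fun w => 1 - PowerSeries.C w * PowerSeries.X).prod := by
    rw [hω]
    have := map_multiset_prod (Polynomial.coeToPowerSeries.ringHom (R := ℂ))
      (ω.map fun w => 1 - C w * X)
    rw [Multiset.map_map] at this
    refine this.trans ?_
    congr 1
    refine Multiset.map_congr rfl fun w _ => ?_
    simp
  set T : PowerSeries ℂ := PowerSeries.mk fun r => if r = 0 then 0 else S r with hT
  have hTA : (PowerSeries.X : PowerSeries ℂ) * PowerSeries.derivative ℂ (A : PowerSeries ℂ) =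
      T * A := by
    ext k
    rcases k with _ | k
    · simp [PowerSeries.coeff_mul, hT]
    · have h1 := hN (k + 1)
      rw [show Finset.Icc 1 (k + 1) = Finset.Ico 1 (k + 2) from rfl,
        Finset.sum_Ico_eq_sum_range] at h1
      rw [PowerSeries.coeff_succ_X_mul, PowerSeries.coeff_derivative, PowerSeries.coeff_mul,
        Finset.Nat.sum_antidiagonal_eq_sum_range_succ_mk, Finset.sum_range_succ']
      simp only [hT, PowerSeries.coeff_mk, Polynomial.coeff_coe, hAc, Nat.succ_ne_zero, if_false,
        if_true, zero_mul, add_zero]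
      push_cast at h1
      rw [mul_comm, h1]
      refine Finset.sum_congr rfl fun i _ => ?_
      rw [add_comm 1 i]
  have hA0 : (A : PowerSeries ℂ) ≠ 0 := by
    intro h
    have := congrArg (PowerSeries.coeff 0) h
    rw [Polynomial.coeff_coe, hAc, ha0] at this
    simp at this
  have hTω : T = - powerSumSeries ω := by
    apply mul_right_cancel₀ hA0
    rw [← hTA, neg_mul, hωP, X_mul_derivative_prod]
  have hSω : ∀ r, r ≠ 0 → S r = - (ω.map fun w => w ^ r).sum := by
    intro r hr
    have := congrArg (PowerSeries.coeff r) hTω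
    simpa [hT, powerSumSeries, hr] using this
  have hroot : ∀ w ∈ ω, ‖w‖ ≤ √q := by
    intro w hw
    have := norm_le_one_of_powerSums_bounded (ω.map fun w => w ^ 2 / q) c ?_ (w ^ 2 / q)
      (Multiset.mem_map_of_mem _ hw)
    · rw [norm_div, norm_pow, Complex.norm_real, Real.norm_of_nonneg hq.le, div_le_one hq] at this
      exact Real.le_sqrt_of_sq_le this
    · intro b hb
      rw [Multiset.map_map]
      have h1 : (ω.map ((fun z : ℂ => z ^ b) ∘ fun w => w ^ 2 / q)).sum = - S (2 * b) / q ^ b := by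
        rw [hSω _ (by omega), neg_neg, ← Multiset.sum_map_div]
        congr 1
        refine Multiset.map_congr rfl fun w _ => ?_
        simp [div_pow, pow_mul]
      rw [h1, norm_div, norm_neg, norm_pow, Complex.norm_real, Real.norm_of_nonneg hq.le,
        div_le_iff₀ (by positivity)]
      exact hS b hb
  rw [hSω 1 one_ne_zero, norm_neg]
  simp only [pow_one, Multiset.map_id']
  have h1 : ‖ω.sum‖ ≤ (ω.map fun w => ‖w‖).sum := norm_multiset_sum_le _
  refine h1.trans ?_
  refine (Multiset.sum_le_card_nsmul _ (√q) ?_).trans ?_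
  · simpa using hroot
  · rw [nsmul_eq_mul, Multiset.card_map]
    gcongr
    omega

end PowerSums

section WeilBound

variable {p : ℕ} [Fact p.Prime]

theorem exists_addChar_extension (K : Type*) [Field K] [Algebra (ZMod p) K] :
    ∃ Ψ : AddChar K ℂ, ∀ t : ZMod p, Ψ (algebraMap (ZMod p) K t) = ZMod.stdAddChar t := by
  obtain ⟨π, hπ⟩ := LinearMap.exists_leftInverse_of_injective (Algebra.linearMap (ZMod p) K)
    (LinearMap.ker_eq_bot.2 (algebraMap (ZMod p) K).injective)
  refine ⟨(ZMod.stdAddChar (N := p)).compAddMonoidHom π.toAddMonoidHom, fun t => ?_⟩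
  have := LinearMap.congr_fun hπ t
  simp only [LinearMap.comp_apply, Algebra.linearMap_apply, LinearMap.id_apply] at this
  simp [AddChar.compAddMonoidHom_apply, this]

theorem sum_stdAddChar : ∑ t : ZMod p, ZMod.stdAddChar t = (0 : ℂ) := by
  have := AddChar.sum_eq_zero_of_ne_one (ψ := ZMod.stdAddChar (N := p)) ?_
  · exact this
  · intro h
    have := ZMod.isPrimitive_stdAddChar p (one_ne_zero)
    apply this
    rw [h]
    ext; simp

theorem card_frobFixed (K : Type*) [Field K] [IsAlgClosed K] [CharP K p] {r : ℕ} (hr : r ≠ 0) :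
    (frobFixed p K r).card = p ^ r := by
  classical
  have hp := (Fact.out : p.Prime).one_lt
  have hsep : (X ^ p ^ r - X : K[X]).Separable := galois_poly_separable p _ (dvd_pow_self p hr)
  rw [frobFixed, Multiset.toFinset_card_of_nodup (nodup_roots hsep),
    splits_iff_card_roots.1 (IsAlgClosed.splits _), FiniteField.X_pow_card_pow_sub_X_natDegree_eq K hr hp]

variable {K : Type*} [Field K] [IsAlgClosed K] [Algebra (ZMod p) K]

theorem norm_frobSum_le (Ψ : AddChar K ℂ)
    (hΨ : ∀ t : ZMod p, Ψ (algebraMap (ZMod p) K t) = ZMod.stdAddChar t)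
    (u v : (ZMod p)[X]) (huv : IsCoprime u v) (hu : u.natDegree ≤ v.natDegree)
    (hv : v.natDegree ≠ 0) (hvp : v.natDegree < p) (b : ℕ) (hb : b ≠ 0) :
    ‖frobSum Ψ u v (2 * b)‖ ≤ (3 * v.natDegree * p : ℝ) * (p : ℝ) ^ b := by
  classical
  have : CharP K p := charP_of_injective_algebraMap' (ZMod p) p
  obtain ⟨b, rfl⟩ := Nat.exists_eq_succ_of_ne_zero hb
  set d := v.natDegree with hd
  have hv0 : v ≠ 0 := by rintro rfl; simp at hd; exact hv hd
  set f : K → K := fun x => ∑ i ∈ Finset.range (2 * (b + 1)), (aeval x u / aeval x v) ^ p ^ i with hf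
  set U : Finset K := (frobFixed p K (2 * (b + 1))).filter fun x => aeval x v ≠ 0 with hU
  have hmemU : ∀ x, x ∈ U ↔ x ^ p ^ (2 * (b + 1)) = x ∧ aeval x v ≠ 0 := by
    intro x
    rw [hU, Finset.mem_filter, mem_frobFixed (by omega)]
  -- the root of `v`
  obtain ⟨x0, hx0⟩ : ∃ x0 : K, aeval x0 v = 0 := by
    apply IsAlgClosed.exists_aeval_eq_zero
    intro h
    exact hv (natDegree_eq_zero_iff_degree_le_zero.2 h.le)
  have hx0u : aeval x0 u ≠ 0 := by
    obtain ⟨s, t, h⟩ := huv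
    intro h0
    have := congrArg (aeval x0) h
    simp [h0, hx0] at this
  have hN : ∀ t : ZMod p, (U.filter fun x => f x = algebraMap (ZMod p) K t).card ≤
      p ^ (b + 1) * (p ^ b + 2 * d) := by
    intro t
    refine stepanov u v d hu le_rfl hvp x0 hx0 hv0 hx0u b t _ ?_
    intro x hx
    rw [Finset.mem_filter, hmemU] at hx
    exact ⟨hx.1.1, hx.1.2, hx.2⟩
  have hfp : ∀ x ∈ U, ∃ t : ZMod p, f x = algebraMap (ZMod p) K t := by
    intro x hx
    rw [hmemU] at hx
    have hq : (aeval x u / aeval x v) ^ p ^ (2 * (b + 1)) = aeval x u / aeval x v := by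
      rw [div_pow, ← aeval_pow_pow_char, ← aeval_pow_pow_char, hx.1]
    have h1 : f x ^ p = f x := by
      simp only [hf]
      rw [sum_pow_char]
      have h2 := Finset.sum_range_succ' (fun i => (aeval x u / aeval x v) ^ p ^ i) (2 * (b + 1))
      rw [Finset.sum_range_succ, hq] at h2
      simp only [pow_zero, pow_one] at h2
      have h3 := add_right_cancel h2
      rw [h3]
      exact Finset.sum_congr rfl fun i _ => by rw [← pow_mul, pow_succ]
    rw [← Subfield.mem_bot_iff_pow_eq_self, mem_bot_iff_intCast p K] at h1
    obtain ⟨k, hk⟩ := h1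
    exact ⟨k, by simp [hk]⟩
  have hinj := (algebraMap (ZMod p) K).injective
  have hsplit : ∀ {M : Type} [AddCommMonoid M] (g : K → M), ∑ x ∈ U, g x =
      ∑ t : ZMod p, ∑ x ∈ U.filter fun x => f x = algebraMap (ZMod p) K t, g x := by
    intro M _ g
    have : U = (Finset.univ : Finset (ZMod p)).biUnion
        fun t => U.filter fun x => f x = algebraMap (ZMod p) K t := by
      ext x
      simp only [Finset.mem_biUnion, Finset.mem_univ, true_and, Finset.mem_filter]
      exact ⟨fun h => (hfp x h).imp fun t ht => ⟨h, ht⟩, fun ⟨t, h, _⟩ => h⟩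
    conv_lhs => rw [this]
    rw [Finset.sum_biUnion]
    intro t _ t' _ hne
    rw [Function.onFun, Finset.disjoint_left]
    intro x hx hx'
    rw [Finset.mem_filter] at hx hx'
    exact hne (hinj (hx.2.symm.trans hx'.2))
  set N : ZMod p → ℕ := fun t => (U.filter fun x => f x = algebraMap (ZMod p) K t).card with hNdef
  have hsumN : ∑ t, N t = U.card := by
    have := hsplit (fun _ => (1 : ℕ))
    simpa [hNdef] using this.symm
  have hS : frobSum Ψ u v (2 * (b + 1)) = ∑ t : ZMod p, (N t : ℂ) * ZMod.stdAddChar t := by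
    rw [frobSum, ← Finset.sum_filter, hsplit]
    refine Finset.sum_congr rfl fun t _ => ?_
    rw [hNdef, ← nsmul_eq_mul, ← Finset.sum_const]
    refine Finset.sum_congr rfl fun x hx => ?_
    rw [Finset.mem_filter] at hx
    rw [← hΨ, ← hx.2]
  have hUcard : p ^ (2 * (b + 1)) ≤ U.card + d := by
    rw [← card_frobFixed K (p := p) (by omega : 2 * (b + 1) ≠ 0),
      ← Finset.card_filter_add_card_filter_not (fun x : K => aeval x v ≠ 0)]
    refine Nat.add_le_add_left ?_ _
    have hvK : v.map (algebraMap (ZMod p) K) ≠ 0 := Polynomial.map_ne_zero hv0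
    have := card_le_degree_of_subset_roots (p := v.map (algebraMap (ZMod p) K))
      (Z := (frobFixed p K (2 * (b + 1))).filter fun x => ¬ aeval x v ≠ 0) ?_
    · rwa [natDegree_map] at this
    · intro x hx
      rw [Finset.mem_val, Finset.mem_filter, not_not] at hx
      rw [mem_roots hvK, IsRoot, eval_map_algebraMap]
      exact hx.2
  have hN' : ∀ t, N t ≤ p ^ (b + 1) * (p ^ b + 2 * d) := hN
  clear_value N
  set M : ℝ := ((p ^ (b + 1) * (p ^ b + 2 * d) : ℕ) : ℝ) with hM
  have hNM : ∀ t, (N t : ℝ) ≤ M := fun t => by rw [hM]; exact_mod_cast hN' t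
  have h1 : frobSum Ψ u v (2 * (b + 1)) = - ∑ t : ZMod p, ((M - N t : ℝ) : ℂ) * ZMod.stdAddChar t := by
    rw [hS]
    push_cast
    simp_rw [sub_mul]
    rw [Finset.sum_sub_distrib, ← Finset.mul_sum, sum_stdAddChar]
    ring
  rw [h1, norm_neg]
  have h2 : ‖∑ t : ZMod p, ((M - N t : ℝ) : ℂ) * ZMod.stdAddChar t‖ ≤ ∑ t : ZMod p, (M - N t) := by
    refine (norm_sum_le _ _).trans (Finset.sum_le_sum fun t _ => ?_)
    rw [norm_mul, Complex.norm_real, Real.norm_of_nonneg (sub_nonneg.2 (hNM t)),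
      AddChar.norm_apply, mul_one]
  refine h2.trans ?_
  rw [Finset.sum_sub_distrib, Finset.sum_const, Finset.card_univ, ZMod.card, ← Nat.cast_sum, hsumN,
    nsmul_eq_mul]
  have h3 : (p : ℝ) ^ (2 * (b + 1)) ≤ U.card + d := by exact_mod_cast hUcard
  have h4 : (1 : ℝ) ≤ (p : ℝ) * (p : ℝ) ^ (b + 1) := by
    have : (1 : ℝ) ≤ p := by exact_mod_cast (Fact.out : p.Prime).one_lt.le
    exact one_le_mul_of_one_le_of_one_le this (one_le_pow₀ this)
  have h5 : (d : ℝ) ≤ d * ((p : ℝ) * (p : ℝ) ^ (b + 1)) := le_mul_of_one_le_right (by positivity) h4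
  have h6 : (p : ℝ) * M = (p : ℝ) ^ (2 * (b + 1)) + 2 * d * ((p : ℝ) * (p : ℝ) ^ (b + 1)) := by
    rw [hM]; push_cast; ring
  rw [Nat.succ_eq_add_one]
  linarith

/-- The norm of an additive-character sum of a reduced fraction that is finite at infinity. -/
theorem norm_sum_stdAddChar_le_of_isCoprime (u v : (ZMod p)[X]) (hvm : v.Monic)
    (huv : IsCoprime u v) (hu : u.natDegree ≤ v.natDegree)
    (hv : v.natDegree ≠ 0) (hvp : 2 * v.natDegree < p) :
    ‖∑ x : ZMod p, if eval x v ≠ 0 then (ZMod.stdAddChar (eval x u / eval x v) : ℂ) else 0‖ ≤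
      2 * v.natDegree * √p := by
  classical
  have hp := (Fact.out : p.Prime)
  set d := v.natDegree with hd
  let K := AlgebraicClosure (ZMod p)
  have : CharP K p := charP_of_injective_algebraMap' (ZMod p) p
  obtain ⟨Ψ, hΨ⟩ := exists_addChar_extension (p := p) K
  have hroots : ((Finset.univ : Finset (ZMod p)).filter fun x => eval x v = 0).card ≤ d := by
    refine card_le_degree_of_subset_roots fun x hx => ?_
    rw [Finset.mem_val, Finset.mem_filter] at hx
    exact (mem_roots hvm.ne_zero).2 hx.2
  -- two points with different values
  obtain ⟨a, ha⟩ : ∃ a : ZMod p, eval a v ≠ 0 := by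
    by_contra! h
    rw [Finset.filter_true_of_mem (fun x _ => h x), Finset.card_univ, ZMod.card] at hroots
    omega
  obtain ⟨b, hb, hab⟩ : ∃ b : ZMod p, eval b v ≠ 0 ∧ eval a u / eval a v ≠ eval b u / eval b v := by
    by_contra! h
    set c := eval a u / eval a v
    have hz : u - C c * v = 0 := by
      by_contra hz
      have h1 : ((Finset.univ : Finset (ZMod p)).filter fun x => ¬ eval x v = 0).card ≤ d := by
        refine (card_le_degree_of_subset_roots (p := u - C c * v) fun x hx => ?_).trans ?_
        · rw [Finset.mem_val, Finset.mem_filter] at hx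
          rw [mem_roots hz, IsRoot, eval_sub, eval_mul, eval_C, h x hx.2,
            div_mul_cancel₀ _ hx.2, sub_self]
        · exact (natDegree_sub_le _ _).trans (max_le hu (natDegree_C_mul_le _ _))
      have h2 := Finset.card_filter_add_card_filter_not (s := (Finset.univ : Finset (ZMod p)))
        (fun x => eval x v = 0)
      rw [Finset.card_univ, ZMod.card] at h2
      omega
    have hvu : IsUnit v := by
      refine huv.isUnit_of_dvd' ?_ dvd_rfl
      rw [sub_eq_zero.1 hz]
      exact dvd_mul_left _ _
    exact hv (natDegree_eq_zero_of_isUnit hvu)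
  have hL : ∀ k, 2 * d ≤ k → lCoeff Ψ u v k = 0 := fun k hk =>
    lCoeff_eq_zero Ψ u v hvm hu a b ha hb (by
      rw [hΨ, hΨ]; exact fun h => hab (ZMod.injective_stdAddChar h)) k hk
  have hS1 : frobSum Ψ u v 1 =
      ∑ x : ZMod p, if eval x v ≠ 0 then (ZMod.stdAddChar (eval x u / eval x v) : ℂ) else 0 := by
    rw [frobSum]
    symm
    refine Finset.sum_bij (fun x _ => algebraMap (ZMod p) K x) ?_ ?_ ?_ ?_
    · intro x _
      rw [mem_frobFixed one_ne_zero, pow_one, ← map_pow, ZMod.pow_card]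
    · intro x _ y _ h
      exact (algebraMap (ZMod p) K).injective h
    · intro y hy
      rw [mem_frobFixed one_ne_zero, pow_one, ← Subfield.mem_bot_iff_pow_eq_self,
        mem_bot_iff_intCast p K] at hy
      obtain ⟨k, hk⟩ := hy
      exact ⟨k, Finset.mem_univ _, by simp [hk]⟩
    · intro x _
      simp only [aeval_algebraMap_apply_eq_algebraMap_eval, Finset.range_one, Finset.sum_singleton,
        pow_zero, pow_one, ← map_div₀, hΨ]
      simp
  rw [← hS1]
  have h0 : lCoeff Ψ u v 0 = 1 := by
    have : monicsOfDegree p 0 = {1} := by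
      ext g
      rw [mem_monicsOfDegree, Finset.mem_singleton]
      exact ⟨fun h => (Monic.natDegree_eq_zero h.1).1 h.2, by rintro rfl; simp⟩
    rw [lCoeff, this, Finset.sum_singleton, polyChar, rootSum]
    simp
  have := norm_le_of_newton (lCoeff Ψ u v) (frobSum Ψ u v) (2 * d) (3 * d * p) p
    (by exact_mod_cast hp.pos) h0 (fun k hk => hL k hk.le) (mul_lCoeff_eq Ψ u v)
    (norm_frobSum_le Ψ hΨ u v huv hu hv (by omega))
  push_cast at this
  exact this

end WeilBound

theorem exists_monic_isCoprime_of_ne_zero {F : Type*} [Field F] (u v : F[X]) (hv : v ≠ 0) :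
    ∃ G u' v' : F[X], u = G * u' ∧ v = G * v' ∧ v'.Monic ∧ IsCoprime u' v' ∧ G ≠ 0 := by
  classical
  set g := EuclideanDomain.gcd u v with hg
  obtain ⟨u₁, hu₁⟩ := EuclideanDomain.gcd_dvd_left u v
  obtain ⟨v₁, hv₁⟩ := EuclideanDomain.gcd_dvd_right u v
  rw [← hg] at hu₁ hv₁
  have hg0 : g ≠ 0 := by rintro h; rw [h, zero_mul] at hv₁; exact hv hv₁
  have hv₁0 : v₁ ≠ 0 := by rintro h; rw [h, mul_zero] at hv₁; exact hv hv₁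
  have hlc : v₁.leadingCoeff ≠ 0 := leadingCoeff_ne_zero.2 hv₁0
  have hcop : IsCoprime u₁ v₁ := by
    have := EuclideanDomain.gcd_eq_gcd_ab u v
    rw [← hg] at this
    refine ⟨EuclideanDomain.gcdA u v, EuclideanDomain.gcdB u v, mul_left_cancel₀ hg0 ?_⟩
    linear_combination -this - EuclideanDomain.gcdA u v * hu₁ - EuclideanDomain.gcdB u v * hv₁
  have hunit : IsUnit (C v₁.leadingCoeff⁻¹ : F[X]) := (isUnit_C).2 (inv_ne_zero hlc).isUnit
  have hCC : (C v₁.leadingCoeff * C v₁.leadingCoeff⁻¹ : F[X]) = 1 := by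
    rw [← C_mul, mul_inv_cancel₀ hlc, C_1]
  refine ⟨g * C v₁.leadingCoeff, u₁ * C v₁.leadingCoeff⁻¹, v₁ * C v₁.leadingCoeff⁻¹, ?_, ?_,
    monic_mul_leadingCoeff_inv hv₁0, ?_, mul_ne_zero hg0 (C_ne_zero.2 hlc)⟩
  · linear_combination hu₁ - g * u₁ * hCC
  · linear_combination hv₁ - g * v₁ * hCC
  · exact (isCoprime_mul_unit_right hunit u₁ v₁).2 hcop

section WeilGeneral

variable {p : ℕ} [Fact p.Prime]

theorem card_filter_eval_eq_zero_le (f : (ZMod p)[X]) (hf : f ≠ 0) :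
    ((Finset.univ : Finset (ZMod p)).filter fun x => eval x f = 0).card ≤ f.natDegree := by
  classical
  refine card_le_degree_of_subset_roots fun x hx => ?_
  rw [Finset.mem_val, Finset.mem_filter] at hx
  exact (mem_roots hf).2 hx.2

theorem norm_sum_stdAddChar_le_of_natDegree_le (u v : (ZMod p)[X]) (hv : v ≠ 0)
    (hu : u.natDegree ≤ v.natDegree) (huv : ∀ c, u ≠ C c * v) (hvp : 2 * v.natDegree < p) :
    ‖∑ x : ZMod p, if eval x v ≠ 0 then (ZMod.stdAddChar (eval x u / eval x v) : ℂ) else 0‖ ≤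
      3 * v.natDegree * √p := by
  classical
  obtain ⟨G, u', v', hGu, hGv, hvm, hcop, hG⟩ := exists_monic_isCoprime_of_ne_zero u v hv
  have hu0 : u' ≠ 0 := by
    rintro h
    apply huv 0
    rw [hGu, h]; simp
  have hdu : u.natDegree = G.natDegree + u'.natDegree := by rw [hGu, natDegree_mul hG hu0]
  have hdv : v.natDegree = G.natDegree + v'.natDegree := by rw [hGv, natDegree_mul hG hvm.ne_zero]
  have hv'0 : v'.natDegree ≠ 0 := by
    intro h0
    have h1 : v' = 1 := (Monic.natDegree_eq_zero hvm).1 h0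
    have h2 : u'.natDegree = 0 := by omega
    rw [natDegree_eq_zero] at h2
    obtain ⟨c, hc⟩ := h2
    apply huv c
    rw [hGu, hGv, h1, ← hc]; ring
  have hmain := norm_sum_stdAddChar_le_of_isCoprime u' v' hvm hcop (by omega) hv'0 (by omega)
  set S := ∑ x : ZMod p, if eval x v ≠ 0 then (ZMod.stdAddChar (eval x u / eval x v) : ℂ) else 0
    with hS
  set S' := ∑ x : ZMod p, if eval x v' ≠ 0 then (ZMod.stdAddChar (eval x u' / eval x v') : ℂ) else 0
    with hS'
  have hdiff : ‖S - S'‖ ≤ v.natDegree := by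
    rw [hS, hS', ← Finset.sum_sub_distrib]
    refine (norm_sum_le _ _).trans ?_
    have : ∀ x ∈ (Finset.univ : Finset (ZMod p)), ‖(if eval x v ≠ 0 then
        (ZMod.stdAddChar (eval x u / eval x v) : ℂ) else 0) - (if eval x v' ≠ 0 then
        (ZMod.stdAddChar (eval x u' / eval x v') : ℂ) else 0)‖ ≤ if eval x v = 0 then 1 else 0 := by
      intro x _
      by_cases h : eval x v = 0
      · rw [if_neg (not_not.2 h), if_pos h, zero_sub, norm_neg]
        split_ifs
        · rw [AddChar.norm_apply]
        · simp
      · have h1 := h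
        rw [hGv, eval_mul] at h1
        have h2 : eval x G ≠ 0 := left_ne_zero_of_mul h1
        have h3 : eval x v' ≠ 0 := right_ne_zero_of_mul h1
        rw [if_pos h, if_neg h, if_pos h3, hGu, hGv, eval_mul, eval_mul, mul_div_mul_left _ _ h2,
          sub_self, norm_zero]
    refine (Finset.sum_le_sum this).trans ?_
    rw [← Finset.sum_filter, Finset.sum_const, nsmul_eq_mul, mul_one]
    exact_mod_cast card_filter_eval_eq_zero_le v hv
  have h1 : ‖S‖ ≤ ‖S - S'‖ + ‖S'‖ := by
    have := norm_add_le (S - S') S'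
    rwa [sub_add_cancel] at this
  have hsq : (1 : ℝ) ≤ √p := Real.one_le_sqrt.2 (by exact_mod_cast (Fact.out : p.Prime).one_lt.le)
  have h2 : (v'.natDegree : ℝ) ≤ v.natDegree := by exact_mod_cast (by omega)
  have h3 : (v'.natDegree : ℝ) * √p ≤ v.natDegree * √p := by gcongr
  have h4 : (v.natDegree : ℝ) ≤ v.natDegree * √p := le_mul_of_one_le_right (by positivity) hsq
  linarith

/-- **Weil's bound** for rational functions over a prime field, with an elementary constant. -/
theorem norm_sum_stdAddChar_le (d : ℕ) (u v : (ZMod p)[X]) (hv : v ≠ 0)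
    (hud : u.natDegree ≤ d) (hvd : v.natDegree ≤ d) (huv : ∀ c, u ≠ C c * v) (hdp : 2 * d < p) :
    ‖∑ x : ZMod p, if eval x v ≠ 0 then (ZMod.stdAddChar (eval x u / eval x v) : ℂ) else 0‖ ≤
      5 * d * √p := by
  classical
  have hd : d ≠ 0 := by
    rintro rfl
    obtain ⟨c, hc⟩ := natDegree_eq_zero.1 (Nat.le_zero.1 hud)
    obtain ⟨c', hc'⟩ := natDegree_eq_zero.1 (Nat.le_zero.1 hvd)
    have : c' ≠ 0 := by rintro rfl; simp at hc'; exact hv hc'.symm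
    apply huv (c / c')
    rw [← hc, ← hc', ← C_mul, div_mul_cancel₀ _ this]
  obtain ⟨a, ha⟩ : ∃ a : ZMod p, eval a v ≠ 0 := by
    by_contra! h
    have := card_filter_eval_eq_zero_le v hv
    rw [Finset.filter_true_of_mem (fun x _ => h x), Finset.card_univ, ZMod.card] at this
    omega
  set φ : (ZMod p)[X] → (ZMod p)[X] := fun f => reflect d (f.comp (X + C a)) with hφ
  have hφd : ∀ f : (ZMod p)[X], f.natDegree ≤ d → (φ f).natDegree ≤ d := by
    intro f hf
    refine natDegree_le_iff_coeff_eq_zero.2 fun N hN => ?_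
    rw [hφ, coeff_reflect, revAt_eq_self_of_lt hN]
    refine coeff_eq_zero_of_natDegree_lt ?_
    rw [natDegree_comp, natDegree_X_add_C, mul_one]
    omega
  have hφe : ∀ f : (ZMod p)[X], f.natDegree ≤ d → ∀ z : ZMod p, z ≠ 0 →
      eval z (φ f) = z ^ d * eval (a + z⁻¹) f := by
    intro f hf z hz
    let hz' : Invertible z⁻¹ := invertibleOfNonzero (inv_ne_zero hz)
    have h1 := eval₂_reflect_mul_pow (RingHom.id (ZMod p)) z⁻¹ d (f.comp (X + C a)) (by
      rw [natDegree_comp, natDegree_X_add_C, mul_one]; exact hf)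
    rw [invOf_eq_inv, inv_inv, ← eval, ← eval, eval_comp, eval_add, eval_X, eval_C] at h1
    rw [add_comm a, ← h1, mul_comm, mul_assoc, ← mul_pow, inv_mul_cancel₀ hz, one_pow, mul_one]
  have hφv : (φ v).natDegree = d := by
    refine natDegree_eq_of_le_of_coeff_ne_zero (hφd v hvd) ?_
    rw [hφ, coeff_reflect, revAt_le le_rfl, Nat.sub_self, coeff_zero_eq_eval_zero]
    simpa using ha
  have hφv0 : φ v ≠ 0 := by rintro h; rw [h] at hφv; simp at hφv; exact hd hφv.symm
  have hmain := norm_sum_stdAddChar_le_of_natDegree_le (φ u) (φ v) hφv0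
    (by rw [hφv]; exact hφd u hud) ?_ (by rw [hφv]; exact hdp)
  swap
  · intro c hc
    apply huv c
    have h1 : (u.comp (X + C a)) = C c * v.comp (X + C a) := by
      have := congrArg (reflect d) hc
      simpa only [hφ, reflect_C_mul, reflect_reflect] using this
    have h2 := congrArg (fun q => q.comp (X - C a)) h1
    simpa [comp_assoc] using h2
  rw [hφv] at hmain
  set F : ZMod p → ℂ := fun x =>
    if eval x v ≠ 0 then (ZMod.stdAddChar (eval x u / eval x v) : ℂ) else 0 with hF
  set F' : ZMod p → ℂ := fun x =>
    if eval x (φ v) ≠ 0 then (ZMod.stdAddChar (eval x (φ u) / eval x (φ v)) : ℂ) else 0 with hF'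
  have hFb : ∀ x, ‖F x‖ ≤ 1 := by
    intro x; simp only [hF]; split_ifs
    · rw [AddChar.norm_apply]
    · simp
  have hFb' : ∀ x, ‖F' x‖ ≤ 1 := by
    intro x; simp only [hF']; split_ifs
    · rw [AddChar.norm_apply]
    · simp
  have hFF : ∀ z : ZMod p, z ≠ 0 → F' z = F (a + z⁻¹) := by
    intro z hz
    simp only [hF, hF', hφe v hvd z hz, hφe u hud z hz]
    have : z ^ d ≠ 0 := pow_ne_zero _ hz
    rw [mul_div_mul_left _ _ this]
    simp [this]
  have hsum : ∑ x, F x - F a = ∑ x, F' x - F' 0 := by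
    rw [Finset.sum_eq_sum_sdiff_singleton_add (Finset.mem_univ a) F,
      Finset.sum_eq_sum_sdiff_singleton_add (Finset.mem_univ 0) F', add_sub_cancel_right,
      add_sub_cancel_right]
    refine Finset.sum_bij' (fun x _ => (x - a)⁻¹) (fun z _ => a + z⁻¹) ?_ ?_ ?_ ?_ ?_
    · intro x hx; simpa [sub_eq_zero] using hx
    · intro x hx; simpa using hx
    · intro x hx; simp
    · intro x hx; simp
    · intro x hx
      rw [hFF _ (by simpa [sub_eq_zero] using hx)]
      simp
  have h1 : ‖∑ x, F x‖ ≤ ‖∑ x, F' x‖ + 2 := by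
    have : ∑ x, F x = ∑ x, F' x + (F a - F' 0) := by linear_combination hsum
    rw [this]
    refine (norm_add_le _ _).trans ?_
    have := norm_sub_le (F a) (F' 0)
    linarith [hFb a, hFb' 0]
  have hsq : (1 : ℝ) ≤ √p := Real.one_le_sqrt.2 (by exact_mod_cast (Fact.out : p.Prime).one_lt.le)
  have h2 : (1 : ℝ) ≤ d := by exact_mod_cast Nat.pos_of_ne_zero hd
  have h3 : (1 : ℝ) ≤ d * √p := one_le_mul_of_one_le_of_one_le h2 hsq
  linarith

end WeilGeneral

section Hensel

variable {F : Type*} [Field F]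

/-- Hensel's lemma for power series over a field, for polynomials that need not be monic. -/
theorem PowerSeries_exists_isRoot (f : (PowerSeries F)[X]) (a₀ : PowerSeries F)
    (h0 : PowerSeries.constantCoeff (eval a₀ f) = 0)
    (h1 : PowerSeries.constantCoeff (eval a₀ (derivative f)) ≠ 0) :
    ∃ a : PowerSeries F, eval a f = 0 ∧
      PowerSeries.constantCoeff a = PowerSeries.constantCoeff a₀ := by
  set π := PowerSeries.constantCoeff (R := F)
  set T : PowerSeries F := PowerSeries.X with hT
  have hderiv : ∀ y : PowerSeries F, π y = π a₀ → π (eval y (derivative f)) ≠ 0 := by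
    intro y hy
    have : ∀ g : (PowerSeries F)[X], π (eval y g) = π (eval a₀ g) := by
      intro g
      rw [← eval₂_at_apply, ← eval₂_at_apply, hy]
    rw [this]; exact h1
  have hstep : ∀ n : ℕ, ∀ y : PowerSeries F, π y = π a₀ → T ^ (n + 1) ∣ eval y f →
      ∃ c : F, T ^ (n + 2) ∣ eval (y + PowerSeries.C c * T ^ (n + 1)) f := by
    intro n y hy ⟨w, hw⟩
    refine ⟨-(π w) / π (eval y (derivative f)), ?_⟩
    set c : F := -(π w) / π (eval y (derivative f)) with hc
    obtain ⟨k, hk⟩ := f.binomExpansion y (PowerSeries.C c * T ^ (n + 1))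
    rw [hk, hw]
    have h2 : T ∣ w + eval y (derivative f) * PowerSeries.C c := by
      rw [PowerSeries.X_dvd_iff]
      change π _ = 0
      rw [map_add, map_mul, hc]
      have := hderiv y hy
      have h3 : π (PowerSeries.C (-(π w) / π (eval y (derivative f)))) =
        -(π w) / π (eval y (derivative f)) := PowerSeries.constantCoeff_C _
      rw [h3]
      field_simp
      ring
    obtain ⟨z, hz⟩ := h2
    refine ⟨z + k * PowerSeries.C c ^ 2 * T ^ n, ?_⟩
    linear_combination T ^ (n + 1) * hz
  choose! c hc using hstep
  let y : ℕ → PowerSeries F := fun n => Nat.recOn n a₀ fun n b => b + PowerSeries.C (c n b) * T ^ (n + 1)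
  have hy1 : ∀ n, y (n + 1) = y n + PowerSeries.C (c n (y n)) * T ^ (n + 1) := fun n => rfl
  have hyπ : ∀ n, π (y n) = π a₀ := by
    intro n
    induction n with
    | zero => rfl
    | succ n ih => rw [hy1, map_add, ih]; simp [π, hT]
  have hyd : ∀ n, T ^ (n + 1) ∣ eval (y n) f := by
    intro n
    induction n with
    | zero =>
      rw [zero_add, pow_one, PowerSeries.X_dvd_iff]
      exact h0
    | succ n ih => exact hc n (y n) (hyπ n) ih
  have hyc : ∀ n m, n ≤ m → T ^ (n + 1) ∣ y m - y n := by
    intro n m hnm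
    induction m, hnm using Nat.le_induction with
    | base => simp
    | succ m hm ih =>
      rw [hy1, add_sub_right_comm]
      exact dvd_add ih (dvd_mul_of_dvd_right (pow_dvd_pow _ (by omega)) _)
  set L : PowerSeries F := PowerSeries.mk fun n => PowerSeries.coeff n (y n) with hL
  have hLd : ∀ n, T ^ (n + 1) ∣ L - y n := by
    intro n
    rw [PowerSeries.X_pow_dvd_iff]
    intro m hm
    have := (PowerSeries.X_pow_dvd_iff.1 (hyc m n (by omega))) m (by omega)
    rw [map_sub, sub_eq_zero] at this
    rw [map_sub, hL, PowerSeries.coeff_mk, this, sub_self]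
  refine ⟨L, ?_, ?_⟩
  · ext n
    have h2 : T ^ (n + 1) ∣ eval L f := by
      have h3 := (hLd n).trans (sub_dvd_eval_sub L (y n) f)
      have := dvd_add h3 (hyd n)
      rwa [sub_add_cancel] at this
    rw [PowerSeries.X_pow_dvd_iff.1 h2 n (by omega), map_zero]
  · have := (PowerSeries.X_pow_dvd_iff.1 (hLd 0)) 0 (by omega)
    rw [map_sub, sub_eq_zero] at this
    simpa [π, y] using this

end Hensel

section Elimination

/-- Evaluation of an integer polynomial at an element of a commutative ring. -/
def intEval {S : Type*} [CommRing S] (x : S) : ℤ[X] →+* S := eval₂RingHom (Int.castRingHom S) x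

@[simp] theorem intEval_X {S : Type*} [CommRing S] (x : S) : intEval x X = x := eval₂_X _ _

@[simp] theorem intEval_C {S : Type*} [CommRing S] (x : S) (n : ℤ) : intEval x (C n) = n :=
  eval₂_C _ _

theorem map_intEval {S T : Type*} [CommRing S] [CommRing T] (φ : S →+* T) (x : S) (q : ℤ[X]) :
    φ (intEval x q) = intEval (φ x) q := by
  have : φ.comp (intEval x) = intEval (φ x) := by
    apply Polynomial.ringHom_ext
    · intro n; simp
    · simp
  exact RingHom.congr_fun this q

theorem intEval_eq_eval_map {S : Type*} [CommRing S] (x : S) (q : ℤ[X]) :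
    intEval x q = eval x (q.map (Int.castRingHom S)) := (eval_map _ _).symm

/-- Evaluation of an integer polynomial in several variables in a commutative ring. -/
def mvIntEval {S σ : Type*} [CommRing S] (x : σ → S) : MvPolynomial σ ℤ →+* S :=
  MvPolynomial.eval₂Hom (Int.castRingHom S) x

@[simp] theorem mvIntEval_X {S σ : Type*} [CommRing S] (x : σ → S) (i : σ) :
    mvIntEval x (MvPolynomial.X i) = x i := MvPolynomial.eval₂Hom_X' _ _ _

@[simp] theorem mvIntEval_C {S σ : Type*} [CommRing S] (x : σ → S) (n : ℤ) :
    mvIntEval x (MvPolynomial.C n) = n := MvPolynomial.eval₂Hom_C _ _ _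

/-- Two rational functions with a common denominator satisfy a nontrivial polynomial relation. -/
theorem exists_relation (A B D : ℤ[X]) :
    ∃ f : ℤ[X][X], f ≠ 0 ∧ ∀ (S : Type) [CommRing S] (Y P Q : S), IsUnit (intEval Y B) →
      P * intEval Y B = intEval Y A → Q * intEval Y B = intEval Y D →
      eval₂ (intEval P) Q f = 0 := by
  classical
  set d := max A.natDegree (max B.natDegree D.natDegree) with hd
  have hA : A.natDegree ≤ d := le_max_left _ _
  have hB : B.natDegree ≤ d := (le_max_left _ _).trans (le_max_right _ _)
  have hD : D.natDegree ≤ d := (le_max_right _ _).trans (le_max_right _ _)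
  set n := 2 * d + 1 with hn
  let m : Fin (n + 1) × Fin (n + 1) → ℤ[X] := fun k =>
    A ^ (k.1 : ℕ) * D ^ (k.2 : ℕ) * B ^ (2 * n - k.1 - k.2)
  have hm : ∀ k, (m k).natDegree < 2 * n * d + 1 := by
    intro k
    have h1 : (m k).natDegree ≤ k.1 * d + k.2 * d + (2 * n - k.1 - k.2) * d :=
      natDegree_mul_le_of_le (natDegree_mul_le_of_le (natDegree_pow_le_of_le _ hA)
        (natDegree_pow_le_of_le _ hD)) (natDegree_pow_le_of_le _ hB)
    have h2 : (k.1 : ℕ) * d + k.2 * d + (2 * n - k.1 - k.2) * d = 2 * n * d := by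
      rw [← add_mul, ← add_mul]
      congr 1
      have := k.1.2; have := k.2.2
      omega
    omega
  obtain ⟨c, hc0, hc⟩ := exists_ne_zero_sum_smul_eq_zero (F := ℚ) (2 * n * d + 1)
    (fun k => (m k).map (Int.castRingHom ℚ)) (fun k => lt_of_le_of_lt natDegree_map_le (hm k)) (by
      rw [Fintype.card_prod, Fintype.card_fin]; nlinarith)
  -- clear denominators
  obtain ⟨N, hN⟩ := IsLocalization.exist_integer_multiples_of_finset (nonZeroDivisors ℤ)
    (Finset.univ.image c)
  have hN' : ∀ k, ∃ z : ℤ, (z : ℚ) = (N : ℤ) * c k := by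
    intro k
    obtain ⟨z, hz⟩ := hN (c k) (Finset.mem_image_of_mem _ (Finset.mem_univ _))
    exact ⟨z, by simpa using hz⟩
  choose z hz using hN'
  have hN0 : ((N : ℤ) : ℚ) ≠ 0 := by exact_mod_cast nonZeroDivisors.coe_ne_zero N
  have hzsum : ∑ k, C (z k) * m k = 0 := by
    apply Polynomial.map_injective (Int.castRingHom ℚ) Int.cast_injective
    rw [Polynomial.map_sum, Polynomial.map_zero]
    have := congrArg (fun q => C ((N : ℤ) : ℚ) * q) hc
    simp only [mul_zero, Finset.mul_sum] at this
    rw [← this]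
    refine Finset.sum_congr rfl fun k _ => ?_
    rw [Polynomial.map_mul, map_C, smul_eq_C_mul, ← mul_assoc, ← C_mul]
    simp [hz]
  refine ⟨∑ k : Fin (n + 1) × Fin (n + 1), C (C (z k) * X ^ (k.1 : ℕ)) * X ^ (k.2 : ℕ), ?_, ?_⟩
  · intro h0
    apply hc0
    ext k
    have h1 : z k = 0 := by
      have := congrArg (fun q => coeff (coeff q k.2) k.1) h0
      simp only [finsetSum_coeff, coeff_C_mul, coeff_X_pow, coeff_zero, mul_ite, mul_one,
        mul_zero, apply_ite (fun q : ℤ[X] => coeff q (k.1 : ℕ))] at this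
      rw [Finset.sum_eq_single k] at this
      · simpa using this
      · intro j _ hj
        by_cases h2 : (k.2 : ℕ) = j.2
        · rw [if_pos h2, if_neg]
          intro h3
          exact hj (Prod.ext (Fin.ext h3.symm) (Fin.ext h2.symm))
        · rw [if_neg h2]
      · simp
    have := hz k
    rw [h1, Int.cast_zero] at this
    simpa using (mul_eq_zero.1 this.symm).resolve_left hN0
  · intro S _ Y P Q hunit hP hQ
    rw [eval₂_finsetSum]
    have h1 := congrArg (intEval Y) hzsum
    simp only [map_sum, map_zero] at h1
    refine (hunit.pow (2 * n)).mul_left_eq_zero.1 ?_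
    rw [← h1, Finset.sum_mul]
    refine Finset.sum_congr rfl fun k _ => ?_
    have h2 : 2 * n = k.1 + k.2 + (2 * n - k.1 - k.2) := by
      have := k.1.2; have := k.2.2
      omega
    conv_lhs => rw [h2]
    simp only [m, map_mul, map_pow, ← hP, ← hQ, eval₂_mul, eval₂_C, eval₂_pow, eval₂_X,
      intEval_X, intEval_C, mul_pow, pow_add]
    ring

/-- After multiplying by a suitable polynomial in `A / B`, the rational function `D / B` becomes
integral over the polynomials in `A / B`. -/
theorem exists_integral_relation (A B D : ℤ[X]) :
    ∃ (l : ℤ[X]) (f : ℤ[X][X]), l ≠ 0 ∧ f.Monic ∧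
      ∀ (S : Type) [CommRing S] (Y P Q : S), IsUnit (intEval Y B) →
      P * intEval Y B = intEval Y A → Q * intEval Y B = intEval Y D →
      eval₂ (intEval P) (intEval P l * Q) f = 0 := by
  obtain ⟨f, hf0, hf⟩ := exists_relation A B D
  have hXf : (X * f) ≠ 0 := mul_ne_zero X_ne_zero hf0
  refine ⟨(X * f).leadingCoeff, integralNormalization (X * f), leadingCoeff_ne_zero.2 hXf,
    monic_integralNormalization hXf, ?_⟩
  intro S _ Y P Q h1 h2 h3
  have := integralNormalization_eval₂_leadingCoeff_mul (p := X * f) (by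
    rw [natDegree_X_mul hf0]; omega) (intEval P) Q
  rw [eval₂_mul, hf S Y P Q h1 h2 h3, mul_zero, mul_zero] at this
  exact this

/-- Universal monic equation for a linear combination of integral elements. -/
theorem exists_universal_monic {R ι : Type} [CommRing R] [Fintype ι] (g : ι → R[X])
    (hg : ∀ i, (g i).Monic) (a : ι → R) :
    ∃ Ψ : R[X], Ψ.Monic ∧ ∀ (S : Type) [CommRing S] (φ : R →+* S) (x : ι → S),
      (∀ i, eval₂ φ (x i) (g i) = 0) → eval₂ φ (∑ i, φ (a i) * x i) Ψ = 0 := by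
  let V := MvPolynomial ι R
  let rel : ι → V := fun i => aeval (MvPolynomial.X i : V) (g i)
  let I : Ideal (MvPolynomial ι R) := Ideal.span (Set.range rel)
  let ξ : ι → MvPolynomial ι R ⧸ I := fun i => Ideal.Quotient.mkₐ R I (MvPolynomial.X i)
  have hξ : ∀ i, (algebraMap R (MvPolynomial ι R ⧸ I)).IsIntegralElem (ξ i) := by
    intro i
    refine ⟨g i, hg i, ?_⟩
    change aeval (ξ i) (g i) = 0
    simp only [ξ]
    rw [aeval_algHom_apply]
    exact Ideal.Quotient.eq_zero_iff_mem.2 (Ideal.subset_span ⟨i, rfl⟩)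
  have hζ : (algebraMap R (MvPolynomial ι R ⧸ I)).IsIntegralElem
      (∑ i, algebraMap R (MvPolynomial ι R ⧸ I) (a i) * ξ i) := by
    classical
    refine Finset.sum_induction _ (algebraMap R (MvPolynomial ι R ⧸ I)).IsIntegralElem
      (fun _ _ => RingHom.IsIntegralElem.add _) (RingHom.isIntegralElem_zero _) fun i _ => ?_
    exact RingHom.IsIntegralElem.mul _ (RingHom.isIntegralElem_map _) (hξ i)
  obtain ⟨Ψ, hΨm, hΨ⟩ := hζ
  refine ⟨Ψ, hΨm, ?_⟩
  intro S _ φ x hx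
  let χ : V →+* S := MvPolynomial.eval₂Hom φ x
  have hχC : χ.comp (algebraMap R V) = φ := by
    ext a
    exact MvPolynomial.eval₂Hom_C φ x a
  have hχX : ∀ i, χ (MvPolynomial.X i) = x i := fun i => MvPolynomial.eval₂Hom_X' φ x i
  have hχ : ∀ a ∈ I, χ a = 0 := by
    have : I ≤ RingHom.ker χ := by
      rw [Ideal.span_le]
      rintro _ ⟨i, rfl⟩
      change χ (aeval (MvPolynomial.X i : V) (g i)) = 0
      rw [aeval_def, hom_eval₂, hχC, hχX, hx]
    exact fun a ha => this ha
  let χ' : MvPolynomial ι R ⧸ I →+* S := Ideal.Quotient.lift _ χ hχ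
  have hχ'π : ∀ a, χ' (Ideal.Quotient.mkₐ R I a) = χ a := fun a => Ideal.Quotient.lift_mk _ _ _
  have hχ'R : χ'.comp (algebraMap R _) = φ := by
    rw [← hχC]
    rfl
  have h1 := congrArg χ' hΨ
  rw [hom_eval₂, hχ'R, map_zero, map_sum] at h1
  rw [← h1]
  congr 1
  refine Finset.sum_congr rfl fun i _ => ?_
  rw [map_mul, ← RingHom.comp_apply, hχ'R, hχ'π, hχX]

/-- Universal integral equation for a signed sum of integral elements. -/
theorem exists_universal_equation (l : ℤ[X]) (f : ℤ[X][X]) (hf : f.Monic) (ε : Fin 4 → ℤ) :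
    ∃ Ψ : (MvPolynomial (Fin 4) ℤ)[X], Ψ.Monic ∧ ∀ (S : Type) [CommRing S] (T x : Fin 4 → S),
      (∀ i, eval₂ (intEval (T i)) (x i) f = 0) →
      eval₂ (mvIntEval T)
        (∑ i, (ε i : S) * (∏ j ∈ Finset.univ.erase i, intEval (T j) l) * x i) Ψ = 0 := by
  let tR : Fin 4 → (ℤ[X] →+* MvPolynomial (Fin 4) ℤ) := fun i =>
    intEval (MvPolynomial.X i : MvPolynomial (Fin 4) ℤ)
  obtain ⟨Ψ, hΨm, hΨ⟩ := exists_universal_monic (fun i => f.map (tR i)) (fun i => hf.map _)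
    (fun i => (ε i : MvPolynomial (Fin 4) ℤ) * ∏ j ∈ Finset.univ.erase i, tR j l)
  refine ⟨Ψ, hΨm, ?_⟩
  intro S _ T x hx
  have hφt : ∀ i, (mvIntEval T).comp (tR i) =
      (intEval (T i)) := by
    intro i
    apply Polynomial.ringHom_ext
    · intro n; simp [tR]
    · simp [tR]
  have h := hΨ S (mvIntEval T) x (by
    intro i
    rw [eval₂_map, hφt, hx])
  rw [← h]
  congr 1
  refine Finset.sum_congr rfl fun i _ => ?_
  rw [map_mul, map_intCast, map_prod]
  congr 2
  exact Finset.prod_congr rfl fun j _ => (RingHom.congr_fun (hφt j) l).symm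

end Elimination

section Shift

/-- The numerator of the derivative of `A / B`. -/
def wron {R : Type*} [CommRing R] (A B : R[X]) : R[X] := derivative A * B - A * derivative B

/-- Local inverse of `A / B` near a noncritical point, and the derivative of `D / B` along it. -/
theorem exists_local_section {F : Type} [Field F] (A B D : ℤ[X]) (y T : F)
    (hB : intEval y B ≠ 0) (hA : intEval y A = T * intEval y B) (hW : intEval y (wron A B) ≠ 0) :
    ∃ Y Q : PowerSeries F, IsUnit (intEval Y B) ∧
      (PowerSeries.C T + PowerSeries.X) * intEval Y B = intEval Y A ∧
      Q * intEval Y B = intEval Y D ∧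
      PowerSeries.constantCoeff Q = intEval y D / intEval y B ∧
      PowerSeries.constantCoeff (PowerSeries.derivative F Q) =
        intEval y (wron D B) / intEval y (wron A B) := by
  set P : PowerSeries F := PowerSeries.C T + PowerSeries.X with hP
  have hP0 : PowerSeries.constantCoeff P = T := by simp [hP]
  let f : (PowerSeries F)[X] := A.map (Int.castRingHom _) - C P * B.map (Int.castRingHom _)
  have ev : ∀ (z : PowerSeries F) (q : ℤ[X]), eval z (q.map (Int.castRingHom _)) = intEval z q :=
    fun z q => (intEval_eq_eval_map z q).symm
  have hf : ∀ z, eval z f = intEval z A - P * intEval z B := by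
    intro z; simp only [f, eval_sub, eval_mul, eval_C, ev]
  have hf' : ∀ z, eval z (derivative f) = intEval z (derivative A) - P * intEval z (derivative B) := by
    intro z
    simp only [f, derivative_sub, derivative_C_mul, derivative_map, eval_sub, eval_mul, eval_C, ev]
  obtain ⟨Y, hY, hY0⟩ := PowerSeries_exists_isRoot f (PowerSeries.C y) (by
      rw [hf, map_sub, map_mul, hP0, map_intEval, map_intEval, PowerSeries.constantCoeff_C, hA,
        sub_self]) (by
      rw [hf', map_sub, map_mul, hP0, map_intEval, map_intEval, PowerSeries.constantCoeff_C]
      intro h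
      apply hW
      rw [wron, map_sub, map_mul, map_mul, hA]
      linear_combination intEval y B * h)
  rw [PowerSeries.constantCoeff_C] at hY0
  rw [hf, sub_eq_zero] at hY
  have hc : ∀ q : ℤ[X], PowerSeries.constantCoeff (intEval Y q) = intEval y q := by
    intro q; rw [map_intEval, hY0]
  have hunit : IsUnit (intEval Y B) := by
    rw [PowerSeries.isUnit_iff_constantCoeff, hc]
    exact hB.isUnit
  obtain ⟨u, hu⟩ := hunit
  have hQ : (intEval Y D * (↑u⁻¹ : PowerSeries F)) * intEval Y B = intEval Y D := by
    rw [← hu, mul_assoc, Units.inv_mul, mul_one]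
  set Q := intEval Y D * (↑u⁻¹ : PowerSeries F)
  clear_value Q
  refine ⟨Y, Q, ⟨u, hu⟩, hY.symm, hQ, ?_, ?_⟩
  · rw [eq_div_iff hB, ← hc, ← hc, ← map_mul, hQ]
  · let δ := PowerSeries.derivative F
    have hδP : δ P = 1 := by
      change PowerSeries.derivative F P = 1
      rw [hP, map_add, PowerSeries.derivative_C, PowerSeries.derivative_X, zero_add]
    have hδ : ∀ q : ℤ[X], δ (intEval Y q) = intEval Y (derivative q) * δ Y := by
      intro q
      have h : ∀ q : ℤ[X], intEval Y q = aeval Y (q.map (Int.castRingHom F)) := by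
        intro q
        rw [intEval_eq_eval_map, aeval_def, eval₂_map, eval_map]
        congr 1
        exact Subsingleton.elim _ _
      rw [h, h, Derivation.map_aeval, smul_eq_mul, derivative_map]
    have h1 := congrArg δ hY
    rw [Derivation.leibniz, hδ, hδ, hδP] at h1
    have h2 := congrArg δ hQ
    rw [Derivation.leibniz, hδ, hδ] at h2
    simp only [smul_eq_mul, mul_one] at h1 h2
    change PowerSeries.constantCoeff (δ Q) = _
    rw [eq_div_iff hW, ← hc, ← hc, ← map_mul]
    congr 1
    have hB0 : intEval Y B ≠ 0 := by rw [← hu]; exact u.ne_zero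
    have hw1 : intEval Y (wron A B) * δ Y = intEval Y B ^ 2 := by
      simp only [wron, map_sub, map_mul]
      rw [hY]
      linear_combination intEval Y B * h1
    have hw2 : δ Q * intEval Y B ^ 2 = intEval Y (wron D B) * δ Y := by
      simp only [wron, map_sub, map_mul]
      rw [← hQ]
      linear_combination intEval Y B * h2
    have hY'0 : δ Y ≠ 0 := by
      intro h
      rw [h, mul_zero] at hw1
      exact pow_ne_zero 2 hB0 hw1.symm
    refine mul_right_cancel₀ hY'0 ?_
    rw [mul_assoc, hw1, hw2]

/-- Given `c`, the shifts `h` such that `c + h` consists of noncritical values of `A / B` attained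
at a nondegenerate solution of a signed four-term equation in `D / B` are roots of a fixed nonzero
polynomial of bounded degree. -/
theorem exists_shift_polynomial (A B D : ℤ[X]) (ε : Fin 4 → ℤ) :
    ∃ (l : ℤ[X]) (Δ : ℕ), l ≠ 0 ∧ ∀ (F : Type) [Field F] (c : Fin 4 → F),
      ∃ g : F[X], g ≠ 0 ∧ g.natDegree ≤ Δ ∧ ∀ (h : F) (y : Fin 4 → F),
        (∀ i, intEval (y i) B ≠ 0) → (∀ i, intEval (y i) A = (c i + h) * intEval (y i) B) →
        (∑ i, (ε i : F) * (intEval (y i) D / intEval (y i) B) = 0) →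
        (∀ i, intEval (y i) (wron A B) ≠ 0) → (∀ i, intEval (c i + h) l ≠ 0) →
        (∑ i, (ε i : F) * (intEval (y i) (wron D B) / intEval (y i) (wron A B)) ≠ 0) →
        eval h g = 0 := by
  obtain ⟨l, f, hl, hf, hrel⟩ := exists_integral_relation A B D
  obtain ⟨Ψ, hΨm, hΨ⟩ := exists_universal_equation l f hf ε
  refine ⟨l, (Finset.range (Ψ.natDegree + 1)).sup fun n => (Ψ.coeff n).totalDegree, hl, ?_⟩
  intro F _ c
  let θ : MvPolynomial (Fin 4) ℤ →+* F[X] :=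
    mvIntEval (fun i => C (c i) + X)
  have hm : (Ψ.map θ).Monic := hΨm.map _
  set k := (Ψ.map θ).natTrailingDegree with hk
  refine ⟨(Ψ.map θ).coeff k, ?_, ?_, ?_⟩
  · exact trailingCoeff_nonzero_iff_nonzero.2 hm.ne_zero
  · rw [coeff_map]
    have hk2 : k ∈ Finset.range (Ψ.natDegree + 1) := by
      have h1 := natTrailingDegree_le_natDegree (Ψ.map θ)
      rw [hΨm.natDegree_map] at h1
      rw [Finset.mem_range]; omega
    refine le_trans ?_ (Finset.le_sup (f := fun n => (Ψ.coeff n).totalDegree) hk2)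
    have h1 : θ (Ψ.coeff k) = MvPolynomial.aeval (fun i => C (c i) + X)
        ((Ψ.coeff k).map (Int.castRingHom F)) := by
      rw [MvPolynomial.aeval_def, MvPolynomial.eval₂_map]
      simp only [θ, mvIntEval, MvPolynomial.coe_eval₂Hom]
      congr 1
    have h2 := MvPolynomial.aeval_natDegree_le (n := 1)
      ((Ψ.coeff k).map (Int.castRingHom F)) (Finset.sup_mono (MvPolynomial.support_map_subset _ _))
      (fun i => C (c i) + X) (fun i => by compute_degree)
    rwa [mul_one, ← h1] at h2
  · intro h y hB hA hQ0 hW hl0 hR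
    choose Y Q hu hP hQ hQc hQd using fun i =>
      exists_local_section A B D (y i) (c i + h) (hB i) (hA i) (hW i)
    let T : Fin 4 → PowerSeries F := fun i => PowerSeries.C (c i + h) + PowerSeries.X
    have h1 := hΨ (PowerSeries F) T (fun i => intEval (T i) l * Q i)
      (fun i => hrel _ (Y i) (T i) (Q i) (hu i) (hP i) (hQ i))
    set s : PowerSeries F := ∑ i, (ε i : PowerSeries F) * Q i with hs
    have hz : (∑ i, (ε i : PowerSeries F) * (∏ j ∈ Finset.univ.erase i, intEval (T j) l) *
        (intEval (T i) l * Q i)) = (∏ j, intEval (T j) l) * s := by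
      rw [hs, Finset.mul_sum]
      refine Finset.sum_congr rfl fun i _ => ?_
      rw [← Finset.mul_prod_erase Finset.univ _ (Finset.mem_univ i)]
      ring
    rw [hz] at h1
    have hs0 : PowerSeries.constantCoeff s = 0 := by
      rw [hs, map_sum, ← hQ0]
      exact Finset.sum_congr rfl fun i _ => by rw [map_mul, map_intCast, hQc]
    have hsne : s ≠ 0 := by
      intro h0
      apply hR
      have h2 : PowerSeries.constantCoeff (PowerSeries.derivative F s) = 0 := by
        rw [h0, map_zero, map_zero]
      rw [← h2, hs, map_sum, map_sum]
      refine Finset.sum_congr rfl fun i _ => ?_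
      have h3 : (ε i : PowerSeries F) * Q i = (ε i) • Q i := (zsmul_eq_mul _ _).symm
      rw [h3, map_zsmul, map_zsmul, hQd, zsmul_eq_mul]
    have hl1 : (∏ j, intEval (T j) l) ≠ 0 := by
      rw [Finset.prod_ne_zero_iff]
      intro j _ h0
      apply hl0 j
      have := congrArg PowerSeries.constantCoeff h0
      rw [map_intEval, map_zero] at this
      simpa [T] using this
    set z := (∏ j, intEval (T j) l) * s with hzdef
    have hzne : z ≠ 0 := mul_ne_zero hl1 hsne
    have hz0 : PowerSeries.constantCoeff z = 0 := by rw [hzdef, map_mul, hs0, mul_zero]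
    clear_value z
    let Φ : F[X] →+* PowerSeries F := eval₂RingHom PowerSeries.C (PowerSeries.C h + PowerSeries.X)
    have hΦ : Φ.comp θ =
        mvIntEval T := by
      apply MvPolynomial.ringHom_ext
      · intro n; simp
      · intro i; simp [Φ, θ, T, add_assoc]
    rw [← hΦ, ← eval₂_map] at h1
    obtain ⟨q, hq⟩ := X_pow_dvd_iff.2 fun d (hd : d < (Ψ.map θ).natTrailingDegree) =>
      coeff_eq_zero_of_lt_natTrailingDegree hd
    rw [← hk] at hq
    have hqk : (Ψ.map θ).coeff k = q.coeff 0 := by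
      have := coeff_X_pow_mul q k 0
      rw [zero_add] at this
      rw [← this, ← hq]
    rw [hq, eval₂_mul, eval₂_pow, eval₂_X] at h1
    have h2 := (mul_eq_zero.1 h1).resolve_left (pow_ne_zero _ hzne)
    have h3 := congrArg PowerSeries.constantCoeff h2
    rw [hom_eval₂, hz0, map_zero, eval₂_at_zero, ← hqk] at h3
    have h4 : evalRingHom h = (PowerSeries.constantCoeff).comp Φ := by
      apply Polynomial.ringHom_ext
      · intro a; simp [Φ]
      · simp [Φ]
    rw [← h3, ← h4]
    rfl

end Shift

section Reduction

/-- Reduction modulo large primes preserves linear independence of integer polynomials. -/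
theorem exists_forall_prime_linearIndependent {ι : Type*} [Fintype ι] (v : ι → ℤ[X])
    (hv : ∀ c : ι → ℚ, ∑ i, C (c i) * (v i).map (Int.castRingHom ℚ) = 0 → c = 0) :
    ∃ p₀ : ℕ, ∀ (p : ℕ) [Fact p.Prime], p₀ < p → ∀ c : ι → ZMod p,
      ∑ i, C (c i) * (v i).map (Int.castRingHom (ZMod p)) = 0 → c = 0 := by
  classical
  let L : (ι → ℚ) →ₗ[ℚ] ℚ[X] := Fintype.linearCombination ℚ fun i => (v i).map (Int.castRingHom ℚ)
  have hL : ∀ c, L c = ∑ i, C (c i) * (v i).map (Int.castRingHom ℚ) := by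
    intro c
    simp only [L, Fintype.linearCombination_apply, smul_eq_C_mul]
  have hker : LinearMap.ker L = ⊥ := by
    rw [LinearMap.ker_eq_bot']
    intro c hc
    rw [hL] at hc
    exact hv c hc
  obtain ⟨M, hM⟩ := LinearMap.exists_leftInverse_of_injective L hker
  set n := Finset.univ.sup fun i => (v i).natDegree with hn
  obtain ⟨N, hN⟩ := IsLocalization.exist_integer_multiples_of_finset (nonZeroDivisors ℤ)
    ((Finset.range (n + 1) ×ˢ (Finset.univ : Finset ι)).image fun kj => M (X ^ kj.1) kj.2)
  have hN' : ∀ k j, ∃ z : ℤ, k ∈ Finset.range (n + 1) → (z : ℚ) = (N : ℤ) * M (X ^ k) j := by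
    intro k j
    by_cases hk : k ∈ Finset.range (n + 1)
    · obtain ⟨z, hz⟩ := hN (M (X ^ k) j) (Finset.mem_image.2
        ⟨(k, j), Finset.mem_product.2 ⟨hk, Finset.mem_univ _⟩, rfl⟩)
      exact ⟨z, fun _ => by simpa using hz⟩
    · exact ⟨0, fun h => absurd h hk⟩
  choose z hz using hN'
  have hdeg : ∀ i, (v i).natDegree ≤ n := fun i =>
    Finset.le_sup (f := fun i => (v i).natDegree) (Finset.mem_univ i)
  have key : ∀ i j, ∑ k ∈ Finset.range (n + 1), (v i).coeff k * z k j =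
      (N : ℤ) * if i = j then 1 else 0 := by
    intro i j
    have h1 : M (L (Pi.single i 1)) = Pi.single i 1 := LinearMap.congr_fun hM _
    have h2 : L (Pi.single i 1) = (v i).map (Int.castRingHom ℚ) := by
      simp [L, Fintype.linearCombination_apply_single]
    have h3 : (v i).map (Int.castRingHom ℚ) =
        ∑ k ∈ Finset.range (n + 1), ((v i).coeff k : ℚ) • (X : ℚ[X]) ^ k := by
      rw [as_sum_range' ((v i).map (Int.castRingHom ℚ)) (n + 1)
        (lt_of_le_of_lt natDegree_map_le (Nat.lt_succ_of_le (hdeg i)))]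
      refine Finset.sum_congr rfl fun k _ => ?_
      rw [← C_mul_X_pow_eq_monomial, smul_eq_C_mul, coeff_map]
      rfl
    rw [h2, h3, map_sum] at h1
    have h4 := congrFun h1 j
    rw [Finset.sum_apply] at h4
    have h5 : ((∑ k ∈ Finset.range (n + 1), (v i).coeff k * z k j : ℤ) : ℚ) =
        (((N : ℤ) * if i = j then 1 else 0 : ℤ) : ℚ) := by
      push_cast
      rw [Pi.single_apply] at h4
      simp only [eq_comm (a := j)] at h4
      rw [← h4, Finset.mul_sum]
      refine Finset.sum_congr rfl fun k hk => ?_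
      rw [hz k j hk, map_smul, Pi.smul_apply, smul_eq_mul]
      ring
    exact_mod_cast h5
  refine ⟨(N : ℤ).natAbs, ?_⟩
  intro p _ hp c hc
  ext j
  have hNp : ((N : ℤ) : ZMod p) ≠ 0 := by
    rw [Ne, ZMod.intCast_zmod_eq_zero_iff_dvd]
    intro hd
    have := Int.natAbs_dvd_natAbs.2 hd
    rw [Int.natAbs_natCast] at this
    have h0 : 0 < (N : ℤ).natAbs := Int.natAbs_pos.2 (nonZeroDivisors.coe_ne_zero N)
    exact absurd (Nat.le_of_dvd h0 this) (by omega)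
  have hk : ∀ k, ∑ i, c i * ((v i).coeff k : ZMod p) = 0 := by
    intro k
    have := congrArg (fun q => coeff q k) hc
    simpa [finsetSum_coeff] using this
  have h1 : ∑ k ∈ Finset.range (n + 1), (∑ i, c i * ((v i).coeff k : ZMod p)) * (z k j : ZMod p)
      = ((N : ℤ) : ZMod p) * c j := by
    simp only [Finset.sum_mul]
    rw [Finset.sum_comm]
    have h2 : ∀ i, ∑ k ∈ Finset.range (n + 1), c i * ((v i).coeff k : ZMod p) * (z k j : ZMod p) =
        c i * (((N : ℤ) : ZMod p) * if i = j then 1 else 0) := by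
      intro i
      have := congrArg (Int.cast : ℤ → ZMod p) (key i j)
      push_cast at this
      rw [← this, Finset.mul_sum]
      exact Finset.sum_congr rfl fun k _ => by ring
    rw [Finset.sum_congr rfl fun i _ => h2 i]
    simp [mul_comm]
  simp only [hk, zero_mul, Finset.sum_const_zero] at h1
  exact (mul_eq_zero.1 h1.symm).resolve_left hNp

/-- A nonzero integer polynomial stays nonzero modulo large primes. -/
theorem exists_forall_prime_map_ne_zero (v : ℤ[X]) (hv : v ≠ 0) :
    ∃ p₀ : ℕ, ∀ (p : ℕ) [Fact p.Prime], p₀ < p → v.map (Int.castRingHom (ZMod p)) ≠ 0 := by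
  obtain ⟨p₀, h⟩ := exists_forall_prime_linearIndependent (fun _ : Unit => v) (by
    intro c hc
    rw [Fintype.sum_unique, mul_eq_zero, C_eq_zero] at hc
    ext i
    exact hc.resolve_right ((Polynomial.map_ne_zero_iff (f := Int.castRingHom ℚ)
      Int.cast_injective).2 hv))
  refine ⟨p₀, fun p _ hp h0 => ?_⟩
  have := congrFun (h p hp (fun _ => 1) (by simp [h0])) ()
  simp at this

end Reduction

section Wronskian

variable {K : Type*} [Field K]

theorem exists_coprime_factorization (A B : K[X]) (hB : B ≠ 0) :
    ∃ d A₀ B₀ : K[X], d ≠ 0 ∧ B₀ ≠ 0 ∧ A = d * A₀ ∧ B = d * B₀ ∧ IsCoprime A₀ B₀ := by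
  classical
  have hd : EuclideanDomain.gcd A B ≠ 0 := fun h => hB (EuclideanDomain.gcd_eq_zero_iff.1 h).2
  obtain ⟨A₀, hA₀⟩ := EuclideanDomain.gcd_dvd_left A B
  obtain ⟨B₀, hB₀⟩ := EuclideanDomain.gcd_dvd_right A B
  refine ⟨EuclideanDomain.gcd A B, A₀, B₀, hd, ?_, hA₀, hB₀, ?_⟩
  · rintro rfl
    rw [mul_zero] at hB₀
    exact hB hB₀
  · refine ⟨EuclideanDomain.gcdA A B, EuclideanDomain.gcdB A B, mul_left_cancel₀ hd ?_⟩
    have h := EuclideanDomain.gcd_eq_gcd_ab A B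
    linear_combination -h - hA₀ * EuclideanDomain.gcdA A B - hB₀ * EuclideanDomain.gcdB A B

theorem wron_mul_mul (d A B : K[X]) : wron (d * A) (d * B) = d ^ 2 * wron A B := by
  simp only [wron, derivative_mul]
  ring

variable [CharZero K]

theorem natDegree_eq_zero_of_dvd_derivative {f : K[X]} (h : f ∣ derivative f) : f.natDegree = 0 := by
  by_contra h0
  have h1 : derivative f ≠ 0 := fun h => h0 (derivative_eq_zero.1 h)
  have h2 := natDegree_le_of_dvd h h1
  have h3 := natDegree_derivative_lt h0
  omega

/-- If the Wronskian vanishes, the quotient is constant. -/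
theorem exists_eq_C_mul_of_wron_eq_zero {A B : K[X]} (hB : B ≠ 0) (h : wron A B = 0) :
    ∃ c, A = C c * B := by
  obtain ⟨d, A₀, B₀, hd, hB₀, rfl, rfl, hco⟩ := exists_coprime_factorization A B hB
  rw [wron_mul_mul] at h
  have h1 := (mul_eq_zero.1 h).resolve_left (pow_ne_zero 2 hd)
  rw [wron, sub_eq_zero] at h1
  have h2 : B₀.natDegree = 0 := by
    apply natDegree_eq_zero_of_dvd_derivative
    exact hco.symm.dvd_of_dvd_mul_left ⟨derivative A₀, by rw [← h1, mul_comm]⟩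
  obtain ⟨b, rfl⟩ := natDegree_eq_zero.1 h2
  rw [derivative_C, mul_zero] at h1
  have h3 := derivative_eq_zero.1 ((mul_eq_zero.1 h1).resolve_right hB₀)
  obtain ⟨a, rfl⟩ := natDegree_eq_zero.1 h3
  have hb : b ≠ 0 := by
    rintro rfl
    exact hB₀ C_0
  refine ⟨a / b, ?_⟩
  have : C a = C (a / b) * C b := by rw [← C_mul, div_mul_cancel₀ a hb]
  rw [this]
  ring

/-- A polynomial equation forcing a denominator to be constant. -/
theorem natDegree_eq_zero_of_log_derivative {A B g h : K[X]} {α : K} (hB : B ≠ 0) (hg : g ≠ 0)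
    (hh : h ≠ 0) (hα : α ≠ 0) (hco : IsCoprime A B)
    (H : wron g h * B ^ 2 = C α * g * h * wron A B) : B.natDegree = 0 := by
  by_contra hdeg
  obtain ⟨q, hq, hqB⟩ := exists_irreducible_of_natDegree_ne_zero hdeg
  have hqp := hq.prime
  have hfin : ∀ f : K[X], f ≠ 0 → ∃ n f₁, ¬ q ∣ f₁ ∧ f = q ^ n * f₁ := by
    intro f hf
    obtain ⟨c, hc, hc'⟩ := (FiniteMultiplicity.of_not_isUnit hq.not_isUnit hf).exists_eq_pow_mul_and_not_dvd
    exact ⟨_, c, hc', hc⟩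
  obtain ⟨m, B₁, hB₁, rfl⟩ := hfin B hB
  obtain ⟨a, g₁, hg₁, rfl⟩ := hfin g hg
  obtain ⟨b, h₁, hh₁, rfl⟩ := hfin h hh
  have hm : m ≠ 0 := by
    rintro rfl
    rw [pow_zero, one_mul] at hqB
    exact hB₁ hqB
  have hqA : ¬ q ∣ A := fun hqA => hq.not_isUnit (hco.isUnit_of_dvd' hqA hqB)
  have hq' : ¬ q ∣ derivative q := by
    intro h
    have := natDegree_eq_zero_of_dvd_derivative h
    have h2 := hq.natDegree_pos
    omega
  have hpow : ∀ n : ℕ, q * derivative (q ^ n) = q ^ n * ((n : K[X]) * derivative q) := by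
    intro n
    rcases n with _ | n
    · simp
    · rw [derivative_pow, Nat.add_sub_cancel, pow_succ]
      simp only [map_natCast]
      ring
  have e1 : q * wron A (q ^ m * B₁) = q ^ m * (q * (derivative A * B₁ - A * derivative B₁) -
      (m : K[X]) * A * derivative q * B₁) := by
    simp only [wron, derivative_mul]
    linear_combination -(A * B₁) * hpow m
  have e2 : q * wron (q ^ a * g₁) (q ^ b * h₁) = q ^ (a + b) *
      (((a : K[X]) - b) * derivative q * g₁ * h₁ +
        q * (derivative g₁ * h₁ - g₁ * derivative h₁)) := by
    simp only [wron, derivative_mul, pow_add]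
    linear_combination (g₁ * h₁ * q ^ b) * hpow a - (g₁ * h₁ * q ^ a) * hpow b
  have hq0 := hq.ne_zero
  have e3 : q ^ m * ((((a : K[X]) - b) * derivative q * g₁ * h₁ +
        q * (derivative g₁ * h₁ - g₁ * derivative h₁)) * B₁ ^ 2) = C α * g₁ * h₁ *
      (q * (derivative A * B₁ - A * derivative B₁) - (m : K[X]) * A * derivative q * B₁) := by
    apply mul_left_cancel₀ (pow_ne_zero (a + b + m) hq0)
    have := congrArg (fun x => q * x) H
    simp only [pow_add] at this e2 ⊢
    linear_combination this - (q ^ m * B₁) ^ 2 * e2 + C α * (q ^ a * g₁) * (q ^ b * h₁) * e1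
  have e4 : q ∣ C α * (g₁ * (h₁ * ((m : K[X]) * (A * (derivative q * B₁))))) := by
    obtain ⟨k, rfl⟩ := Nat.exists_eq_succ_of_ne_zero hm
    refine ⟨C α * g₁ * h₁ * (derivative A * B₁ - A * derivative B₁) - q ^ k *
      ((((a : K[X]) - b) * derivative q * g₁ * h₁ +
        q * (derivative g₁ * h₁ - g₁ * derivative h₁)) * B₁ ^ 2), ?_⟩
    rw [pow_succ] at e3
    linear_combination e3
  have hC : ∀ c : K, c ≠ 0 → ¬ q ∣ C c := fun c hc h =>
    hq.not_isUnit (isUnit_of_dvd_unit h (isUnit_C.2 hc.isUnit))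
  have hmC : ¬ q ∣ (m : K[X]) := by
    rw [← C_eq_natCast]
    exact hC _ (Nat.cast_ne_zero.2 hm)
  simp only [hqp.dvd_mul] at e4
  rcases e4 with h | h | h | h | h | h | h
  exacts [hC α hα h, hg₁ h, hh₁ h, hmC h, hqA h, hq' h, hB₁ h]

/-- A logarithmic derivative of a rational function is not a nonzero derivative of a rational
function. -/
theorem wron_eq_zero_of_log_derivative {A B g h : K[X]} {α : K} (hB : B ≠ 0) (hg : g ≠ 0)
    (hh : h ≠ 0) (hα : α ≠ 0) (H : wron g h * B ^ 2 = C α * g * h * wron A B) :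
    wron A B = 0 := by
  obtain ⟨d, A₀, B₀, hd, hB₀, rfl, rfl, hco⟩ := exists_coprime_factorization A B hB
  obtain ⟨e, g₀, h₀, he, hh₀, rfl, rfl, hco'⟩ := exists_coprime_factorization g h hh
  have hg₀ : g₀ ≠ 0 := right_ne_zero_of_mul hg
  rw [wron_mul_mul, wron_mul_mul] at H
  have H' : wron g₀ h₀ * B₀ ^ 2 = C α * g₀ * h₀ * wron A₀ B₀ := by
    apply mul_left_cancel₀ (mul_ne_zero (pow_ne_zero 2 he) (pow_ne_zero 2 hd))
    linear_combination H
  rw [wron_mul_mul]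
  suffices wron A₀ B₀ = 0 by rw [this, mul_zero]
  have hBdeg := natDegree_eq_zero_of_log_derivative hB₀ hg₀ hh₀ hα hco H'
  obtain ⟨b, rfl⟩ := natDegree_eq_zero.1 hBdeg
  have hg₂ : g₀ ∣ derivative g₀ := by
    have h1 : g₀ ∣ (C b ^ 2 * h₀) * derivative g₀ := by
      refine ⟨C b ^ 2 * derivative h₀ + C α * h₀ * wron A₀ (C b), ?_⟩
      rw [wron] at H'
      linear_combination H'
    refine IsCoprime.dvd_of_dvd_mul_left ?_ h1
    exact IsCoprime.mul_right (isCoprime_one_right.of_isCoprime_of_dvd_right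
      (((isUnit_iff_ne_zero.2 (C_ne_zero.1 hB₀)).map C).pow 2).dvd) hco'
  have hh₂ : h₀ ∣ derivative h₀ := by
    have h1 : h₀ ∣ (C b ^ 2 * g₀) * derivative h₀ := by
      refine ⟨C b ^ 2 * derivative g₀ - C α * g₀ * wron A₀ (C b), ?_⟩
      rw [wron] at H'
      linear_combination -H'
    refine IsCoprime.dvd_of_dvd_mul_left ?_ h1
    exact IsCoprime.mul_right (isCoprime_one_right.of_isCoprime_of_dvd_right
      (((isUnit_iff_ne_zero.2 (C_ne_zero.1 hB₀)).map C).pow 2).dvd) hco'.symm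
  obtain ⟨u, rfl⟩ := natDegree_eq_zero.1 (natDegree_eq_zero_of_dvd_derivative hg₂)
  obtain ⟨v, rfl⟩ := natDegree_eq_zero.1 (natDegree_eq_zero_of_dvd_derivative hh₂)
  have h0 : wron (C u) (C v) = 0 := by simp [wron]
  rw [h0, zero_mul] at H'
  exact (mul_eq_zero.1 H'.symm).resolve_left
    (mul_ne_zero (mul_ne_zero (C_ne_zero.2 hα) hg₀) hh₀)

/-- If `1`, `A / B` and `D / B` are linearly independent, so are `D / B`, `1` and the derivative
of `D / B` with respect to `A / B`. -/
theorem linearIndependent_derivative {A B D : K[X]} (hB : B ≠ 0)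
    (hind : ∀ a b c : K, C a * A + C b * B + C c * D = 0 → a = 0 ∧ b = 0 ∧ c = 0)
    {α β γ : K} (h : C α * (D * wron A B) + C β * (wron D B * B) + C γ * (B * wron A B) = 0) :
    α = 0 ∧ β = 0 ∧ γ = 0 := by
  have hW : wron A B ≠ 0 := by
    intro h0
    obtain ⟨c, hc⟩ := exists_eq_C_mul_of_wron_eq_zero hB h0
    have := (hind 1 (-c) 0 (by rw [hc]; simp)).1
    exact one_ne_zero this
  by_cases hβ : β = 0
  · subst hβ
    have h1 : wron A B * (C α * D + C γ * B) = 0 := by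
      rw [C_0] at h
      linear_combination h
    have h2 := (mul_eq_zero.1 h1).resolve_left hW
    obtain ⟨_, h3, h4⟩ := hind 0 γ α (by rw [C_0]; linear_combination h2)
    exact ⟨h4, rfl, h3⟩
  · exfalso
    have hβC : C β * C β⁻¹ = 1 := by rw [← C_mul, mul_inv_cancel₀ hβ, C_1]
    by_cases hα : α = 0
    · subst hα
      have h1 : wron (C β * D + C γ * A) B = 0 := by
        have h2 : B * wron (C β * D + C γ * A) B = 0 := by
          rw [← h, C_0]
          simp only [wron, derivative_add, derivative_C_mul]
          ring
        exact (mul_eq_zero.1 h2).resolve_left hB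
      obtain ⟨c, hc⟩ := exists_eq_C_mul_of_wron_eq_zero hB h1
      exact hβ (hind γ (-c) β (by rw [C_neg]; linear_combination hc)).2.2
    · set G := C α * D + C γ * B with hG
      have hG0 : G ≠ 0 := fun h0 => hα (hind 0 γ α (by rw [C_0]; linear_combination h0)).2.2
      have hwG : wron G B = C α * wron D B := by
        simp only [hG, wron, derivative_add, derivative_C_mul]
        ring
      refine hW (wron_eq_zero_of_log_derivative (α := -α * β⁻¹) hB hG0 hB ?_ ?_)
      · exact mul_ne_zero (neg_ne_zero.2 hα) (inv_ne_zero hβ)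
      · rw [hwG, C_mul, C_neg]
        have h1 : G * wron A B + C β * wron D B * B = 0 := by rw [← h, hG]; ring
        linear_combination C α * C β⁻¹ * B * h1 - C α * wron D B * B ^ 2 * hβC

end Wronskian

section Moments

theorem AddChar_map_sum {A M ι : Type*} [AddCommMonoid A] [CommMonoid M] (ψ : AddChar A M)
    (s : Finset ι) (f : ι → A) : ψ (∑ i ∈ s, f i) = ∏ i ∈ s, ψ (f i) := by
  classical
  induction s using Finset.induction_on with
  | empty => simp
  | insert a s ha ih => rw [Finset.sum_insert ha, Finset.prod_insert ha, AddChar.map_add_eq_mul, ih]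

/-- The signs in the fourth moment of an exponential sum. -/
def sgn : Fin 4 → ℤ := ![1, -1, -1, 1]

theorem sgn_mul_self (i : Fin 4) : sgn i * sgn i = 1 := by
  fin_cases i <;> rfl

theorem norm_pow_four_eq_prod {p : ℕ} [Fact p.Prime] {τ : Type*} (W : Finset τ) (f : τ → ZMod p) :
    ((‖∑ w ∈ W, (ZMod.stdAddChar (f w) : ℂ)‖ ^ 4 : ℝ) : ℂ) =
      ∏ i : Fin 4, ∑ w ∈ W, (ZMod.stdAddChar ((sgn i : ZMod p) * f w) : ℂ) := by
  have h1 : (∑ w ∈ W, (ZMod.stdAddChar (-f w) : ℂ)) =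
      (starRingEnd ℂ) (∑ w ∈ W, (ZMod.stdAddChar (f w) : ℂ)) := by
    rw [map_sum]
    exact Finset.sum_congr rfl fun w _ => AddChar.map_neg_eq_conj _ _
  simp only [Fin.prod_univ_four, sgn, Matrix.cons_val, Int.cast_one, Int.cast_neg, one_mul,
    neg_one_mul, h1]
  set S := ∑ w ∈ W, (ZMod.stdAddChar (f w) : ℂ)
  have h2 := Complex.mul_conj' S
  push_cast
  linear_combination (-(S * (starRingEnd ℂ) S) - (‖S‖ : ℂ) ^ 2) * h2

/-- The fourth moment of a two-parameter family of exponential sums counts solutions. -/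
theorem sum_norm_pow_four {p : ℕ} [Fact p.Prime] {τ : Type*} (W : Finset τ) (f g : τ → ZMod p) :
    ∑ m : ZMod p, ∑ n : ZMod p, ‖∑ w ∈ W, (ZMod.stdAddChar (m * f w + n * g w) : ℂ)‖ ^ 4 =
      (p : ℝ) ^ 2 * ((Fintype.piFinset fun _ : Fin 4 => W).filter fun w =>
        ∑ i, (sgn i : ZMod p) * f (w i) = 0 ∧ ∑ i, (sgn i : ZMod p) * g (w i) = 0).card := by
  apply Complex.ofReal_injective
  rw [Complex.ofReal_sum]
  simp only [Complex.ofReal_sum, norm_pow_four_eq_prod, Finset.prod_univ_sum]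
  have h1 : ∀ (m n : ZMod p) (w : Fin 4 → τ),
      ∏ i, (ZMod.stdAddChar ((sgn i : ZMod p) * (m * f (w i) + n * g (w i))) : ℂ) =
        (ZMod.stdAddChar (m * ∑ i, (sgn i : ZMod p) * f (w i)) : ℂ) *
        (ZMod.stdAddChar (n * ∑ i, (sgn i : ZMod p) * g (w i)) : ℂ) := by
    intro m n w
    rw [← AddChar.map_add_eq_mul, ← AddChar_map_sum, Finset.mul_sum, Finset.mul_sum,
      ← Finset.sum_add_distrib]
    congr 1
    exact Finset.sum_congr rfl fun i _ => by ring
  simp only [h1]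
  have h2 : ∀ b : ZMod p, ∑ x : ZMod p, (ZMod.stdAddChar (x * b) : ℂ) =
      if b = 0 then (p : ℂ) else 0 := by
    intro b
    rw [AddChar.sum_mulShift b (ZMod.isPrimitive_stdAddChar p), ZMod.card]
    split_ifs <;> simp
  have h3 : ∀ m : ZMod p, ∑ n : ZMod p, ∑ w ∈ Fintype.piFinset fun _ : Fin 4 => W,
      (ZMod.stdAddChar (m * ∑ i, (sgn i : ZMod p) * f (w i)) : ℂ) *
        (ZMod.stdAddChar (n * ∑ i, (sgn i : ZMod p) * g (w i)) : ℂ) =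
      ∑ w ∈ Fintype.piFinset fun _ : Fin 4 => W,
      (ZMod.stdAddChar (m * ∑ i, (sgn i : ZMod p) * f (w i)) : ℂ) *
        if ∑ i, (sgn i : ZMod p) * g (w i) = 0 then (p : ℂ) else 0 := by
    intro m
    rw [Finset.sum_comm]
    exact Finset.sum_congr rfl fun w _ => by rw [← Finset.mul_sum, h2]
  rw [Finset.sum_congr rfl fun m _ => h3 m, Finset.sum_comm]
  simp only [← Finset.sum_mul, h2]
  rw [Finset.card_filter]
  push_cast
  rw [Finset.mul_sum]
  refine Finset.sum_congr rfl fun w _ => ?_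
  by_cases ha : ∑ i, (sgn i : ZMod p) * f (w i) = 0 <;>
    by_cases hb : ∑ i, (sgn i : ZMod p) * g (w i) = 0 <;> simp [ha, hb, sq]

end Moments

section Counting

/-- A set of quadruples in which one coordinate takes boundedly many values given the others. -/
theorem card_le_of_fiber {F : Type*} [DecidableEq F] (H : Finset (Fin 4 → F)) (j : Fin 4) (z : F)
    (s : Fin 4 → Finset F) (hs : ∀ y ∈ H, ∀ k, k ≠ j → y k ∈ s k) (d : ℕ)
    (hd : ∀ y ∈ H, ∃ t : Finset F, t.card ≤ d ∧
      ∀ y' ∈ H, (∀ k, k ≠ j → y' k = y k) → y' j ∈ t) :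
    H.card ≤ d * ∏ k ∈ Finset.univ.erase j, (s k).card := by
  classical
  have hT : (Fintype.piFinset (Function.update s j {z})).card =
      ∏ k ∈ Finset.univ.erase j, (s k).card := by
    rw [Fintype.card_piFinset, ← Finset.mul_prod_erase Finset.univ _ (Finset.mem_univ j)]
    rw [Function.update_self, Finset.card_singleton, one_mul]
    refine Finset.prod_congr rfl fun k hk => ?_
    rw [Function.update_of_ne (Finset.ne_of_mem_erase hk)]
  rw [← hT]
  refine Finset.card_le_mul_card_image_of_maps_to (f := fun y => Function.update y j z) ?_ d ?_
  · intro y hy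
    rw [Fintype.mem_piFinset]
    intro k
    by_cases hk : k = j
    · subst hk; simp
    · rw [Function.update_of_ne hk, Function.update_of_ne hk]
      exact hs y hy k hk
  · intro b _
    rcases (H.filter fun y => Function.update y j z = b).eq_empty_or_nonempty with h | ⟨y, hy⟩
    · rw [h]; simp
    · rw [Finset.mem_filter] at hy
      obtain ⟨t, ht, ht'⟩ := hd y hy.1
      have hagree : ∀ y', Function.update y' j z = b → ∀ k, k ≠ j → y' k = y k := by
        intro y' hy' k hk
        have := congrFun (hy'.trans hy.2.symm) k
        rwa [Function.update_of_ne hk, Function.update_of_ne hk] at this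
      refine le_trans (Finset.card_le_card_of_injOn (fun y' => y' j) ?_ ?_) ht
      · intro y' hy'
        rw [Finset.mem_coe, Finset.mem_filter] at hy'
        exact ht' y' hy'.1 (hagree y' hy'.2)
      · intro y₁ h₁ y₂ h₂ h12
        rw [Finset.mem_coe, Finset.mem_filter] at h₁ h₂
        ext k
        by_cases hk : k = j
        · subst hk; exact h12
        · rw [hagree y₁ h₁.2 k hk, hagree y₂ h₂.2 k hk]

variable {p : ℕ} [Fact p.Prime]

/-- Quadruples in `Y` with vanishing signed sum of `Q`. -/
def signedSolutions (Y : Finset (ZMod p)) (Q : ZMod p → ZMod p) : Finset (Fin 4 → ZMod p) :=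
  (Fintype.piFinset fun _ => Y).filter fun y => ∑ i, (sgn i : ZMod p) * Q (y i) = 0

theorem mem_signedSolutions {Y : Finset (ZMod p)} {Q : ZMod p → ZMod p} {y : Fin 4 → ZMod p} :
    y ∈ signedSolutions Y Q ↔ (∀ i, y i ∈ Y) ∧ ∑ i, (sgn i : ZMod p) * Q (y i) = 0 := by
  rw [signedSolutions, Finset.mem_filter, Fintype.mem_piFinset]

theorem card_signedSolutions_filter_le (Y : Finset (ZMod p)) (Q : ZMod p → ZMod p) (d : ℕ)
    (hQ : ∀ c, (Y.filter fun y => Q y = c).card ≤ d) (j : Fin 4) (s : Fin 4 → Finset (ZMod p))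
    (r : (Fin 4 → ZMod p) → Prop) [DecidablePred r]
    (hs : ∀ y, (∀ i, y i ∈ Y) → r y → ∀ k, k ≠ j → y k ∈ s k) :
    ((signedSolutions Y Q).filter r).card ≤ d * ∏ k ∈ Finset.univ.erase j, (s k).card := by
  refine card_le_of_fiber _ j 0 s (fun y hy => ?_) d (fun y hy => ?_)
  · rw [Finset.mem_filter, mem_signedSolutions] at hy
    exact hs y hy.1.1 hy.2
  · refine ⟨_, hQ (Q (y j)), fun y' hy' hk => ?_⟩
    rw [Finset.mem_filter, mem_signedSolutions] at hy hy'
    rw [Finset.mem_filter]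
    refine ⟨hy'.1.1 j, ?_⟩
    have h1 := hy.1.2
    have h2 := hy'.1.2
    rw [← Finset.add_sum_erase _ _ (Finset.mem_univ j)] at h1 h2
    have h3 : ∑ i ∈ Finset.univ.erase j, (sgn i : ZMod p) * Q (y' i) =
        ∑ i ∈ Finset.univ.erase j, (sgn i : ZMod p) * Q (y i) :=
      Finset.sum_congr rfl fun i hi => by rw [hk i (Finset.ne_of_mem_erase hi)]
    have h4 : ((sgn j : ZMod p)) * (sgn j : ZMod p) = 1 := by
      exact_mod_cast congrArg (Int.cast : ℤ → ZMod p) (sgn_mul_self j)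
    rw [h3] at h2
    linear_combination (sgn j : ZMod p) * (h2 - h1) - (Q (y' j) - Q (y j)) * h4

theorem card_signedSolutions_le (Y : Finset (ZMod p)) (Q : ZMod p → ZMod p) (d : ℕ)
    (hQ : ∀ c, (Y.filter fun y => Q y = c).card ≤ d) : (signedSolutions Y Q).card ≤ d * p ^ 3 := by
  have := card_signedSolutions_filter_le Y Q d hQ 0 (fun _ => Finset.univ) (fun _ => True)
    (fun _ _ _ _ _ => Finset.mem_univ _)
  rw [Finset.filter_true] at this
  simpa [ZMod.card] using this

/-- Solutions with a coordinate outside a large subset. -/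
theorem card_signedSolutions_exists_notMem_le (Y U : Finset (ZMod p)) (Q : ZMod p → ZMod p)
    (d b : ℕ) (hQ : ∀ c, (Y.filter fun y => Q y = c).card ≤ d) (hU : (Y \ U).card ≤ b) :
    ((signedSolutions Y Q).filter fun y => ∃ i, y i ∉ U).card ≤ 4 * (d * (b * p ^ 2)) := by
  classical
  have hsub : ((signedSolutions Y Q).filter fun y => ∃ i, y i ∉ U) ⊆
      Finset.univ.biUnion fun i : Fin 4 => (signedSolutions Y Q).filter fun y => y i ∉ U := by
    intro y hy
    rw [Finset.mem_filter] at hy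
    obtain ⟨hy, i, hi⟩ := hy
    exact Finset.mem_biUnion.2 ⟨i, Finset.mem_univ _, Finset.mem_filter.2 ⟨hy, hi⟩⟩
  refine (Finset.card_le_card hsub).trans (Finset.card_biUnion_le.trans ?_)
  have h1 : ∀ i : Fin 4, ((signedSolutions Y Q).filter fun y => y i ∉ U).card ≤
      d * (b * p ^ 2) := by
    intro i
    have h := card_signedSolutions_filter_le Y Q d hQ (i + 1)
      (fun k => if k = i then Y \ U else Finset.univ) (fun y => y i ∉ U) (by
        intro y hy hi k _
        by_cases hk : k = i
        · subst hk; simp [hy, hi]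
        · simp [hk])
    refine h.trans (Nat.mul_le_mul_left d ?_)
    have hi : i ∈ Finset.univ.erase (i + 1) := by
      rw [Finset.mem_erase]
      refine ⟨?_, Finset.mem_univ _⟩
      fin_cases i <;> decide
    rw [← Finset.mul_prod_erase _ _ hi, if_pos rfl]
    refine Nat.mul_le_mul hU ?_
    rw [Finset.prod_congr rfl (g := fun _ => p) (fun k hk => by
      rw [if_neg (Finset.ne_of_mem_erase hk), Finset.card_univ, ZMod.card]), Finset.prod_const,
      Finset.card_erase_of_mem hi, Finset.card_erase_of_mem (Finset.mem_univ _)]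
    simp
  refine (Finset.sum_le_sum fun i _ => h1 i).trans ?_
  simp

/-- Counting pairs of solutions whose `P`-values differ by a common shift. -/
theorem sum_card_shifted_pairs_le (Y U : Finset (ZMod p)) (P Q R : ZMod p → ZMod p)
    (d b K Δ : ℕ) (hP : ∀ c, (Y.filter fun y => P y = c).card ≤ d)
    (hQ : ∀ c, (Y.filter fun y => Q y = c).card ≤ d) (hU : (Y \ U).card ≤ b)
    (hR : ((signedSolutions Y Q).filter fun y => (∀ i, y i ∈ U) ∧
      ∑ i, (sgn i : ZMod p) * R (y i) = 0).card ≤ K * p ^ 2)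
    (hΔ : ∀ c : Fin 4 → ZMod p, ∃ t : Finset (ZMod p), t.card ≤ Δ ∧ ∀ h, ∀ y ∈ signedSolutions Y Q,
      (∀ i, y i ∈ U) → ∑ i, (sgn i : ZMod p) * R (y i) ≠ 0 → (∀ i, P (y i) = c i + h) → h ∈ t) :
    ∑ h : ZMod p, ((signedSolutions Y Q ×ˢ signedSolutions Y Q).filter fun w =>
      ∀ i, P (w.1 i) = P (w.2 i) + h).card ≤ d ^ 4 * (4 * d * b + K + d * Δ) * p ^ 3 := by
  classical
  set H := signedSolutions Y Q with hH
  let r : (Fin 4 → ZMod p) → Prop := fun y => (∀ i, y i ∈ U) ∧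
    ∑ i, (sgn i : ZMod p) * R (y i) ≠ 0
  choose t ht ht' using hΔ
  have hfib : ∀ c : Fin 4 → ZMod p, (H.filter fun y => ∀ i, P (y i) = c i).card ≤ d ^ 4 := by
    intro c
    refine (Finset.card_le_card (t := Fintype.piFinset fun i => Y.filter fun y => P y = c i)
      ?_).trans ?_
    · intro y hy
      rw [Finset.mem_filter, hH, mem_signedSolutions] at hy
      rw [Fintype.mem_piFinset]
      exact fun i => Finset.mem_filter.2 ⟨hy.1.1 i, hy.2 i⟩
    · rw [Fintype.card_piFinset]
      refine (Finset.prod_le_pow_card _ _ d fun i _ => hP _).trans ?_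
      simp
  have hZ : (H.filter fun y => ¬ r y).card ≤ (4 * d * b + K) * p ^ 2 := by
    have hsub : (H.filter fun y => ¬ r y) ⊆ (H.filter fun y => ∃ i, y i ∉ U) ∪
        H.filter fun y => (∀ i, y i ∈ U) ∧ ∑ i, (sgn i : ZMod p) * R (y i) = 0 := by
      intro y hy
      rw [Finset.mem_filter] at hy
      rw [Finset.mem_union, Finset.mem_filter, Finset.mem_filter]
      by_cases h : ∀ i, y i ∈ U
      · right
        exact ⟨hy.1, h, by_contra fun h2 => hy.2 ⟨h, h2⟩⟩
      · left
        exact ⟨hy.1, not_forall.1 h⟩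
    refine (Finset.card_le_card hsub).trans ((Finset.card_union_le _ _).trans ?_)
    have := card_signedSolutions_exists_notMem_le Y U Q d b hQ hU
    calc _ ≤ 4 * (d * (b * p ^ 2)) + K * p ^ 2 := Nat.add_le_add this hR
      _ = _ := by ring
  have hterm : ∀ h : ZMod p, ((H ×ˢ H).filter fun w => ∀ i, P (w.1 i) = P (w.2 i) + h).card ≤
      (H.filter fun y => ¬ r y).card * d ^ 4 +
        (H.filter fun y => h ∈ t fun i => P (y i)).card * d ^ 4 := by
    intro h
    rw [← Finset.card_filter_add_card_filter_not (s := (H ×ˢ H).filter _)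
      (fun w : (Fin 4 → ZMod p) × (Fin 4 → ZMod p) => ¬ r w.1)]
    refine Nat.add_le_add ?_ ?_
    · rw [mul_comm]
      refine Finset.card_le_mul_card_image_of_maps_to (f := Prod.fst) ?_ _ ?_
      · intro w hw
        simp only [Finset.mem_filter, Finset.mem_product] at hw ⊢
        exact ⟨hw.1.1.1, hw.2⟩
      · intro y _
        refine le_trans (Finset.card_le_card_of_injOn Prod.snd ?_ ?_) (hfib fun i => P (y i) - h)
        · intro w hw
          simp only [Finset.coe_filter, Set.mem_ofPred_eq, Finset.mem_filter,
            Finset.mem_product] at hw ⊢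
          refine ⟨hw.1.1.1.2, fun i => ?_⟩
          rw [← hw.2, hw.1.1.2 i]; ring
        · intro w hw w' hw' h2
          simp only [Finset.coe_filter, Set.mem_ofPred_eq] at hw hw'
          exact Prod.ext (hw.2.trans hw'.2.symm) h2
    · rw [mul_comm]
      refine Finset.card_le_mul_card_image_of_maps_to (f := Prod.snd) ?_ _ ?_
      · intro w hw
        simp only [Finset.mem_filter, Finset.mem_product, not_not] at hw ⊢
        exact ⟨hw.1.1.2, ht' _ h w.1 hw.1.1.1 hw.2.1 hw.2.2 hw.1.2⟩
      · intro y _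
        refine le_trans (Finset.card_le_card_of_injOn Prod.fst ?_ ?_) (hfib fun i => P (y i) + h)
        · intro w hw
          simp only [Finset.coe_filter, Set.mem_ofPred_eq, Finset.mem_filter,
            Finset.mem_product] at hw ⊢
          refine ⟨hw.1.1.1.1, fun i => ?_⟩
          rw [← hw.2, hw.1.1.2 i]
        · intro w hw w' hw' h2
          simp only [Finset.coe_filter, Set.mem_ofPred_eq] at hw hw'
          exact Prod.ext h2 (hw.2.trans hw'.2.symm)
  refine (Finset.sum_le_sum fun h _ => hterm h).trans ?_
  rw [Finset.sum_add_distrib, ← Finset.sum_mul, Finset.sum_const, Finset.card_univ, ZMod.card,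
    smul_eq_mul]
  have hswap : ∑ h : ZMod p, (H.filter fun y => h ∈ t fun i => P (y i)).card ≤ d * p ^ 3 * Δ := by
    simp only [Finset.card_filter]
    rw [Finset.sum_comm]
    refine (Finset.sum_le_card_nsmul H _ Δ fun y _ => ?_).trans ?_
    · rw [← Finset.card_filter, Finset.filter_univ_mem]
      exact ht _
    · exact Nat.mul_le_mul_right _ (card_signedSolutions_le Y Q d hQ)
  rw [← Finset.sum_mul, mul_assoc]
  calc _ ≤ p * (((4 * d * b + K) * p ^ 2) * d ^ 4) + (d * p ^ 3 * Δ) * d ^ 4 := by gcongr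
    _ = _ := by ring

end Counting

section Arithmetic

theorem exists_forall_prime_independent (u v w : ℤ[X])
    (h : ∀ a b c : ℚ, C a * u.map (Int.castRingHom ℚ) + C b * v.map (Int.castRingHom ℚ) +
      C c * w.map (Int.castRingHom ℚ) = 0 → a = 0 ∧ b = 0 ∧ c = 0) :
    ∃ p₀ : ℕ, ∀ (p : ℕ) [Fact p.Prime], p₀ < p → ∀ a b c : ZMod p,
      C a * u.map (Int.castRingHom (ZMod p)) + C b * v.map (Int.castRingHom (ZMod p)) +
        C c * w.map (Int.castRingHom (ZMod p)) = 0 → a = 0 ∧ b = 0 ∧ c = 0 := by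
  obtain ⟨p₀, hp₀⟩ := exists_forall_prime_linearIndependent ![u, v, w] (by
    intro c hc
    simp only [Fin.sum_univ_three, Matrix.cons_val] at hc
    obtain ⟨h0, h1, h2⟩ := h _ _ _ hc
    ext i
    fin_cases i
    exacts [h0, h1, h2])
  refine ⟨p₀, fun p _ hp a b c hc => ?_⟩
  have := hp₀ p hp ![a, b, c] (by simpa [Fin.sum_univ_three] using hc)
  exact ⟨congrFun this 0, congrFun this 1, congrFun this 2⟩

theorem wron_map {R S : Type*} [CommRing R] [CommRing S] (φ : R →+* S) (A B : R[X]) :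
    (wron A B).map φ = wron (A.map φ) (B.map φ) := by
  simp only [wron, Polynomial.map_sub, Polynomial.map_mul, derivative_map]

variable {p : ℕ} [Fact p.Prime]

/-- Exponential sums along independent rational functions with a common denominator. -/
theorem norm_sum_filter_stdAddChar_le (M : ℕ) (hM : 2 * M < p) (u₁ u₂ v : (ZMod p)[X])
    (h₁ : u₁.natDegree ≤ M) (h₂ : u₂.natDegree ≤ M) (hv : v.natDegree ≤ M)
    (hind : ∀ a b c : ZMod p, C a * u₁ + C b * u₂ + C c * v = 0 → a = 0 ∧ b = 0 ∧ c = 0)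
    (m n : ZMod p) (hmn : ¬ (m = 0 ∧ n = 0)) :
    ‖∑ y ∈ Finset.univ.filter fun y => eval y v ≠ 0,
      (ZMod.stdAddChar (m * (eval y u₁ / eval y v) + n * (eval y u₂ / eval y v)) : ℂ)‖ ≤
      5 * M * √p := by
  have hv0 : v ≠ 0 := by
    rintro rfl
    exact one_ne_zero (hind 0 0 1 (by simp)).2.2
  have h := norm_sum_stdAddChar_le M (C m * u₁ + C n * u₂) v hv0
    ((natDegree_add_le_of_degree_le ((natDegree_C_mul_le _ _).trans h₁)
      ((natDegree_C_mul_le _ _).trans h₂))) hv (by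
      intro c hc
      have := hind m n (-c) (by rw [hc, C_neg]; ring)
      exact hmn ⟨this.1, this.2.1⟩) hM
  rw [Finset.sum_filter]
  convert h using 5 with y
  rw [eval_add, eval_mul, eval_mul, eval_C, eval_C]
  ring

theorem card_filter_div_eq_le (M : ℕ) (u₁ u₂ v : (ZMod p)[X])
    (h₁ : u₁.natDegree ≤ M) (hv : v.natDegree ≤ M)
    (hind : ∀ a b c : ZMod p, C a * u₁ + C b * u₂ + C c * v = 0 → a = 0 ∧ b = 0 ∧ c = 0)
    (c : ZMod p) :
    ((Finset.univ.filter fun y => eval y v ≠ 0).filter fun y =>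
      eval y u₁ / eval y v = c).card ≤ M := by
  have h0 : u₁ - C c * v ≠ 0 := by
    intro h
    exact one_ne_zero (hind 1 0 (-c) (by
      rw [C_neg, C_0, C_1, zero_mul]; linear_combination h)).1
  refine le_trans (Finset.card_le_card ?_) ((card_filter_eval_eq_zero_le _ h0).trans
    (natDegree_sub_le_of_le h₁ ((natDegree_C_mul_le _ _).trans hv) |>.trans (max_self M).le))
  intro y hy
  simp only [Finset.mem_filter, Finset.mem_univ, true_and] at hy ⊢
  rw [div_eq_iff hy.1] at hy
  rw [eval_sub, eval_mul, eval_C, hy.2, sub_self]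

/-- Solutions of two simultaneous signed equations in independent rational functions. -/
theorem card_double_solutions_le (M : ℕ) (hM : 2 * M < p) (u₁ u₂ v : (ZMod p)[X])
    (h₁ : u₁.natDegree ≤ M) (h₂ : u₂.natDegree ≤ M) (hv : v.natDegree ≤ M)
    (hind : ∀ a b c : ZMod p, C a * u₁ + C b * u₂ + C c * v = 0 → a = 0 ∧ b = 0 ∧ c = 0) :
    ((Fintype.piFinset fun _ : Fin 4 => Finset.univ.filter fun y => eval y v ≠ 0).filter fun w =>
      ∑ i, (sgn i : ZMod p) * (eval (w i) u₁ / eval (w i) v) = 0 ∧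
      ∑ i, (sgn i : ZMod p) * (eval (w i) u₂ / eval (w i) v) = 0).card ≤
      (1 + 625 * M ^ 4) * p ^ 2 := by
  have hp : 0 < (p : ℝ) := Nat.cast_pos.2 (Fact.out : p.Prime).pos
  have h := sum_norm_pow_four (Finset.univ.filter fun y : ZMod p => eval y v ≠ 0)
    (fun y => eval y u₁ / eval y v) (fun y => eval y u₂ / eval y v)
  set N := ((Fintype.piFinset fun _ : Fin 4 => Finset.univ.filter fun y => eval y v ≠ 0).filter
    fun w => ∑ i, (sgn i : ZMod p) * (eval (w i) u₁ / eval (w i) v) = 0 ∧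
      ∑ i, (sgn i : ZMod p) * (eval (w i) u₂ / eval (w i) v) = 0).card
  have hterm : ∀ m n : ZMod p, ‖∑ y ∈ Finset.univ.filter fun y => eval y v ≠ 0,
      (ZMod.stdAddChar (m * (eval y u₁ / eval y v) + n * (eval y u₂ / eval y v)) : ℂ)‖ ^ 4 ≤
      (if m = 0 then if n = 0 then (p : ℝ) ^ 4 else 0 else 0) + 625 * M ^ 4 * p ^ 2 := by
    intro m n
    by_cases hmn : m = 0 ∧ n = 0
    · rw [if_pos hmn.1, if_pos hmn.2]
      have h1 : ‖∑ y ∈ Finset.univ.filter fun y => eval y v ≠ 0,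
          (ZMod.stdAddChar (m * (eval y u₁ / eval y v) + n * (eval y u₂ / eval y v)) : ℂ)‖ ≤ p := by
        refine (norm_sum_le _ _).trans ?_
        simp only [AddChar.norm_apply, Finset.sum_const, nsmul_eq_mul, mul_one]
        exact_mod_cast (Finset.card_le_univ _).trans (ZMod.card p).le
      have h2 := pow_le_pow_left₀ (norm_nonneg _) h1 4
      have : (0 : ℝ) ≤ 625 * M ^ 4 * p ^ 2 := by positivity
      linarith
    · have h1 := norm_sum_filter_stdAddChar_le M hM u₁ u₂ v h₁ h₂ hv hind m n hmn
      have h2 := pow_le_pow_left₀ (norm_nonneg _) h1 4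
      have h3 : (√(p : ℝ)) ^ 4 = p ^ 2 := by
        rw [show (4 : ℕ) = 2 * 2 from rfl, pow_mul, Real.sq_sqrt hp.le]
      rw [mul_pow, mul_pow, h3] at h2
      have h4 : (0 : ℝ) ≤ (if m = 0 then if n = 0 then (p : ℝ) ^ 4 else 0 else 0) := by
        split_ifs <;> positivity
      refine h2.trans ?_
      norm_num
      exact h4
  have hsum := Finset.sum_le_sum fun m (_ : m ∈ (Finset.univ : Finset (ZMod p))) =>
    Finset.sum_le_sum fun n (_ : n ∈ (Finset.univ : Finset (ZMod p))) => hterm m n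
  rw [h] at hsum
  have hrhs : ∑ m : ZMod p, ∑ n : ZMod p, ((if m = 0 then if n = 0 then (p : ℝ) ^ 4 else 0 else 0) +
      625 * M ^ 4 * p ^ 2) = p ^ 2 * (((1 + 625 * M ^ 4) * p ^ 2 : ℕ) : ℝ) := by
    simp only [Finset.sum_add_distrib, Finset.sum_const, Finset.card_univ, ZMod.card]
    rw [Finset.sum_eq_single 0 (fun m _ hm => by simp [hm]) (by simp)]
    simp
    ring
  rw [hrhs] at hsum
  exact_mod_cast le_of_mul_le_mul_left hsum (by positivity)

end Arithmetic

/-- The square-root bounds and the counting estimate available for large primes. -/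
theorem exists_weil_and_count (A B D : ℤ[X])
    (hind : ∀ a b c : ℚ, C a * A.map (Int.castRingHom ℚ) + C b * B.map (Int.castRingHom ℚ) +
      C c * D.map (Int.castRingHom ℚ) = 0 → a = 0 ∧ b = 0 ∧ c = 0) :
    ∃ K p₀ : ℕ, ∀ (p : ℕ) [Fact p.Prime], p₀ < p → ∀ (Y : Finset (ZMod p)) (P Q : ZMod p → ZMod p),
      (∀ y, y ∈ Y ↔ intEval y B ≠ 0) → (∀ y, P y = intEval y A / intEval y B) →
      (∀ y, Q y = intEval y D / intEval y B) →
      Yᶜ.card ≤ K ∧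
      (∀ m n : ZMod p, ¬ (m = 0 ∧ n = 0) →
        ‖∑ y ∈ Y, (ZMod.stdAddChar (m * Q y + n * P y) : ℂ)‖ ≤ K * √p) ∧
      ∑ h : ZMod p, ((signedSolutions Y Q ×ˢ signedSolutions Y Q).filter fun w =>
        ∀ i, P (w.1 i) = P (w.2 i) + h).card ≤ K * p ^ 3 := by
  have hB : B.map (Int.castRingHom ℚ) ≠ 0 := by
    intro h
    exact one_ne_zero (hind 0 1 0 (by simp [h])).2.1
  obtain ⟨p₁, hp₁⟩ := exists_forall_prime_independent A B D hind
  obtain ⟨p₂, hp₂⟩ := exists_forall_prime_independent (D * wron A B) (wron D B * B) (B * wron A B)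
    (by
      intro a b c h
      simp only [Polynomial.map_mul, wron_map] at h
      exact linearIndependent_derivative hB hind h)
  obtain ⟨l, Δ, hl, hΔ⟩ := exists_shift_polynomial A B D sgn
  obtain ⟨p₃, hp₃⟩ := exists_forall_prime_map_ne_zero l hl
  set M := A.natDegree + B.natDegree + D.natDegree + (D * wron A B).natDegree +
    (wron D B * B).natDegree + (B * wron A B).natDegree + (wron A B).natDegree + l.natDegree with hM
  refine ⟨M + 5 * M + M ^ 4 * (4 * M * (M + M * M) + (1 + 625 * M ^ 4) + M * Δ),
    p₁ + p₂ + p₃ + 2 * M, ?_⟩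
  intro p _ hp Y P Q hY hP hQ
  set φ := Int.castRingHom (ZMod p) with hφ
  have hdeg : ∀ q : ℤ[X], q.natDegree ≤ M → (q.map φ).natDegree ≤ M := fun q hq =>
    natDegree_map_le.trans hq
  have hindp := hp₁ p (by omega)
  have hindp₂ := hp₂ p (by omega)
  have hlp := hp₃ p (by omega)
  rw [← hφ] at hindp hindp₂ hlp
  have hYe : Y = Finset.univ.filter fun y => eval y (B.map φ) ≠ 0 := by
    ext y
    rw [hY, intEval_eq_eval_map]
    simp [hφ]
  have hPe : P = fun y => eval y (A.map φ) / eval y (B.map φ) := by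
    ext y
    rw [hP, intEval_eq_eval_map, intEval_eq_eval_map]
  have hQe : Q = fun y => eval y (D.map φ) / eval y (B.map φ) := by
    ext y
    rw [hQ, intEval_eq_eval_map, intEval_eq_eval_map]
  have hB0 : B.map φ ≠ 0 := by
    intro h
    exact one_ne_zero (hindp 0 1 0 (by simp [h])).2.1
  have hW0 : (wron A B).map φ ≠ 0 := by
    intro h
    exact one_ne_zero (hindp₂ 0 0 1 (by simp [h])).2.2
  have hind₁ : ∀ a b c : ZMod p, C a * D.map φ + C b * A.map φ + C c * B.map φ = 0 →
      a = 0 ∧ b = 0 ∧ c = 0 := by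
    intro a b c h
    obtain ⟨h1, h2, h3⟩ := hindp b c a (by linear_combination h)
    exact ⟨h3, h1, h2⟩
  have hind₂ : ∀ a b c : ZMod p, C a * A.map φ + C b * D.map φ + C c * B.map φ = 0 →
      a = 0 ∧ b = 0 ∧ c = 0 := by
    intro a b c h
    obtain ⟨h1, h2, h3⟩ := hindp a c b (by linear_combination h)
    exact ⟨h1, h3, h2⟩
  have hfP : ∀ c, (Y.filter fun y => P y = c).card ≤ M := by
    rw [hYe, hPe]
    exact card_filter_div_eq_le M _ _ _ (hdeg A (by omega)) (hdeg B (by omega)) hind₂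
  have hfQ : ∀ c, (Y.filter fun y => Q y = c).card ≤ M := by
    rw [hYe, hQe]
    exact card_filter_div_eq_le M _ _ _ (hdeg D (by omega)) (hdeg B (by omega)) hind₁
  refine ⟨?_, ?_, ?_⟩
  · have : Yᶜ = Finset.univ.filter fun y => eval y (B.map φ) = 0 := by
      rw [hYe]; ext y; simp
    rw [this]
    refine (card_filter_eval_eq_zero_le _ hB0).trans ((hdeg B (by omega)).trans ?_)
    omega
  · intro m n hmn
    rw [hYe, hPe, hQe]
    refine (norm_sum_filter_stdAddChar_le M (by omega) _ _ _ (hdeg D (by omega)) (hdeg A (by omega))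
      (hdeg B (by omega)) hind₁ m n hmn).trans ?_
    refine mul_le_mul_of_nonneg_right ?_ (Real.sqrt_nonneg _)
    have : 5 * M ≤ M + 5 * M + M ^ 4 * (4 * M * (M + M * M) + (1 + 625 * M ^ 4) + M * Δ) := by omega
    exact_mod_cast this
  · set U := Y.filter fun y => eval y ((wron A B).map φ) ≠ 0 ∧ eval (P y) (l.map φ) ≠ 0 with hU
    have hUY : ∀ y ∈ U, eval y (B.map φ) ≠ 0 ∧ eval y ((wron A B).map φ) ≠ 0 ∧
        eval (P y) (l.map φ) ≠ 0 := by
      intro y hy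
      rw [hU, Finset.mem_filter, hYe, Finset.mem_filter] at hy
      exact ⟨hy.1.2, hy.2⟩
    have hUcard : (Y \ U).card ≤ M + M * M := by
      have hsub : Y \ U ⊆ (Finset.univ.filter fun y => eval y ((wron A B).map φ) = 0) ∪
          Y.filter fun y => eval (P y) (l.map φ) = 0 := by
        intro y hy
        rw [Finset.mem_sdiff, hU, Finset.mem_filter] at hy
        simp only [Finset.mem_union, Finset.mem_filter, Finset.mem_univ, true_and]
        tauto
      refine (Finset.card_le_card hsub).trans ((Finset.card_union_le _ _).trans ?_)
      refine Nat.add_le_add ((card_filter_eval_eq_zero_le _ hW0).trans (hdeg _ (by omega))) ?_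
      refine (Finset.card_le_mul_card_image_of_maps_to (f := P)
        (t := Finset.univ.filter fun z => eval z (l.map φ) = 0) ?_ M ?_).trans
        (Nat.mul_le_mul_left M ((card_filter_eval_eq_zero_le _ hlp).trans (hdeg l (by omega))))
      · intro y hy
        rw [Finset.mem_filter] at hy
        simpa using hy.2
      · intro c _
        refine le_trans (Finset.card_le_card ?_) (hfP c)
        intro y hy
        simp only [Finset.mem_filter] at hy ⊢
        exact ⟨hy.1.1, hy.2⟩
    have hcount := sum_card_shifted_pairs_le Y U P Q
      (fun y => eval y ((wron D B).map φ) / eval y ((wron A B).map φ)) M (M + M * M)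
      (1 + 625 * M ^ 4) Δ hfP hfQ hUcard ?_ ?_
    · refine hcount.trans (Nat.mul_le_mul_right _ ?_)
      omega
    · refine le_trans (Finset.card_le_card ?_) (card_double_solutions_le M (by omega)
        ((D * wron A B).map φ) ((wron D B * B).map φ) ((B * wron A B).map φ)
        (hdeg _ (by omega)) (hdeg _ (by omega)) (hdeg _ (by omega)) hindp₂)
      intro w hw
      rw [Finset.mem_filter, mem_signedSolutions] at hw
      obtain ⟨⟨_, hw1⟩, hw2, hw3⟩ := hw
      rw [Finset.mem_filter, Fintype.mem_piFinset]
      refine ⟨fun i => ?_, ?_, ?_⟩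
      · obtain ⟨h1, h2, _⟩ := hUY _ (hw2 i)
        rw [Finset.mem_filter, Polynomial.map_mul, eval_mul]
        exact ⟨Finset.mem_univ _, mul_ne_zero h1 h2⟩
      · rw [← hw1]
        refine Finset.sum_congr rfl fun i _ => ?_
        obtain ⟨h1, h2, _⟩ := hUY _ (hw2 i)
        rw [hQe, Polynomial.map_mul, Polynomial.map_mul, eval_mul, eval_mul,
          mul_div_mul_right _ _ h2]
      · rw [← hw3]
        refine Finset.sum_congr rfl fun i _ => ?_
        obtain ⟨h1, h2, _⟩ := hUY _ (hw2 i)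
        rw [Polynomial.map_mul, Polynomial.map_mul, eval_mul, eval_mul, mul_comm (eval _ (B.map φ)),
          mul_div_mul_right _ _ h1]
    · intro c
      obtain ⟨g, hg0, hgd, hg⟩ := hΔ (ZMod p) c
      refine ⟨Finset.univ.filter fun h => eval h g = 0,
        (card_filter_eval_eq_zero_le _ hg0).trans hgd, ?_⟩
      intro h y hy hyU hR hc
      rw [Finset.mem_filter]
      refine ⟨Finset.mem_univ _, hg h y ?_ ?_ ?_ ?_ ?_ ?_⟩
      · intro i
        rw [intEval_eq_eval_map]
        exact (hUY _ (hyU i)).1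
      · intro i
        rw [← hc i, hPe, intEval_eq_eval_map, intEval_eq_eval_map]
        exact (div_mul_cancel₀ _ (hUY _ (hyU i)).1).symm
      · rw [mem_signedSolutions] at hy
        rw [← hy.2]
        exact Finset.sum_congr rfl fun i _ => by rw [hQ]
      · intro i
        rw [intEval_eq_eval_map]
        exact (hUY _ (hyU i)).2.1
      · intro i
        rw [← hc i, intEval_eq_eval_map]
        exact (hUY _ (hyU i)).2.2
      · simpa only [intEval_eq_eval_map] using hR

section Fourier

variable {p : ℕ} [Fact p.Prime]

theorem sum_stdAddChar_mul (b : ZMod p) :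
    ∑ x : ZMod p, (ZMod.stdAddChar (x * b) : ℂ) = if b = 0 then (p : ℂ) else 0 := by
  rw [AddChar.sum_mulShift b (ZMod.isPrimitive_stdAddChar p), ZMod.card]
  split_ifs <;> simp

/-- Plancherel's identity on `ZMod p`. -/
theorem sum_norm_sq_trigonometric (c : ZMod p → ℂ) :
    ∑ x : ZMod p, ‖∑ n : ZMod p, c n * ZMod.stdAddChar (n * x)‖ ^ 2 =
      p * ∑ n : ZMod p, ‖c n‖ ^ 2 := by
  apply Complex.ofReal_injective
  push_cast
  simp only [← Complex.mul_conj', map_sum, map_mul, Finset.sum_mul_sum, ← AddChar.map_neg_eq_conj]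
  rw [Finset.sum_comm, Finset.mul_sum]
  refine Finset.sum_congr rfl fun n _ => ?_
  rw [Finset.sum_comm]
  have h : ∀ m x : ZMod p, c n * ZMod.stdAddChar (n * x) *
      ((starRingEnd ℂ) (c m) * ZMod.stdAddChar (-(m * x))) =
      c n * (starRingEnd ℂ) (c m) * ZMod.stdAddChar (x * (n - m)) := by
    intro m x
    rw [mul_mul_mul_comm, ← AddChar.map_add_eq_mul]
    congr 2
    ring
  simp only [h, ← Finset.mul_sum, sum_stdAddChar_mul, sub_eq_zero]
  simp [mul_comm]

theorem fourier_inversion (f : ZMod p → ℂ) (z : ZMod p) :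
    ∑ n : ZMod p, (∑ a : ZMod p, f a * ZMod.stdAddChar (n * (-a))) * ZMod.stdAddChar (n * z) =
      p * f z := by
  simp only [Finset.sum_mul]
  rw [Finset.sum_comm]
  have h : ∀ a n : ZMod p, f a * ZMod.stdAddChar (n * (-a)) * ZMod.stdAddChar (n * z) =
      f a * ZMod.stdAddChar (n * (z - a)) := by
    intro a n
    rw [mul_assoc, ← AddChar.map_add_eq_mul]
    congr 2
    ring
  simp only [h, ← Finset.mul_sum, sum_stdAddChar_mul, sub_eq_zero]
  simp [mul_comm]

/-- The sum of squares of the averages of a bounded function along a curve with square-root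
cancellation, after removal of the main term. -/
theorem sum_norm_sq_curve_le {Y : Finset (ZMod p)} {P Q : ZMod p → ZMod p} {K : ℕ}
    (hY : Yᶜ.card ≤ K)
    (hW : ∀ m n : ZMod p, ¬ (m = 0 ∧ n = 0) →
      ‖∑ y ∈ Y, (ZMod.stdAddChar (m * Q y + n * P y) : ℂ)‖ ≤ K * √p)
    (f : ZMod p → ℂ) (hf : ∀ x, ‖f x‖ ≤ 1) (m : ZMod p) :
    ∑ x : ZMod p, ‖∑ y ∈ Y, f (x + P y) * ZMod.stdAddChar (m * Q y) -
      if m = 0 then ∑ a, f a else 0‖ ^ 2 ≤ (K : ℝ) ^ 2 * (p : ℝ) ^ 2 := by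
  have hp : (0 : ℝ) < p := Nat.cast_pos.2 (Fact.out : p.Prime).pos
  have hp1 : (1 : ℝ) ≤ p := Nat.one_le_cast.2 (Fact.out : p.Prime).one_le
  set F : ZMod p → ℂ := fun n => ∑ a : ZMod p, f a * ZMod.stdAddChar (n * (-a)) with hF
  set k : ZMod p → ℂ := fun n => ∑ y ∈ Y, (ZMod.stdAddChar (m * Q y + n * P y) : ℂ) -
    if m = 0 ∧ n = 0 then (p : ℂ) else 0 with hk
  have hkle : ∀ n, ‖k n‖ ≤ K * √p := by
    intro n
    simp only [hk]
    split_ifs with h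
    · simp only [h.1, h.2, zero_mul, add_zero, AddChar.map_zero_eq_one, Finset.sum_const,
        nsmul_eq_mul, mul_one]
      have h1 : (Y.card : ℂ) - p = -(Yᶜ.card : ℂ) := by
        have h2 := Finset.card_add_card_compl Y
        rw [ZMod.card] at h2
        have h3 : (Y.card : ℂ) + Yᶜ.card = p := by exact_mod_cast h2
        linear_combination h3
      rw [h1, norm_neg, Complex.norm_natCast]
      have h2 : (Yᶜ.card : ℝ) ≤ K := by exact_mod_cast hY
      have h3 : (1 : ℝ) ≤ √p := Real.one_le_sqrt.2 hp1
      nlinarith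
    · rw [sub_zero]
      exact hW m n h
  have hT : ∀ x, (p : ℂ) * (∑ y ∈ Y, f (x + P y) * ZMod.stdAddChar (m * Q y) -
      if m = 0 then ∑ a, f a else 0) = ∑ n, F n * k n * ZMod.stdAddChar (n * x) := by
    intro x
    simp only [hk, mul_sub, sub_mul, Finset.sum_sub_distrib]
    congr 1
    · rw [Finset.mul_sum]
      simp only [Finset.mul_sum, Finset.sum_mul]
      rw [Finset.sum_comm]
      refine Finset.sum_congr rfl fun y _ => ?_
      rw [← mul_assoc, ← fourier_inversion f (x + P y), Finset.sum_mul]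
      refine Finset.sum_congr rfl fun n _ => ?_
      rw [mul_assoc, mul_assoc, ← AddChar.map_add_eq_mul, ← AddChar.map_add_eq_mul]
      congr 2
      ring
    · by_cases h : m = 0 <;> simp [h, hF, mul_comm]
  have h1 := sum_norm_sq_trigonometric fun n => F n * k n
  have h2 : ∑ n, ‖F n‖ ^ 2 = p * ∑ a, ‖f a‖ ^ 2 := by
    have := sum_norm_sq_trigonometric fun a => f (-a)
    rw [← Equiv.sum_comp (Equiv.neg (ZMod p)) (fun a => ‖f a‖ ^ 2)]
    simp only [Equiv.neg_apply]
    rw [← this]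
    refine Finset.sum_congr rfl fun n _ => ?_
    simp only [hF]
    rw [← Equiv.sum_comp (Equiv.neg (ZMod p))]
    simp [mul_comm]
  have h3 : ∑ a, ‖f a‖ ^ 2 ≤ (p : ℝ) := by
    calc ∑ a, ‖f a‖ ^ 2 ≤ ∑ _a : ZMod p, (1 : ℝ) :=
          Finset.sum_le_sum fun a _ => pow_le_one₀ (norm_nonneg _) (hf a)
      _ = p := by simp [ZMod.card]
  simp only [← hT, norm_mul, mul_pow, ← Finset.mul_sum, Complex.norm_natCast] at h1
  have h4 : ∑ n, ‖F n‖ ^ 2 * ‖k n‖ ^ 2 ≤ (∑ n, ‖F n‖ ^ 2) * ((K : ℝ) ^ 2 * p) := by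
    rw [Finset.sum_mul]
    refine Finset.sum_le_sum fun n _ => mul_le_mul_of_nonneg_left ?_ (sq_nonneg _)
    calc ‖k n‖ ^ 2 ≤ (K * √p) ^ 2 := pow_le_pow_left₀ (norm_nonneg _) (hkle n) 2
      _ = (K : ℝ) ^ 2 * p := by rw [mul_pow, Real.sq_sqrt hp.le]
  rw [h2] at h4
  have h5 : (p : ℝ) * (∑ a, ‖f a‖ ^ 2) * ((K : ℝ) ^ 2 * p) ≤ p * p * ((K : ℝ) ^ 2 * p) := by
    gcongr
  refine le_of_mul_le_mul_left ?_ (pow_pos hp 2)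
  rw [h1]
  nlinarith

end Fourier

section Averages

variable {p : ℕ} [Fact p.Prime]

/-- The frequencies that are zero or are taken often by `φ`. -/
def largeFrequencies (φ : ZMod p → ZMod p) : Finset (ZMod p) :=
  Finset.univ.filter fun m => m = 0 ∨ √p < ((Finset.univ.filter fun x => φ x = m).card : ℝ)

theorem card_largeFrequencies_le (φ : ZMod p → ZMod p) :
    ((largeFrequencies φ).card : ℝ) ≤ 2 * √p := by
  have hp : (0 : ℝ) < p := Nat.cast_pos.2 (Fact.out : p.Prime).pos
  have hp1 : (1 : ℝ) ≤ p := Nat.one_le_cast.2 (Fact.out : p.Prime).one_le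
  set L : Finset (ZMod p) := Finset.univ.filter fun m =>
    √p < ((Finset.univ.filter fun x => φ x = m).card : ℝ) with hL
  have h1 : (largeFrequencies φ).card ≤ L.card + 1 := by
    refine le_trans (Finset.card_le_card (t := insert 0 L) fun m hm => ?_)
      (Finset.card_insert_le _ _)
    rw [largeFrequencies, Finset.mem_filter] at hm
    rw [Finset.mem_insert, hL, Finset.mem_filter]
    exact hm.2.imp id fun h => ⟨Finset.mem_univ _, h⟩
  have h2 : (L.card : ℝ) * √p ≤ p := by
    calc (L.card : ℝ) * √p = ∑ _m ∈ L, √p := by rw [Finset.sum_const, nsmul_eq_mul]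
      _ ≤ ∑ m ∈ L, ((Finset.univ.filter fun x => φ x = m).card : ℝ) := by
          refine Finset.sum_le_sum fun m hm => ?_
          rw [hL, Finset.mem_filter] at hm
          exact hm.2.le
      _ ≤ ∑ m, ((Finset.univ.filter fun x => φ x = m).card : ℝ) :=
          Finset.sum_le_sum_of_subset_of_nonneg (Finset.subset_univ _) fun _ _ _ => by positivity
      _ = p := by
          rw [← Nat.cast_sum, ← Finset.card_eq_sum_card_fiberwise fun x _ => Finset.mem_univ (φ x)]
          simp [ZMod.card]
  have h3 : (1 : ℝ) ≤ √p := Real.one_le_sqrt.2 hp1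
  have h4 : √(p : ℝ) * √p = p := Real.mul_self_sqrt hp.le
  have h5 : (L.card : ℝ) ≤ √p := by
    refine le_of_mul_le_mul_right ?_ (lt_of_lt_of_le one_pos h3)
    rw [h4]
    exact h2
  have h6 : ((largeFrequencies φ).card : ℝ) ≤ L.card + 1 := by exact_mod_cast h1
  linarith

theorem sq_sum_large_le {Y : Finset (ZMod p)} {P Q : ZMod p → ZMod p} {K : ℕ}
    (hY : Yᶜ.card ≤ K)
    (hW : ∀ m n : ZMod p, ¬ (m = 0 ∧ n = 0) →
      ‖∑ y ∈ Y, (ZMod.stdAddChar (m * Q y + n * P y) : ℂ)‖ ≤ K * √p)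
    (f : ZMod p → ℂ) (hf : ∀ x, ‖f x‖ ≤ 1) (φ : ZMod p → ZMod p) :
    (∑ x ∈ Finset.univ.filter fun x => φ x ∈ largeFrequencies φ,
      ‖∑ y ∈ Y, f (x + P y) * ZMod.stdAddChar (φ x * Q y) -
        if φ x = 0 then ∑ a, f a else 0‖) ^ 2 ≤ 2 * (K : ℝ) ^ 2 * √p * (p : ℝ) ^ 3 := by
  set T : ZMod p → ZMod p → ℝ := fun m x =>
    ‖∑ y ∈ Y, f (x + P y) * ZMod.stdAddChar (m * Q y) - if m = 0 then ∑ a, f a else 0‖ with hT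
  set X := Finset.univ.filter fun x => φ x ∈ largeFrequencies φ with hX
  change (∑ x ∈ X, T (φ x) x) ^ 2 ≤ _
  have hp : (0 : ℝ) < p := Nat.cast_pos.2 (Fact.out : p.Prime).pos
  have h1 : (X.card : ℝ) ≤ p := by
    have := Finset.card_le_univ X
    rw [ZMod.card] at this
    exact_mod_cast this
  have h2 : ∑ x ∈ X, T (φ x) x ^ 2 ≤ (largeFrequencies φ).card * ((K : ℝ) ^ 2 * (p : ℝ) ^ 2) := by
    rw [← Finset.sum_fiberwise_of_maps_to (t := largeFrequencies φ) (g := φ)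
      fun x hx => (Finset.mem_filter.1 hx).2, ← nsmul_eq_mul, ← Finset.sum_const]
    refine Finset.sum_le_sum fun m _ => ?_
    calc ∑ x ∈ X with φ x = m, T (φ x) x ^ 2 = ∑ x ∈ X with φ x = m, T m x ^ 2 :=
          Finset.sum_congr rfl fun x hx => by rw [(Finset.mem_filter.1 hx).2]
      _ ≤ ∑ x, T m x ^ 2 :=
          Finset.sum_le_sum_of_subset_of_nonneg (Finset.subset_univ _) fun _ _ _ => sq_nonneg _
      _ ≤ _ := sum_norm_sq_curve_le hY hW f hf m
  have h3 := card_largeFrequencies_le φ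
  calc (∑ x ∈ X, T (φ x) x) ^ 2 ≤ X.card * ∑ x ∈ X, T (φ x) x ^ 2 := sq_sum_le_card_mul_sum_sq
    _ ≤ p * ((2 * √p) * ((K : ℝ) ^ 2 * (p : ℝ) ^ 2)) := by
        refine mul_le_mul h1 (h2.trans ?_) (Finset.sum_nonneg fun _ _ => sq_nonneg _) hp.le
        exact mul_le_mul_of_nonneg_right h3 (by positivity)
    _ = _ := by ring

/-- Pairs of points of `Y` whose images under `P` differ by `h`. -/
def shiftedPairs (Y : Finset (ZMod p)) (P : ZMod p → ZMod p) (h : ZMod p) :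
    Finset (ZMod p × ZMod p) :=
  (Y ×ˢ Y).filter fun w => P w.1 = P w.2 + h

/-- The correlation at shift `h` of two twists of a curve. -/
def curveCorrelation (Y : Finset (ZMod p)) (P Q : ZMod p → ZMod p) (h m n : ZMod p) : ℂ :=
  ∑ w ∈ shiftedPairs Y P h, ZMod.stdAddChar (m * Q w.1 + n * (-Q w.2))

theorem sum_norm_curveCorrelation_pow_four_le {Y : Finset (ZMod p)} {P Q : ZMod p → ZMod p}
    {K : ℕ} (hN : ∑ h : ZMod p, ((signedSolutions Y Q ×ˢ signedSolutions Y Q).filter fun w =>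
      ∀ i, P (w.1 i) = P (w.2 i) + h).card ≤ K * p ^ 3) :
    ∑ h : ZMod p, ∑ m : ZMod p, ∑ n : ZMod p, ‖curveCorrelation Y P Q h m n‖ ^ 4 ≤
      K * (p : ℝ) ^ 5 := by
  simp only [curveCorrelation]
  simp only [sum_norm_pow_four (f := fun w : ZMod p × ZMod p => Q w.1)
    (g := fun w : ZMod p × ZMod p => -Q w.2)]
  rw [← Finset.mul_sum]
  have h1 : ∑ h : ZMod p, ((Fintype.piFinset fun _ : Fin 4 => shiftedPairs Y P h).filter fun w =>
        ∑ i, (sgn i : ZMod p) * Q (w i).1 = 0 ∧ ∑ i, (sgn i : ZMod p) * -Q (w i).2 = 0).card ≤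
      K * p ^ 3 := by
    refine le_trans (Finset.sum_le_sum fun h _ => ?_) hN
    refine Finset.card_le_card_of_injOn (fun w => (fun i => (w i).1, fun i => (w i).2)) ?_ ?_
    · intro w hw
      rw [Finset.mem_coe, Finset.mem_filter, Fintype.mem_piFinset] at hw
      obtain ⟨hw, h1, h2⟩ := hw
      simp only [shiftedPairs, Finset.mem_filter, Finset.mem_product] at hw
      rw [Finset.mem_coe, Finset.mem_filter, Finset.mem_product, mem_signedSolutions,
        mem_signedSolutions]
      refine ⟨⟨⟨fun i => (hw i).1.1, h1⟩, fun i => (hw i).1.2, ?_⟩, fun i => (hw i).2⟩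
      simpa only [mul_neg, Finset.sum_neg_distrib, neg_eq_zero] using h2
    · intro w _ w' _ hww
      rw [Prod.mk.injEq] at hww
      funext i
      exact Prod.ext (congrFun hww.1 i) (congrFun hww.2 i)
  calc _ ≤ (p : ℝ) ^ 2 * (K * (p : ℝ) ^ 3) := by
        refine mul_le_mul_of_nonneg_left ?_ (by positivity)
        exact_mod_cast h1
    _ = _ := by ring

theorem sum_pow_four_correlation_le (X : Finset (ZMod p)) (φ : ZMod p → ZMod p) (M : ℝ)
    (hX : ∀ m, ((X.filter fun x => φ x = m).card : ℝ) ≤ M)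
    (S : ZMod p → ZMod p → ZMod p → ℝ) (hS : ∀ h m n, 0 ≤ S h m n) :
    ∑ x ∈ X, ∑ x' ∈ X, S (x' - x) (φ x) (φ x') ≤ M * ∑ h, ∑ m, ∑ n, S h m n := by
  calc ∑ x ∈ X, ∑ x' ∈ X, S (x' - x) (φ x) (φ x')
      ≤ ∑ x ∈ X, ∑ x', S (x' - x) (φ x) (φ x') :=
        Finset.sum_le_sum fun x _ =>
          Finset.sum_le_sum_of_subset_of_nonneg (Finset.subset_univ _) fun _ _ _ => hS _ _ _
    _ = ∑ x ∈ X, ∑ h, S h (φ x) (φ (x + h)) := by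
        refine Finset.sum_congr rfl fun x _ => ?_
        rw [← Equiv.sum_comp (Equiv.addLeft x)]
        simp
    _ ≤ ∑ x ∈ X, ∑ h, ∑ n, S h (φ x) n :=
        Finset.sum_le_sum fun x _ => Finset.sum_le_sum fun h _ =>
          Finset.single_le_sum (f := fun n => S h (φ x) n) (fun _ _ => hS _ _ _)
            (Finset.mem_univ _)
    _ = ∑ h, ∑ m, ∑ x ∈ X with φ x = m, ∑ n, S h (φ x) n := by
        rw [Finset.sum_comm]
        refine Finset.sum_congr rfl fun h _ => ?_
        rw [Finset.sum_fiberwise]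
    _ ≤ ∑ h, ∑ m, M * ∑ n, S h m n := by
        refine Finset.sum_le_sum fun h _ => Finset.sum_le_sum fun m _ => ?_
        calc ∑ x ∈ X with φ x = m, ∑ n, S h (φ x) n = ∑ x ∈ X with φ x = m, ∑ n, S h m n :=
              Finset.sum_congr rfl fun x hx => by rw [(Finset.mem_filter.1 hx).2]
          _ = ((X.filter fun x => φ x = m).card : ℝ) * ∑ n, S h m n := by
              rw [Finset.sum_const, nsmul_eq_mul]
          _ ≤ _ := mul_le_mul_of_nonneg_right (hX m) (Finset.sum_nonneg fun _ _ => hS _ _ _)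
    _ = _ := by simp only [Finset.mul_sum]

/-- Cauchy–Schwarz bound of a twisted average by correlations. -/
theorem norm_sum_twisted_sq_le (X Y : Finset (ZMod p)) (P Q φ : ZMod p → ZMod p)
    (f g : ZMod p → ℂ) (hf : ∀ x, ‖f x‖ ≤ 1) (hg : ∀ x, ‖g x‖ ≤ 1) :
    ‖∑ x ∈ X, g x * ∑ y ∈ Y, f (x + P y) * ZMod.stdAddChar (φ x * Q y)‖ ^ 2 ≤
      p * ∑ x ∈ X, ∑ x' ∈ X, ‖curveCorrelation Y P Q (x' - x) (φ x) (φ x')‖ := by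
  set G : ZMod p → ℂ := fun z =>
    ∑ x ∈ X, ∑ y ∈ Y, if x + P y = z then g x * ZMod.stdAddChar (φ x * Q y) else 0 with hG
  have h1 : ∑ x ∈ X, g x * ∑ y ∈ Y, f (x + P y) * ZMod.stdAddChar (φ x * Q y) =
      ∑ z, f z * G z := by
    simp only [hG, Finset.mul_sum]
    conv_rhs => rw [Finset.sum_comm]
    refine Finset.sum_congr rfl fun x _ => ?_
    conv_rhs => rw [Finset.sum_comm]
    refine Finset.sum_congr rfl fun y _ => ?_
    simp only [mul_ite, mul_zero, Finset.sum_ite_eq, Finset.mem_univ, if_true]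
    ring
  have h2 : ((∑ z, ‖G z‖ ^ 2 : ℝ) : ℂ) = ∑ x ∈ X, ∑ x' ∈ X,
      g x * (starRingEnd ℂ) (g x') * curveCorrelation Y P Q (x' - x) (φ x) (φ x') := by
    push_cast
    have h3 : ∀ z, (‖G z‖ : ℂ) ^ 2 = ∑ x ∈ X, ∑ x' ∈ X, ∑ w ∈ Y ×ˢ Y,
        if x + P w.1 = z then if x' + P w.2 = z then
          g x * (starRingEnd ℂ) (g x') *
            (ZMod.stdAddChar (φ x * Q w.1 + φ x' * (-Q w.2)) : ℂ) else 0 else 0 := by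
      intro z
      rw [← Complex.mul_conj']
      simp only [hG, map_sum]
      rw [Finset.sum_mul_sum]
      refine Finset.sum_congr rfl fun x _ => Finset.sum_congr rfl fun x' _ => ?_
      rw [Finset.sum_mul_sum, Finset.sum_product]
      refine Finset.sum_congr rfl fun y _ => Finset.sum_congr rfl fun y' _ => ?_
      split_ifs
      · rw [map_mul (starRingEnd ℂ), ← AddChar.map_neg_eq_conj, AddChar.map_add_eq_mul, mul_neg]
        ring
      all_goals simp
    simp only [h3]
    rw [Finset.sum_comm]
    refine Finset.sum_congr rfl fun x _ => ?_
    rw [Finset.sum_comm]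
    refine Finset.sum_congr rfl fun x' _ => ?_
    rw [Finset.sum_comm, curveCorrelation, shiftedPairs, Finset.sum_filter, Finset.mul_sum]
    refine Finset.sum_congr rfl fun w _ => ?_
    rw [Finset.sum_ite_eq, if_pos (Finset.mem_univ _), mul_ite, mul_zero]
    refine if_congr ?_ rfl rfl
    constructor <;> intro h
    · linear_combination -h
    · linear_combination -h
  have h4 : ∑ z, ‖G z‖ ^ 2 ≤
      ∑ x ∈ X, ∑ x' ∈ X, ‖curveCorrelation Y P Q (x' - x) (φ x) (φ x')‖ := by
    have h5 : ‖((∑ z, ‖G z‖ ^ 2 : ℝ) : ℂ)‖ = ∑ z, ‖G z‖ ^ 2 := by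
      rw [Complex.norm_real, Real.norm_of_nonneg (Finset.sum_nonneg fun _ _ => sq_nonneg _)]
    rw [← h5, h2]
    refine (norm_sum_le _ _).trans (Finset.sum_le_sum fun x _ => (norm_sum_le _ _).trans
      (Finset.sum_le_sum fun x' _ => ?_))
    rw [norm_mul, norm_mul, RCLike.norm_conj]
    have := mul_le_one₀ (hg x) (norm_nonneg _) (hg x')
    exact mul_le_of_le_one_left (norm_nonneg _) this
  rw [h1]
  calc ‖∑ z, f z * G z‖ ^ 2 ≤ (∑ z, ‖G z‖) ^ 2 := by
        refine pow_le_pow_left₀ (norm_nonneg _) ((norm_sum_le _ _).trans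
          (Finset.sum_le_sum fun z _ => ?_)) 2
        rw [norm_mul]
        exact mul_le_of_le_one_left (norm_nonneg _) (hf z)
    _ ≤ (Finset.univ : Finset (ZMod p)).card * ∑ z, ‖G z‖ ^ 2 := sq_sum_le_card_mul_sum_sq
    _ ≤ _ := by
        rw [Finset.card_univ, ZMod.card]
        exact mul_le_mul_of_nonneg_left h4 (Nat.cast_nonneg _)

theorem norm_sum_small_pow_eight_le {Y : Finset (ZMod p)} {P Q : ZMod p → ZMod p} {K : ℕ}
    (hN : ∑ h : ZMod p, ((signedSolutions Y Q ×ˢ signedSolutions Y Q).filter fun w =>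
      ∀ i, P (w.1 i) = P (w.2 i) + h).card ≤ K * p ^ 3)
    (f g : ZMod p → ℂ) (hf : ∀ x, ‖f x‖ ≤ 1) (hg : ∀ x, ‖g x‖ ≤ 1) (φ : ZMod p → ZMod p) :
    ‖∑ x ∈ Finset.univ.filter fun x => φ x ∉ largeFrequencies φ,
      g x * ∑ y ∈ Y, f (x + P y) * ZMod.stdAddChar (φ x * Q y)‖ ^ 8 ≤
      K * √p * (p : ℝ) ^ 15 := by
  set X := Finset.univ.filter fun x => φ x ∉ largeFrequencies φ with hX
  have hp : (0 : ℝ) < p := Nat.cast_pos.2 (Fact.out : p.Prime).pos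
  have hfib : ∀ m, ((X.filter fun x => φ x = m).card : ℝ) ≤ √p := by
    intro m
    rcases (X.filter fun x => φ x = m).eq_empty_or_nonempty with h | ⟨x, hx⟩
    · rw [h, Finset.card_empty, Nat.cast_zero]
      positivity
    · rw [Finset.mem_filter, hX, Finset.mem_filter] at hx
      obtain ⟨⟨_, hx⟩, rfl⟩ := hx
      rw [largeFrequencies, Finset.mem_filter, not_and_or, not_or, not_lt] at hx
      refine le_trans ?_ (hx.resolve_left (fun h => h (Finset.mem_univ _))).2
      exact_mod_cast Finset.card_le_card (Finset.filter_subset_filter _ (Finset.subset_univ _))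
  set S : ZMod p → ZMod p → ℝ := fun x x' => ‖curveCorrelation Y P Q (x' - x) (φ x) (φ x')‖
    with hS
  have h1 : ∑ w ∈ X ×ˢ X, S w.1 w.2 ^ 4 ≤ √p * (K * (p : ℝ) ^ 5) := by
    rw [Finset.sum_product]
    refine (sum_pow_four_correlation_le X φ (√p) hfib
      (fun h m n => ‖curveCorrelation Y P Q h m n‖ ^ 4) fun _ _ _ => by positivity).trans ?_
    exact mul_le_mul_of_nonneg_left (sum_norm_curveCorrelation_pow_four_le hN)
      (Real.sqrt_nonneg _)
  have hcard : ((X ×ˢ X).card : ℝ) ≤ (p : ℝ) ^ 2 := by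
    have h := Finset.card_le_univ X
    rw [ZMod.card] at h
    rw [Finset.card_product, sq]
    exact_mod_cast Nat.mul_le_mul h h
  have hS0 : ∀ r : ℕ, 0 ≤ ∑ w ∈ X ×ˢ X, S w.1 w.2 ^ r := fun r =>
    Finset.sum_nonneg fun _ _ => pow_nonneg (norm_nonneg _) _
  have h2 : (∑ w ∈ X ×ˢ X, S w.1 w.2) ^ 4 ≤ (p : ℝ) ^ 6 * (√p * (K * (p : ℝ) ^ 5)) := by
    have h3 : (∑ w ∈ X ×ˢ X, S w.1 w.2) ^ 2 ≤ (p : ℝ) ^ 2 * ∑ w ∈ X ×ˢ X, S w.1 w.2 ^ 2 :=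
      sq_sum_le_card_mul_sum_sq.trans (mul_le_mul_of_nonneg_right hcard (hS0 2))
    have h4 : (∑ w ∈ X ×ˢ X, S w.1 w.2 ^ 2) ^ 2 ≤ (p : ℝ) ^ 2 * ∑ w ∈ X ×ˢ X, S w.1 w.2 ^ 4 := by
      refine sq_sum_le_card_mul_sum_sq.trans ?_
      simp only [← pow_mul]
      exact mul_le_mul_of_nonneg_right hcard (hS0 4)
    calc (∑ w ∈ X ×ˢ X, S w.1 w.2) ^ 4 = ((∑ w ∈ X ×ˢ X, S w.1 w.2) ^ 2) ^ 2 := by ring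
      _ ≤ ((p : ℝ) ^ 2 * ∑ w ∈ X ×ˢ X, S w.1 w.2 ^ 2) ^ 2 :=
          pow_le_pow_left₀ (sq_nonneg _) h3 2
      _ = (p : ℝ) ^ 4 * (∑ w ∈ X ×ˢ X, S w.1 w.2 ^ 2) ^ 2 := by ring
      _ ≤ (p : ℝ) ^ 4 * ((p : ℝ) ^ 2 * ∑ w ∈ X ×ˢ X, S w.1 w.2 ^ 4) :=
          mul_le_mul_of_nonneg_left h4 (by positivity)
      _ ≤ (p : ℝ) ^ 4 * ((p : ℝ) ^ 2 * (√p * (K * (p : ℝ) ^ 5))) := by gcongr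
      _ = _ := by ring
  have h5 := norm_sum_twisted_sq_le X Y P Q φ f g hf hg
  rw [← Finset.sum_product' X X S] at h5
  calc _ = (‖∑ x ∈ X, g x * ∑ y ∈ Y, f (x + P y) * ZMod.stdAddChar (φ x * Q y)‖ ^ 2) ^ 4 := by
        ring
    _ ≤ (p * ∑ w ∈ X ×ˢ X, S w.1 w.2) ^ 4 := pow_le_pow_left₀ (sq_nonneg _) h5 4
    _ = (p : ℝ) ^ 4 * (∑ w ∈ X ×ˢ X, S w.1 w.2) ^ 4 := by ring
    _ ≤ (p : ℝ) ^ 4 * ((p : ℝ) ^ 6 * (√p * (K * (p : ℝ) ^ 5))) := by gcongr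
    _ = _ := by ring

/-- Twisted averages along a curve are governed by the zero frequency. -/
theorem norm_sum_twisted_sub_le {Y : Finset (ZMod p)} {P Q : ZMod p → ZMod p} {K : ℕ}
    (hY : Yᶜ.card ≤ K)
    (hW : ∀ m n : ZMod p, ¬ (m = 0 ∧ n = 0) →
      ‖∑ y ∈ Y, (ZMod.stdAddChar (m * Q y + n * P y) : ℂ)‖ ≤ K * √p)
    (hN : ∑ h : ZMod p, ((signedSolutions Y Q ×ˢ signedSolutions Y Q).filter fun w =>
      ∀ i, P (w.1 i) = P (w.2 i) + h).card ≤ K * p ^ 3)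
    (f g : ZMod p → ℂ) (hf : ∀ x, ‖f x‖ ≤ 1) (hg : ∀ x, ‖g x‖ ≤ 1) (φ : ZMod p → ZMod p) :
    ‖∑ x, g x * (∑ y ∈ Y, f (x + P y) * ZMod.stdAddChar (φ x * Q y) -
      if φ x = 0 then ∑ a, f a else 0)‖ ≤ (3 * K + 1) * (p : ℝ) ^ ((2 : ℝ) - 1 / 640) := by
  have hp : (0 : ℝ) < p := Nat.cast_pos.2 (Fact.out : p.Prime).pos
  have hp1 : (1 : ℝ) ≤ p := Nat.one_le_cast.2 (Fact.out : p.Prime).one_le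
  set q : ℝ := (p : ℝ) ^ ((2 : ℝ) - 1 / 640) with hq
  have hq0 : 0 ≤ q := Real.rpow_nonneg hp.le _
  have hq2 : √p * (p : ℝ) ^ 3 ≤ q ^ 2 := by
    rw [hq, ← Real.rpow_natCast, ← Real.rpow_natCast, ← Real.rpow_mul hp.le, Real.sqrt_eq_rpow,
      ← Real.rpow_add hp]
    exact Real.rpow_le_rpow_of_exponent_le hp1 (by norm_num)
  have hq8 : √p * (p : ℝ) ^ 15 ≤ q ^ 8 := by
    rw [hq, ← Real.rpow_natCast, ← Real.rpow_natCast, ← Real.rpow_mul hp.le, Real.sqrt_eq_rpow,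
      ← Real.rpow_add hp]
    exact Real.rpow_le_rpow_of_exponent_le hp1 (by norm_num)
  clear_value q
  have hK : (0 : ℝ) ≤ K := Nat.cast_nonneg K
  rw [← Finset.sum_filter_add_sum_filter_not Finset.univ fun x => φ x ∈ largeFrequencies φ]
  refine (norm_add_le _ _).trans ?_
  have h1 : ‖∑ x ∈ Finset.univ.filter fun x => φ x ∈ largeFrequencies φ,
      g x * (∑ y ∈ Y, f (x + P y) * ZMod.stdAddChar (φ x * Q y) -
        if φ x = 0 then ∑ a, f a else 0)‖ ≤ 2 * K * q := by
    have h3 := sq_sum_large_le hY hW f hf φ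
    refine le_trans ((norm_sum_le _ _).trans (Finset.sum_le_sum fun x _ => ?_))
      (le_of_pow_le_pow_left₀ (n := 2) two_ne_zero (by positivity) (h3.trans ?_))
    · rw [norm_mul]
      exact mul_le_of_le_one_left (norm_nonneg _) (hg x)
    · nlinarith [mul_le_mul_of_nonneg_left hq2 (sq_nonneg (K : ℝ)),
        mul_nonneg (sq_nonneg (K : ℝ)) (sq_nonneg q)]
  have h2 : ‖∑ x ∈ Finset.univ.filter fun x => φ x ∉ largeFrequencies φ,
      g x * (∑ y ∈ Y, f (x + P y) * ZMod.stdAddChar (φ x * Q y) -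
        if φ x = 0 then ∑ a, f a else 0)‖ ≤ (K + 1) * q := by
    have h3 : ∑ x ∈ Finset.univ.filter fun x => φ x ∉ largeFrequencies φ,
      g x * (∑ y ∈ Y, f (x + P y) * ZMod.stdAddChar (φ x * Q y) -
        if φ x = 0 then ∑ a, f a else 0) =
        ∑ x ∈ Finset.univ.filter fun x => φ x ∉ largeFrequencies φ,
      g x * ∑ y ∈ Y, f (x + P y) * ZMod.stdAddChar (φ x * Q y) := by
      refine Finset.sum_congr rfl fun x hx => ?_
      rw [if_neg, sub_zero]
      intro h
      refine (Finset.mem_filter.1 hx).2 ?_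
      rw [largeFrequencies, Finset.mem_filter]
      exact ⟨Finset.mem_univ _, Or.inl h⟩
    rw [h3]
    refine le_of_pow_le_pow_left₀ (n := 8) (by norm_num) (by positivity)
      ((norm_sum_small_pow_eight_le hN f g hf hg φ).trans ?_)
    rw [mul_assoc, mul_pow]
    refine mul_le_mul ?_ hq8 (by positivity) (by positivity)
    have h4 : (K : ℝ) + 1 ≤ (K + 1) ^ 8 := le_self_pow₀ (by linarith) (by norm_num)
    linarith
  linarith

end Averages

section Reduction

theorem exists_int_multiple (f : ℚ[X]) :
    ∃ n : ℕ, n ≠ 0 ∧ ∃ a : ℤ[X], a.map (Int.castRingHom ℚ) = C (n : ℚ) * f := by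
  obtain ⟨b, hbm, hb⟩ := IsLocalization.integerNormalization_spec (nonZeroDivisors ℤ) f
  have hb0 : b ≠ 0 := nonZeroDivisors.ne_zero hbm
  refine ⟨b.natAbs, Int.natAbs_ne_zero.2 hb0,
    C b.sign * IsLocalization.integerNormalization (nonZeroDivisors ℤ) f, ?_⟩
  have h1 : (algebraMap ℤ ℚ) = Int.castRingHom ℚ := rfl
  rw [h1] at hb
  rw [Polynomial.map_mul, hb, Polynomial.map_C]
  have h2 : ((b.natAbs : ℕ) : ℚ) = (b.sign : ℚ) * (b : ℚ) := by
    rw [← Int.cast_mul, Int.sign_mul_self_eq_natAbs, Int.cast_natCast]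
  rw [h2, C_mul, mul_assoc]
  congr 1
  ext i
  simp

theorem exists_int_multiples {ι : Type*} [Fintype ι] (f : ι → ℚ[X]) :
    ∃ n : ℕ, n ≠ 0 ∧ ∃ a : ι → ℤ[X], ∀ k, (a k).map (Int.castRingHom ℚ) = C (n : ℚ) * f k := by
  classical
  choose n hn a ha using fun k => exists_int_multiple (f k)
  refine ⟨∏ k, n k, Finset.prod_ne_zero_iff.2 fun k _ => hn k,
    fun k => C (((∏ j ∈ Finset.univ.erase k, n j : ℕ)) : ℤ) * a k, fun k => ?_⟩
  rw [Polynomial.map_mul, ha, Polynomial.map_C, ← mul_assoc, ← C_mul,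
    ← Finset.prod_erase_mul Finset.univ n (Finset.mem_univ k)]
  simp

theorem ratRed_eq {p : ℕ} [Fact p.Prime] {n : ℕ} {q : ℚ} {k : ℤ} (hq : ¬ p ∣ q.den)
    (h : (k : ℚ) = n * q) : (k : ZMod p) = n * ratRed p q := by
  have h1 : k * (q.den : ℤ) = n * q.num := by
    have h2 : (q.den : ℚ) ≠ 0 := Nat.cast_ne_zero.2 q.den_nz
    have h3 : (k : ℚ) * q.den = n * q.num := by
      rw [h, mul_assoc, Rat.mul_den_eq_num]
    exact_mod_cast h3
  have h2 : (q.den : ZMod p) ≠ 0 := by rwa [Ne, ZMod.natCast_eq_zero_iff]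
  have h3 := congrArg (Int.cast : ℤ → ZMod p) h1
  push_cast at h3
  rw [ratRed, ← mul_assoc, eq_mul_inv_iff_mul_eq₀ h2, h3]

theorem coeff_polyRed (p : ℕ) (f : ℚ[X]) (i : ℕ) :
    (polyRed p f).coeff i = ratRed p (f.coeff i) := by
  rw [polyRed, Polynomial.sum_def, finsetSum_coeff]
  simp only [coeff_C_mul, coeff_X_pow, mul_ite, mul_one, mul_zero, Finset.sum_ite_eq]
  split_ifs with h
  · rfl
  · rw [notMem_support_iff.1 h]
    simp [ratRed]

theorem intEval_eq_mul_eval_polyRed {p : ℕ} [Fact p.Prime] {n : ℕ} {f : ℚ[X]} {a : ℤ[X]}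
    (hf : ∀ i, ¬ p ∣ (f.coeff i).den) (ha : a.map (Int.castRingHom ℚ) = C (n : ℚ) * f)
    (y : ZMod p) : intEval y a = n * (polyRed p f).eval y := by
  have h : a.map (Int.castRingHom (ZMod p)) = C (n : ZMod p) * polyRed p f := by
    ext i
    have h1 := congrArg (fun g => g.coeff i) ha
    simp only [coeff_map, coeff_C_mul, eq_intCast] at h1
    rw [coeff_map, coeff_C_mul, coeff_polyRed, eq_intCast]
    exact ratRed_eq (hf i) h1
  rw [intEval_eq_eval_map, h, eval_mul, eval_C]

theorem linearIndependent_common_denominator {P Q : RatFunc ℚ}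
    (hPQ : LinearIndependent ℚ ![P, Q, (1 : RatFunc ℚ)]) {x y z : ℚ}
    (h : C x * (P.num * Q.denom) + C y * (P.denom * Q.denom) + C z * (Q.num * P.denom) = 0) :
    x = 0 ∧ y = 0 ∧ z = 0 := by
  set α := algebraMap ℚ[X] (RatFunc ℚ) with hα
  have hinj : Function.Injective α := RatFunc.algebraMap_injective ℚ
  have hP0 : α P.denom ≠ 0 := fun h0 => P.denom_ne_zero (hinj (by rw [h0, map_zero]))
  have hQ0 : α Q.denom ≠ 0 := fun h0 => Q.denom_ne_zero (hinj (by rw [h0, map_zero]))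
  have hP : α P.num = P * α P.denom := by
    rw [← div_eq_iff hP0]; exact RatFunc.num_div_denom P
  have hQ : α Q.num = Q * α Q.denom := by
    rw [← div_eq_iff hQ0]; exact RatFunc.num_div_denom Q
  have h1 := congrArg α h
  simp only [map_add, map_mul, map_zero, hP, hQ] at h1
  have h2 : ∀ c : ℚ, α (C c) = (c : RatFunc ℚ) := fun c => eq_ratCast (α.comp C) c
  simp only [h2] at h1
  have h3 := Fintype.linearIndependent_iff.1 hPQ ![x, z, y] (by
    simp only [Fin.sum_univ_three, Matrix.cons_val, Rat.smul_def, mul_one]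
    refine (mul_eq_zero.1 ?_).resolve_right (mul_ne_zero hP0 hQ0)
    linear_combination h1)
  exact ⟨h3 0, h3 2, h3 1⟩

end Reduction

section Corners

variable {p : ℕ} [Fact p.Prime]

theorem ep_eq_stdAddChar (x : ZMod p) : ep p x = ZMod.stdAddChar x := by
  rw [ZMod.stdAddChar_apply, ZMod.toCircle_apply, ep]

theorem norm_inv_mul_sum_le {f : ZMod p → ℂ} (hf : ∀ x, ‖f x‖ ≤ 1) :
    ‖(p : ℂ)⁻¹ * ∑ x, f x‖ ≤ 1 := by
  have hp : (0 : ℝ) < p := Nat.cast_pos.2 (Fact.out : p.Prime).pos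
  rw [norm_mul, norm_inv, Complex.norm_natCast, inv_mul_le_iff₀ hp, mul_one]
  calc ‖∑ x, f x‖ ≤ ∑ _x : ZMod p, (1 : ℝ) := norm_sum_le_of_le _ fun x _ => hf x
    _ = p := by simp [ZMod.card]

theorem norm_cornerAvg_le (P Q : RatFunc ℚ) {f0 f1 f2 : ZMod p × ZMod p → ℂ}
    (h0 : OneBounded f0) (h1 : OneBounded f1) (h2 : OneBounded f2) :
    ‖cornerAvg p P Q f0 f1 f2‖ ≤ 1 := by
  have h : cornerAvg p P Q f0 f1 f2 = (p : ℂ)⁻¹ * ∑ x1 : ZMod p, (p : ℂ)⁻¹ * ∑ x2 : ZMod p,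
      (p : ℂ)⁻¹ * ∑ y : ZMod p, if ¬ IsPole p P y ∧ ¬ IsPole p Q y then
      f0 (x1, x2) * f1 (x1 + evalRed p P y, x2) * f2 (x1, x2 + evalRed p Q y) else 0 := by
    simp only [cornerAvg, ← Finset.mul_sum]
    ring
  rw [h]
  refine norm_inv_mul_sum_le fun x1 => norm_inv_mul_sum_le fun x2 => norm_inv_mul_sum_le fun y => ?_
  split_ifs
  · rw [norm_mul, norm_mul]
    exact mul_le_one₀ (mul_le_one₀ (h0 _) (norm_nonneg _) (h1 _)) (norm_nonneg _) (h2 _)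
  · simp

theorem norm_mainTerm_le {f0 f1 f2 : ZMod p × ZMod p → ℂ}
    (h0 : OneBounded f0) (h1 : OneBounded f1) (h2 : OneBounded f2) :
    ‖mainTerm p f0 f1 f2‖ ≤ 1 := by
  have h : mainTerm p f0 f1 f2 = (p : ℂ)⁻¹ * ∑ x1 : ZMod p, (p : ℂ)⁻¹ * ∑ x2 : ZMod p,
      f0 (x1, x2) * ((p : ℂ)⁻¹ * ∑ a : ZMod p, f1 (a, x2)) *
        ((p : ℂ)⁻¹ * ∑ b : ZMod p, f2 (x1, b)) := by
    rw [mainTerm, ← Finset.mul_sum]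
    ring
  rw [h]
  refine norm_inv_mul_sum_le fun x1 => norm_inv_mul_sum_le fun x2 => ?_
  rw [norm_mul, norm_mul]
  exact mul_le_one₀ (mul_le_one₀ (h0 _) (norm_nonneg _) (norm_inv_mul_sum_le fun _ => h1 _))
    (norm_nonneg _) (norm_inv_mul_sum_le fun _ => h2 _)

/-- For an eigenfunction `f2`, the counting operator minus its main term is an average over `x2`
of one-dimensional twisted averages. -/
theorem cornerAvg_sub_mainTerm_eq {P Q : RatFunc ℚ} {Y : Finset (ZMod p)} {P' Q' : ZMod p → ZMod p}
    (hY : ∀ y, y ∈ Y ↔ ¬ IsPole p P y ∧ ¬ IsPole p Q y) (hP : ∀ y ∈ Y, evalRed p P y = P' y)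
    (hQ : ∀ y ∈ Y, evalRed p Q y = Q' y) (f0 f1 f2 : ZMod p × ZMod p → ℂ)
    {u : ZMod p → ℂ} {φ : ZMod p → ZMod p}
    (hf2 : ∀ x1 x2, f2 (x1, x2) = u x1 * ZMod.stdAddChar (φ x1 * x2)) :
    cornerAvg p P Q f0 f1 f2 - mainTerm p f0 f1 f2 = (p : ℂ)⁻¹ ^ 3 * ∑ x2, ∑ x1,
      (f0 (x1, x2) * f2 (x1, x2)) *
        (∑ y ∈ Y, f1 (x1 + P' y, x2) * ZMod.stdAddChar (φ x1 * Q' y) -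
          if φ x1 = 0 then ∑ a, f1 (a, x2) else 0) := by
  have hp : (p : ℂ) ≠ 0 := Nat.cast_ne_zero.2 (Fact.out : p.Prime).ne_zero
  have h1 : mainTerm p f0 f1 f2 = (p : ℂ)⁻¹ ^ 3 * ∑ x1, ∑ x2, f0 (x1, x2) * f2 (x1, x2) *
      if φ x1 = 0 then ∑ a, f1 (a, x2) else 0 := by
    rw [mainTerm, pow_succ _ 2, mul_assoc]
    refine congrArg ((p : ℂ)⁻¹ ^ 2 * ·) ?_
    rw [Finset.mul_sum]
    refine Finset.sum_congr rfl fun x1 _ => ?_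
    conv_rhs => rw [Finset.mul_sum]
    refine Finset.sum_congr rfl fun x2 _ => ?_
    have h2 : (p : ℂ)⁻¹ * ∑ b, f2 (x1, b) = if φ x1 = 0 then u x1 else 0 := by
      simp only [hf2, mul_comm (φ x1), ← Finset.mul_sum, sum_stdAddChar_mul]
      split_ifs
      · field_simp
      · simp
    rw [h2, hf2]
    split_ifs with h
    · rw [h, zero_mul, AddChar.map_zero_eq_one]
      ring
    · simp
  have h2 : cornerAvg p P Q f0 f1 f2 = (p : ℂ)⁻¹ ^ 3 * ∑ x1, ∑ x2, f0 (x1, x2) * f2 (x1, x2) *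
      ∑ y ∈ Y, f1 (x1 + P' y, x2) * ZMod.stdAddChar (φ x1 * Q' y) := by
    rw [cornerAvg]
    congr 1
    refine Finset.sum_congr rfl fun x1 _ => Finset.sum_congr rfl fun x2 _ => ?_
    rw [← Finset.sum_filter, Finset.mul_sum]
    have h3 : (Finset.univ.filter fun y => ¬ IsPole p P y ∧ ¬ IsPole p Q y) = Y := by
      ext y
      rw [Finset.mem_filter, hY]
      exact and_iff_right (Finset.mem_univ _)
    rw [h3]
    refine Finset.sum_congr rfl fun y hy => ?_
    rw [hP y hy, hQ y hy, hf2, hf2, mul_add, AddChar.map_add_eq_mul]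
    ring
  rw [h1, h2, ← mul_sub, ← Finset.sum_sub_distrib, Finset.sum_comm' (t' := Finset.univ)
    (s' := fun _ => Finset.univ) (by simp)]
  congr 1
  simp only [← Finset.sum_sub_distrib, mul_sub]

theorem evalRed_eq_div {P : RatFunc ℚ} {n : ℕ} (hn : (n : ZMod p) ≠ 0) (hP : Admissible p P)
    {a b : ℤ[X]} (ha : a.map (Int.castRingHom ℚ) = C (n : ℚ) * P.num)
    (hb : b.map (Int.castRingHom ℚ) = C (n : ℚ) * P.denom) (y : ZMod p) :
    evalRed p P y = intEval y a / intEval y b := by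
  rw [intEval_eq_mul_eval_polyRed hP.1 ha, intEval_eq_mul_eval_polyRed hP.2 hb,
    mul_div_mul_left _ _ hn, evalRed, div_eq_mul_inv]

theorem isPole_iff {P : RatFunc ℚ} {n : ℕ} (hn : (n : ZMod p) ≠ 0) (hP : Admissible p P)
    {b : ℤ[X]} (hb : b.map (Int.castRingHom ℚ) = C (n : ℚ) * P.denom) (y : ZMod p) :
    IsPole p P y ↔ intEval y b = 0 := by
  rw [intEval_eq_mul_eval_polyRed hP.2 hb, mul_eq_zero, IsPole]
  exact ⟨Or.inr, fun h => h.resolve_left hn⟩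

end Corners

/-- **Theorem 5.4.(2).** Intermediate case of degree lowering: asymptotic formula for the
corner counting operator when `f₂` is an eigenfunction with respect to the second
coordinate. -/
theorem degree_lowering_step (P Q : RatFunc ℚ)
    (hPQ : LinearIndependent ℚ ![P, Q, (1 : RatFunc ℚ)]) :
    ∃ C : ℝ, 0 < C ∧ ∀ (p : ℕ) [Fact p.Prime],
      Admissible p P → Admissible p Q →
      ∀ f0 f1 f2 : ZMod p × ZMod p → ℂ,
        OneBounded f0 → OneBounded f1 → OneBounded f2 →
        IsEigen2 p f2 →
        ‖cornerAvg p P Q f0 f1 f2 - mainTerm p f0 f1 f2‖ ≤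
          C * (p : ℝ) ^ (-(1 : ℝ) / 640) := by
  classical
  obtain ⟨n, hn, a, ha⟩ := exists_int_multiples ![P.num, P.denom, Q.num, Q.denom]
  have ha0 : (a 0).map (Int.castRingHom ℚ) = Polynomial.C (n : ℚ) * P.num := ha 0
  have ha1 : (a 1).map (Int.castRingHom ℚ) = Polynomial.C (n : ℚ) * P.denom := ha 1
  have ha2 : (a 2).map (Int.castRingHom ℚ) = Polynomial.C (n : ℚ) * Q.num := ha 2
  have ha3 : (a 3).map (Int.castRingHom ℚ) = Polynomial.C (n : ℚ) * Q.denom := ha 3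
  obtain ⟨K, p₀, hK⟩ := exists_weil_and_count (a 0 * a 3) (a 1 * a 3) (a 2 * a 1) (by
    intro x y z h
    refine linearIndependent_common_denominator hPQ ?_
    simp only [Polynomial.map_mul, ha0, ha1, ha2, ha3] at h
    have hn' : (Polynomial.C (n : ℚ)) ^ 2 ≠ 0 :=
      pow_ne_zero 2 (Polynomial.C_ne_zero.2 (Nat.cast_ne_zero.2 hn))
    refine (mul_eq_zero.1 ?_).resolve_left hn'
    linear_combination h)
  refine ⟨3 * K + 1 + 2 * (p₀ + n), by positivity, ?_⟩
  intro p _ hadP hadQ f0 f1 f2 h0 h1 h2 hχ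
  have hp : (0 : ℝ) < p := Nat.cast_pos.2 (Fact.out : p.Prime).pos
  have hp1 : (1 : ℝ) ≤ p := Nat.one_le_cast.2 (Fact.out : p.Prime).one_le
  have hr : 0 ≤ (p : ℝ) ^ (-(1 : ℝ) / 640) := Real.rpow_nonneg hp.le _
  by_cases hbig : p ≤ p₀ + n
  · have h3 : ‖cornerAvg p P Q f0 f1 f2 - mainTerm p f0 f1 f2‖ ≤ 2 := by
      refine (norm_sub_le _ _).trans ?_
      have := norm_cornerAvg_le P Q h0 h1 h2
      have := norm_mainTerm_le h0 h1 h2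
      linarith
    have h4 : (p : ℝ) ^ (-1 : ℝ) ≤ (p : ℝ) ^ (-(1 : ℝ) / 640) :=
      Real.rpow_le_rpow_of_exponent_le hp1 (by norm_num)
    rw [Real.rpow_neg_one] at h4
    have h5 : (p : ℝ) ≤ p₀ + n := by exact_mod_cast hbig
    have h6 : 1 ≤ ((p₀ : ℝ) + n) * (p : ℝ) ^ (-(1 : ℝ) / 640) := by
      calc (1 : ℝ) = p * (p : ℝ)⁻¹ := (mul_inv_cancel₀ hp.ne').symm
        _ ≤ _ := mul_le_mul h5 h4 (by positivity) (by positivity)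
    have h7 : 0 ≤ (3 * (K : ℝ) + 1) * (p : ℝ) ^ (-(1 : ℝ) / 640) := by positivity
    linarith
  · have hnp : (n : ZMod p) ≠ 0 := by
      rw [Ne, ZMod.natCast_eq_zero_iff]
      exact fun h => hbig ((Nat.le_of_dvd (Nat.pos_of_ne_zero hn) h).trans (Nat.le_add_left _ _))
    set Y : Finset (ZMod p) := Finset.univ.filter fun y => intEval y (a 1 * a 3) ≠ 0 with hYdef
    have hYmem : ∀ y, y ∈ Y ↔ intEval y (a 1 * a 3) ≠ 0 := fun y => by simp [hYdef]
    clear_value Y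
    obtain ⟨hY, hW, hN⟩ := hK p (by omega) Y _ _ hYmem (fun _ => rfl) (fun _ => rfl)
    obtain ⟨E, φ, ψ, hχ⟩ := hχ
    have hf2 : ∀ x1 x2, f2 (x1, x2) =
        ((if x1 ∈ E then 1 else 0) * eC (ψ x1)) * ZMod.stdAddChar (φ x1 * x2) := by
      intro x1 x2
      rw [hχ, ep_eq_stdAddChar]
      ring
    have hYne : ∀ y ∈ Y, intEval y (a 1) ≠ 0 ∧ intEval y (a 3) ≠ 0 := fun y hy =>
      mul_ne_zero_iff.1 (by rw [← map_mul]; exact (hYmem y).1 hy)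
    rw [cornerAvg_sub_mainTerm_eq (Y := Y)
      (P' := fun y => intEval y (a 0 * a 3) / intEval y (a 1 * a 3))
      (Q' := fun y => intEval y (a 2 * a 1) / intEval y (a 1 * a 3)) ?_ ?_ ?_ f0 f1 f2 hf2, norm_mul, norm_pow, norm_inv,
      Complex.norm_natCast]
    rotate_left
    · intro y
      rw [hYmem, isPole_iff hnp hadP ha1, isPole_iff hnp hadQ ha3, map_mul, mul_ne_zero_iff]
    · intro y hy
      rw [evalRed_eq_div hnp hadP ha0 ha1, ← mul_div_mul_right _ _ (hYne y hy).2, ← map_mul,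
        ← map_mul]
    · intro y hy
      rw [evalRed_eq_div hnp hadQ ha2 ha3, ← mul_div_mul_right _ _ (hYne y hy).1, ← map_mul,
        ← map_mul, mul_comm (a 3)]
    have h3 : ∀ x2 : ZMod p, ‖∑ x1, (f0 (x1, x2) * f2 (x1, x2)) *
        (∑ y ∈ Y, f1 (x1 + intEval y (a 0 * a 3) / intEval y (a 1 * a 3), x2) *
          ZMod.stdAddChar (φ x1 * (intEval y (a 2 * a 1) / intEval y (a 1 * a 3))) -
          if φ x1 = 0 then ∑ a, f1 (a, x2) else 0)‖ ≤
        (3 * K + 1) * (p : ℝ) ^ ((2 : ℝ) - 1 / 640) := fun x2 =>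
      norm_sum_twisted_sub_le hY hW hN (fun x => f1 (x, x2)) (fun x => f0 (x, x2) * f2 (x, x2))
        (fun _ => h1 _) (fun _ => by
          rw [norm_mul]
          exact mul_le_one₀ (h0 _) (norm_nonneg _) (h2 _)) φ
    have h4 : (p : ℝ)⁻¹ ^ 3 * (p * ((3 * K + 1) * (p : ℝ) ^ ((2 : ℝ) - 1 / 640))) =
        (3 * K + 1) * (p : ℝ) ^ (-(1 : ℝ) / 640) := by
      have h5 : (p : ℝ) ^ ((2 : ℝ) - 1 / 640) = (p : ℝ) ^ 2 * (p : ℝ) ^ (-(1 : ℝ) / 640) := by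
        rw [← Real.rpow_natCast, ← Real.rpow_add hp]
        norm_num
      rw [h5]
      field_simp
    calc _ ≤ (p : ℝ)⁻¹ ^ 3 * (p * ((3 * K + 1) * (p : ℝ) ^ ((2 : ℝ) - 1 / 640))) := by
          refine mul_le_mul_of_nonneg_left ?_ (by positivity)
          refine (norm_sum_le_of_le _ fun x2 _ => h3 x2).trans ?_
          rw [Finset.sum_const, Finset.card_univ, ZMod.card, nsmul_eq_mul]
      _ ≤ _ := by
          rw [h4]
          refine mul_le_mul_of_nonneg_right ?_ hr
          have : (0 : ℝ) ≤ 2 * (p₀ + n) := by positivity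
          linarith

end RatCorners
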